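/- Let c = 1 − (1 + log log 2)/(log 2). Then for Lebesgue-almost all α > 0, the inequality δ_min^{(α)}(N) ≤ (log N)^{2c} / (N log N) holds for only finitely many N. -/

import Mathlib

open MeasureTheory Filter

/-- `log x`, read as `max {1, log x}`. -/
noncomputable def L (x : ℝ) : ℝ := max 1 (Real.log x)

/-- `log₂ x = log log x`, with the `max {1, ·}` convention. -/
noncomputable def LL (x : ℝ) : ℝ := L (L x)

/-- `lam` enumerates, in increasing order (for indices `k ≥ 1`), the spectrum
`{α m² + n² : m, n ≥ 1}` of the rectangular billiard. -/
def IsSpectrumEnum (α : ℝ) (lam : ℕ → ℝ) : Prop :=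
  (∀ j k : ℕ, 1 ≤ j → j < k → lam j < lam k) ∧ 0 < lam 1 ∧
    {x : ℝ | ∃ k : ℕ, 1 ≤ k ∧ lam k = x} =
      {x : ℝ | ∃ m n : ℕ, 1 ≤ m ∧ 1 ≤ n ∧ x = α * (m : ℝ) ^ 2 + (n : ℝ) ^ 2}

/-- `δ_min^{(α)}(N) = min {λ_{k+1} − λ_k : 1 ≤ k ≤ N}`. -/
noncomputable def bDeltaMin (lam : ℕ → ℝ) (N : ℕ) : ℝ :=
  sInf {x : ℝ | ∃ k : ℕ, 1 ≤ k ∧ k ≤ N ∧ x = lam (k + 1) - lam k}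

/-- The constant from the Erdős multiplication table problem. -/
noncomputable def erdosC : ℝ := 1 - (1 + Real.log (Real.log 2)) / Real.log 2

namespace BilliardGaps

open Finset

/-- The partial sum of the reciprocals of the primes up to `n`. -/
noncomputable def primeRecipSum (n : ℕ) : ℝ := ∑ p ∈ Nat.primesLE n, (1 : ℝ) / p

lemma sum_log_primes_le (F : Finset ℕ) {y : ℝ} (hy : 0 ≤ y)
    (hF : ∀ p ∈ F, p.Prime ∧ (p : ℝ) ≤ y) : ∑ p ∈ F, Real.log p ≤ Real.log 4 * y := by
  refine le_trans ?_ (Chebyshev.theta_le_log4_mul_x hy)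
  rw [Chebyshev.theta_eq_sum_primesLE]
  refine sum_le_sum_of_subset_of_nonneg (fun p hp => ?_) fun p _ _ => Real.log_natCast_nonneg p
  rw [Nat.mem_primesLE]
  exact ⟨Nat.le_floor (hF p hp).2, (hF p hp).1⟩

lemma log_four : Real.log 4 = 2 * Real.log 2 := by
  rw [show (4 : ℝ) = 2 ^ 2 by norm_num, Real.log_pow]; norm_num

lemma sum_log_div_le_dyadic (v : ℕ) {A : ℝ} (hA : 0 < A) :
    ∀ F : Finset ℕ, (∀ p ∈ F, p.Prime ∧ A < p ∧ (p : ℝ) ≤ 2 ^ v * A) →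
      ∑ p ∈ F, Real.log p / p ≤ v * (2 * Real.log 4) := by
  induction v with
  | zero =>
    intro F hF
    have : F = ∅ := by
      refine eq_empty_of_forall_notMem fun p hp => ?_
      have := hF p hp
      simp only [pow_zero, one_mul] at this
      linarith [this.2.1, this.2.2]
    simp [this]
  | succ v ih =>
    intro F hF
    rw [← sum_filter_add_sum_filter_not F (fun p : ℕ => (p : ℝ) ≤ 2 ^ v * A)]
    have h1 := ih (F.filter fun p : ℕ => (p : ℝ) ≤ 2 ^ v * A) (by
      intro p hp
      rw [mem_filter] at hp
      exact ⟨(hF p hp.1).1, (hF p hp.1).2.1, hp.2⟩)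
    have hpos : 0 < 2 ^ v * A := by positivity
    have h2 : ∑ p ∈ F.filter (fun p : ℕ => ¬ (p : ℝ) ≤ 2 ^ v * A), Real.log p / p ≤ 2 * Real.log 4 := by
      calc ∑ p ∈ F.filter (fun p : ℕ => ¬ (p : ℝ) ≤ 2 ^ v * A), Real.log p / p
          ≤ ∑ p ∈ F.filter (fun p : ℕ => ¬ (p : ℝ) ≤ 2 ^ v * A), Real.log p / (2 ^ v * A) := by
            refine sum_le_sum fun p hp => ?_
            rw [mem_filter, not_le] at hp
            exact div_le_div_of_nonneg_left (Real.log_natCast_nonneg p) hpos hp.2.le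
        _ = (∑ p ∈ F.filter (fun p : ℕ => ¬ (p : ℝ) ≤ 2 ^ v * A), Real.log p) / (2 ^ v * A) := by
            rw [sum_div]
        _ ≤ (Real.log 4 * (2 ^ (v + 1) * A)) / (2 ^ v * A) := by
            gcongr
            refine sum_log_primes_le _ (by positivity) fun p hp => ?_
            rw [mem_filter] at hp
            exact ⟨(hF p hp.1).1, (hF p hp.1).2.2⟩
        _ = 2 * Real.log 4 := by field_simp; ring
    push_cast
    linarith

lemma sum_log_div_le (F : Finset ℕ) {A B : ℝ} (hA : 0 < A) (hAB : A ≤ B)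
    (hF : ∀ p ∈ F, p.Prime ∧ A < p ∧ (p : ℝ) ≤ B) :
    ∑ p ∈ F, Real.log p / p ≤ 4 * (1 + Real.log (B / A)) := by
  have h2 : 0 < Real.log 2 := Real.log_pos (by norm_num)
  have hl : 0 ≤ Real.log (B / A) := Real.log_nonneg (by rwa [one_le_div hA])
  set v := ⌈Real.log (B / A) / Real.log 2⌉₊ with hv
  have hv1 : (v : ℝ) < Real.log (B / A) / Real.log 2 + 1 := Nat.ceil_lt_add_one (by positivity)
  have hB : B ≤ 2 ^ v * A := by
    rw [← div_le_iff₀ hA, ← Real.log_le_log_iff (div_pos (by linarith) hA) (by positivity),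
      Real.log_pow, ← div_le_iff₀ h2]
    exact Nat.le_ceil _
  have := sum_log_div_le_dyadic v hA F fun p hp =>
    ⟨(hF p hp).1, (hF p hp).2.1, (hF p hp).2.2.trans hB⟩
  rw [log_four] at this
  have h3 : (v : ℝ) * Real.log 2 < Real.log (B / A) + Real.log 2 := by
    have := mul_lt_mul_of_pos_right hv1 h2
    rwa [add_mul, div_mul_cancel₀ _ h2.ne', one_mul] at this
  have : Real.log 2 < 1 := by linarith [Real.log_two_lt_d9]
  linarith

lemma sum_log_div_primesLE_le {n : ℕ} (hn : 1 ≤ n) :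
    ∑ p ∈ Nat.primesLE n, Real.log p / p ≤ Real.log n + 2 := by
  have hn0 : (0 : ℝ) < n := by exact_mod_cast hn
  have hdvd : ∏ p ∈ Nat.primesLE n, p ^ (n / p) ∣ n.factorial := by
    refine Finset.prod_dvd_of_isRelPrime (fun p hp q hq hpq => ?_) fun p hp => ?_
    · have hp' := (Nat.mem_primesLE.1 hp).2
      have hq' := (Nat.mem_primesLE.1 hq).2
      exact Nat.coprime_iff_isRelPrime.1 <| Nat.Coprime.pow _ _ ((Nat.coprime_primes hp' hq').2 hpq)
    · rw [Nat.mem_primesLE] at hp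
      rw [hp.2.pow_dvd_factorial_iff (lt_add_one _)]
      calc n / p = n / p ^ 1 := by simp
        _ ≤ ∑ i ∈ Ico 1 (Nat.log p n + 1), n / p ^ i := by
          refine single_le_sum (f := fun i => n / p ^ i) (fun _ _ => Nat.zero_le _) ?_
          rw [mem_Ico]
          exact ⟨le_rfl, Nat.lt_add_one_iff.2 (Nat.log_pos hp.2.one_lt hp.1)⟩
  have hle : ∏ p ∈ Nat.primesLE n, p ^ (n / p) ≤ n ^ n :=
    (Nat.le_of_dvd (Nat.factorial_pos n) hdvd).trans (Nat.factorial_le_pow n)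
  have h1 : ∑ p ∈ Nat.primesLE n, ((n / p : ℕ) : ℝ) * Real.log p ≤ n * Real.log n := by
    have h : (∏ p ∈ Nat.primesLE n, (p : ℝ) ^ (n / p)) ≤ (n : ℝ) ^ n := by exact_mod_cast hle
    have h' := Real.log_le_log (prod_pos fun p hp =>
      pow_pos (by exact_mod_cast (Nat.mem_primesLE.1 hp).2.pos) _) h
    rw [Real.log_prod (fun p hp => (pow_pos (by
      exact_mod_cast (Nat.mem_primesLE.1 hp).2.pos) _).ne')] at h'
    simpa [Real.log_pow] using h'
  have h2 : ∑ p ∈ Nat.primesLE n, Real.log p ≤ Real.log 4 * n :=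
    sum_log_primes_le _ hn0.le fun p hp => by
      rw [Nat.mem_primesLE] at hp
      exact ⟨hp.2, by exact_mod_cast hp.1⟩
  have h3 : (n : ℝ) * ∑ p ∈ Nat.primesLE n, Real.log p / p
      ≤ ∑ p ∈ Nat.primesLE n, ((n / p : ℕ) : ℝ) * Real.log p
        + ∑ p ∈ Nat.primesLE n, Real.log p := by
    rw [mul_sum, ← sum_add_distrib]
    refine sum_le_sum fun p hp => ?_
    have : (n : ℝ) / p ≤ (n / p : ℕ) + 1 := by
      rw [← Nat.floor_div_eq_div (K := ℝ)]
      exact (Nat.lt_floor_add_one _).le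
    have hl := Real.log_natCast_nonneg p
    calc (n : ℝ) * (Real.log p / p) = (n : ℝ) / p * Real.log p := by ring
      _ ≤ ((n / p : ℕ) + 1) * Real.log p := by gcongr
      _ = _ := by ring
  have h4 : Real.log 4 < 2 := by rw [log_four]; linarith [Real.log_two_lt_d9]
  have h5 : (n : ℝ) * ∑ p ∈ Nat.primesLE n, Real.log p / p ≤ n * (Real.log n + 2) := by nlinarith
  exact le_of_mul_le_mul_left h5 hn0

lemma primesLE_succ_sum (f : ℕ → ℝ) (n : ℕ) :
    ∑ p ∈ Nat.primesLE (n + 1), f p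
      = ∑ p ∈ Nat.primesLE n, f p + if (n + 1).Prime then f (n + 1) else 0 := by
  rw [Nat.primesLE_eq_filter_range, Nat.primesLE_eq_filter_range, sum_filter, sum_range_succ,
    sum_filter]

lemma exists_primeRecipSum_le :
    ∃ C : ℝ, ∀ n : ℕ, 2 ≤ n → primeRecipSum n ≤ Real.log (Real.log n) + C := by
  set A : ℕ → ℝ := fun n => ∑ p ∈ Nat.primesLE n, Real.log p / p with hA
  set Φ : ℕ → ℝ := fun n =>
    primeRecipSum n - A n / Real.log n + 2 / Real.log n - Real.log (Real.log n) with hΦ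
  have hstep : ∀ n : ℕ, 2 ≤ n → Φ (n + 1) ≤ Φ n := by
    intro n hn
    have hn' : (2 : ℝ) ≤ n := by exact_mod_cast hn
    have hl : 0 < Real.log n := Real.log_pos (by linarith)
    have hl' : 0 < Real.log ((n + 1 : ℕ) : ℝ) := Real.log_pos (by push_cast; linarith)
    have hll : Real.log n ≤ Real.log ((n + 1 : ℕ) : ℝ) :=
      Real.log_le_log (by linarith) (by push_cast; linarith)
    have hA1 : A n ≤ Real.log n + 2 := sum_log_div_primesLE_le (by omega)
    have hE : primeRecipSum (n + 1) - A (n + 1) / Real.log ((n + 1 : ℕ) : ℝ)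
        = primeRecipSum n - A n / Real.log ((n + 1 : ℕ) : ℝ) := by
      rw [hA, primeRecipSum, primeRecipSum]
      simp only [primesLE_succ_sum]
      split_ifs with h
      · field_simp
        ring
      · ring
    have hlog : 1 - Real.log n / Real.log ((n + 1 : ℕ) : ℝ)
        ≤ Real.log (Real.log ((n + 1 : ℕ) : ℝ)) - Real.log (Real.log n) := by
      rw [← Real.log_div hl'.ne' hl.ne']
      have := Real.one_sub_inv_le_log_of_pos (div_pos hl' hl)
      rwa [inv_div] at this
    have hdiff : A n * ((Real.log n)⁻¹ - (Real.log ((n + 1 : ℕ) : ℝ))⁻¹)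
        ≤ (Real.log n + 2) * ((Real.log n)⁻¹ - (Real.log ((n + 1 : ℕ) : ℝ))⁻¹) :=
      mul_le_mul_of_nonneg_right hA1 (sub_nonneg.2 (inv_anti₀ hl hll))
    have hexp : (Real.log n + 2) * ((Real.log n)⁻¹ - (Real.log ((n + 1 : ℕ) : ℝ))⁻¹)
        = 1 - Real.log n / Real.log ((n + 1 : ℕ) : ℝ)
          + (2 / Real.log n - 2 / Real.log ((n + 1 : ℕ) : ℝ)) := by
      field_simp
    simp only [hΦ]
    rw [hE]
    rw [hexp] at hdiff
    simp only [div_eq_mul_inv] at *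
    nlinarith
  have hmono : ∀ n : ℕ, 2 ≤ n → Φ n ≤ Φ 2 := by
    intro n hn
    induction n, hn using Nat.le_induction with
    | base => exact le_rfl
    | succ n hn ih => exact (hstep n hn).trans ih
  refine ⟨Φ 2 + (1 + 2 / Real.log 2), fun n hn => ?_⟩
  have hn' : (2 : ℝ) ≤ n := by exact_mod_cast hn
  have hl2 : 0 < Real.log 2 := Real.log_pos (by norm_num)
  have hl : Real.log 2 ≤ Real.log n := Real.log_le_log (by norm_num) hn'
  have h1 := hmono n hn
  have hA1 : A n ≤ Real.log n + 2 := sum_log_div_primesLE_le (by omega)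
  have h2 : A n / Real.log n ≤ 1 + 2 / Real.log 2 := by
    calc A n / Real.log n ≤ (Real.log n + 2) / Real.log n := by gcongr
      _ = 1 + 2 / Real.log n := by rw [add_div, div_self (by linarith)]
      _ ≤ _ := by gcongr
  have h3 : 0 ≤ 2 / Real.log n := by positivity
  simp only [hΦ] at h1 ⊢
  linarith

lemma sum_inv_mul_pred_le (n : ℕ) :
    ∑ p ∈ Nat.primesLE n, (1 : ℝ) / (p * (p - 1)) ≤ 1 := by
  have hle : ∑ p ∈ Nat.primesLE n, (1 : ℝ) / (p * (p - 1))
      ≤ ∑ k ∈ range n, ((1 : ℝ) / (k + 1) - 1 / (k + 2)) := by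
    rw [show (∑ k ∈ range n, ((1 : ℝ) / (k + 1) - 1 / (k + 2)))
      = ∑ p ∈ Ico 2 (n + 2), (1 : ℝ) / (p * (p - 1)) by
        rw [sum_Ico_eq_sum_range]
        refine sum_congr (by simp) fun k _ => ?_
        push_cast
        have : (2 : ℝ) + k - 1 ≠ 0 := by rw [show (2 : ℝ) + k - 1 = k + 1 by ring]; positivity
        field_simp
        ring]
    refine sum_le_sum_of_subset_of_nonneg (fun p hp => ?_) fun p hp _ => ?_
    · rw [Nat.mem_primesLE] at hp
      exact mem_Ico.2 ⟨hp.2.two_le, by omega⟩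
    · have : (2 : ℝ) ≤ p := by exact_mod_cast (mem_Ico.1 hp).1
      exact div_nonneg zero_le_one (mul_nonneg (by linarith) (by linarith))
  refine hle.trans ?_
  have := sum_range_sub' (fun k : ℕ => (1 : ℝ) / (k + 1)) n
  have h2 : ∑ k ∈ range n, ((1 : ℝ) / (k + 1) - 1 / (k + 2)) = 1 - 1 / ((n : ℝ) + 1) := by
    rw [← show (1 : ℝ) / ((0 : ℕ) + 1) - 1 / ((n : ℝ) + 1) = 1 - 1 / ((n : ℝ) + 1) by simp, ← this]
    refine sum_congr rfl fun k _ => ?_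
    push_cast
    ring
  rw [h2]
  have : (0 : ℝ) ≤ 1 / ((n : ℝ) + 1) := by positivity
  linarith

lemma log_log_sub_one_le_primeRecipSum {n : ℕ} (hn : 2 ≤ n) :
    Real.log (Real.log n) - 1 ≤ primeRecipSum n := by
  have hn' : (2 : ℝ) ≤ n := by exact_mod_cast hn
  let f : ℕ →* ℝ :=
    { toFun := fun k => (k : ℝ)⁻¹
      map_one' := by simp
      map_mul' := fun a b => by push_cast; rw [mul_inv] }
  have hf : ∀ k : ℕ, f k = (k : ℝ)⁻¹ := fun k => rfl
  have hlt : ∀ {p : ℕ}, p.Prime → ‖f p‖ < 1 := by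
    intro p hp
    have : (1 : ℝ) < p := by exact_mod_cast hp.one_lt
    simpa [hf] using inv_lt_one_of_one_lt₀ this
  obtain ⟨hs, hsum⟩ :=
    EulerProduct.summable_and_hasSum_smoothNumbers_prod_primesBelow_geometric hlt (n + 1)
  have hge : Real.log n ≤ ∏ p ∈ Nat.primesLE n, (1 - f p)⁻¹ := by
    have h1 := log_le_harmonic_floor (n : ℝ) (by linarith)
    rw [Nat.floor_natCast, harmonic_eq_sum_Icc] at h1
    refine h1.trans ?_
    have h2 : ∀ k ∈ Icc 1 n, k ∈ (n + 1).smoothNumbers := fun k hk => by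
      rw [mem_Icc] at hk
      exact Nat.mem_smoothNumbers_of_lt (by omega) (by omega)
    have h3 := hsum.summable.sum_le_tsum ((Icc 1 n).attach.map
      ⟨fun k => (⟨k.1, h2 k.1 k.2⟩ : (n + 1).smoothNumbers), fun a b h => by
        exact Subtype.ext (congrArg (fun z : (n + 1).smoothNumbers => (z : ℕ)) h)⟩)
      (fun i _ => by rw [hf]; positivity)
    rw [hsum.tsum_eq, sum_map] at h3
    refine le_trans (le_of_eq ?_) h3
    push_cast
    rw [← sum_attach]
    rfl
  have hup : ∏ p ∈ Nat.primesLE n, (1 - f p)⁻¹ ≤ Real.exp (primeRecipSum n + 1) := by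
    calc ∏ p ∈ Nat.primesLE n, (1 - f p)⁻¹
        ≤ ∏ p ∈ Nat.primesLE n, Real.exp (1 / p + 1 / (p * (p - 1))) := by
          refine prod_le_prod (fun p hp => ?_) fun p hp => ?_
          · have := hlt (Nat.mem_primesLE.1 hp).2
            rw [inv_nonneg]
            linarith [(abs_lt.1 this).2]
          · have h2 : (2 : ℝ) ≤ p := by exact_mod_cast (Nat.mem_primesLE.1 hp).2.two_le
            refine le_trans (le_of_eq ?_) (Real.add_one_le_exp _)
            rw [hf]
            have : (p : ℝ) - 1 ≠ 0 := by linarith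
            field_simp
            ring
      _ = Real.exp (∑ p ∈ Nat.primesLE n, (1 / (p : ℝ) + 1 / (p * (p - 1)))) := by
          rw [Real.exp_sum]
      _ ≤ _ := by
          rw [Real.exp_le_exp, sum_add_distrib, primeRecipSum]
          linarith [sum_inv_mul_pred_le n]
  have hl : 0 < Real.log n := Real.log_pos (by linarith)
  have := (Real.log_le_iff_le_exp hl).2 (hge.trans hup)
  linarith

lemma primeRecipSum_succ_le (n : ℕ) :
    primeRecipSum (n + 1) ≤ primeRecipSum n + 1 / ((n + 1 : ℕ) : ℝ) := by
  rw [primeRecipSum, primesLE_succ_sum, primeRecipSum]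
  split_ifs
  · exact le_rfl
  · have : (0 : ℝ) ≤ 1 / ((n + 1 : ℕ) : ℝ) := by positivity
    linarith

lemma primeRecipSum_mono : Monotone primeRecipSum := fun _ _ h =>
  sum_le_sum_of_subset_of_nonneg (Nat.primesLE_mono h) fun _ _ _ => by positivity

lemma primeRecipSum_sub_le_log {a b : ℕ} (ha : 1 ≤ a) (hab : a ≤ b) :
    primeRecipSum b - primeRecipSum a ≤ Real.log b - Real.log a := by
  induction b, hab using Nat.le_induction with
  | base => simp
  | succ b hb ih =>
    have hb0 : (0 : ℝ) < b := by exact_mod_cast lt_of_lt_of_le ha hb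
    have h1 := primeRecipSum_succ_le b
    have h2 : 1 / ((b + 1 : ℕ) : ℝ) ≤ Real.log ((b + 1 : ℕ) : ℝ) - Real.log b := by
      have hb1 : (0 : ℝ) < ((b + 1 : ℕ) : ℝ) := by positivity
      rw [← Real.log_div hb1.ne' hb0.ne']
      refine le_trans (le_of_eq ?_) (Real.one_sub_inv_le_log_of_pos (div_pos hb1 hb0))
      push_cast
      field_simp
      ring
    linarith

lemma exists_lt_primeRecipSum (T : ℝ) : ∃ n : ℕ, T < primeRecipSum n := by
  have h : Filter.Tendsto (fun n : ℕ => Real.log (Real.log n)) Filter.atTop Filter.atTop :=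
    Real.tendsto_log_atTop.comp (Real.tendsto_log_atTop.comp tendsto_natCast_atTop_atTop)
  obtain ⟨n, hn, hn2⟩ := ((h.eventually_gt_atTop (T + 1)).and (Filter.eventually_ge_atTop 2)).exists
  exact ⟨n, by linarith [log_log_sub_one_le_primeRecipSum hn2]⟩

/-- The largest `y` for which the reciprocals of the primes in `(a, y]` sum to at most `log 2`. -/
noncomputable def blockEnd (a : ℕ) : ℕ :=
  sSup {y : ℕ | primeRecipSum y - primeRecipSum a ≤ Real.log 2}

lemma bddAbove_blockEnd (a : ℕ) :
    BddAbove {y : ℕ | primeRecipSum y - primeRecipSum a ≤ Real.log 2} := by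
  obtain ⟨n, hn⟩ := exists_lt_primeRecipSum (Real.log 2 + primeRecipSum a)
  refine ⟨n, fun y hy => ?_⟩
  by_contra! hlt
  have := primeRecipSum_mono hlt.le
  simp only [Set.mem_ofPred_eq] at hy
  linarith

lemma primeRecipSum_blockEnd_le (a : ℕ) :
    primeRecipSum (blockEnd a) - primeRecipSum a ≤ Real.log 2 :=
  Nat.sSup_mem (s := {y : ℕ | primeRecipSum y - primeRecipSum a ≤ Real.log 2})
    ⟨a, by simpa using Real.log_nonneg (by norm_num)⟩ (bddAbove_blockEnd a)

lemma two_mul_le_blockEnd {a : ℕ} (ha : 1 ≤ a) : 2 * a ≤ blockEnd a := by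
  refine le_csSup (bddAbove_blockEnd a) ?_
  have ha0 : (0 : ℝ) < a := by exact_mod_cast ha
  refine (primeRecipSum_sub_le_log ha (by omega)).trans (le_of_eq ?_)
  rw [← Real.log_div (by push_cast; positivity) ha0.ne']
  congr 1
  push_cast
  field_simp

lemma le_primeRecipSum_blockEnd (a : ℕ) :
    primeRecipSum a + Real.log 2 - 1 / ((blockEnd a + 1 : ℕ) : ℝ) ≤ primeRecipSum (blockEnd a) := by
  have h1 : ¬ primeRecipSum (blockEnd a + 1) - primeRecipSum a ≤ Real.log 2 := fun h => by
    have := le_csSup (bddAbove_blockEnd a) h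
    have h' : blockEnd a + 1 ≤ blockEnd a := this
    omega
  have h2 := primeRecipSum_succ_le (blockEnd a)
  push Not at h1
  linarith

/-- The end points of consecutive blocks of primes, each with reciprocal sum at most `log 2`. -/
noncomputable def blk : ℕ → ℕ
  | 0 => 1
  | j + 1 => blockEnd (blk j)

lemma blk_succ (j : ℕ) : blk (j + 1) = blockEnd (blk j) := rfl

lemma two_pow_le_blk (j : ℕ) : 2 ^ j ≤ blk j := by
  induction j with
  | zero => simp [blk]
  | succ j ih =>
    have := two_mul_le_blockEnd (a := blk j) (le_trans Nat.one_le_two_pow ih)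
    rw [blk_succ, pow_succ]
    omega

lemma blk_strictMono : StrictMono blk := strictMono_nat_of_lt_succ fun j => by
  have h1 : 1 ≤ blk j := le_trans Nat.one_le_two_pow (two_pow_le_blk j)
  have := two_mul_le_blockEnd h1
  rw [blk_succ]
  omega

lemma primeRecipSum_blk_le (j : ℕ) : primeRecipSum (blk j) ≤ j * Real.log 2 := by
  induction j with
  | zero => simp [blk, primeRecipSum]
  | succ j ih =>
    have := primeRecipSum_blockEnd_le (blk j)
    rw [blk_succ]
    push_cast
    linarith

lemma le_primeRecipSum_blk (j : ℕ) : j * Real.log 2 - 1 ≤ primeRecipSum (blk j) := by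
  have h : ∀ j : ℕ, j * Real.log 2 - 1 + (1 / 2 : ℝ) ^ j ≤ primeRecipSum (blk j) := by
    intro j
    induction j with
    | zero => simp [blk, primeRecipSum]
    | succ j ih =>
      have h1 := le_primeRecipSum_blockEnd (blk j)
      have h2 : 1 / ((blockEnd (blk j) + 1 : ℕ) : ℝ) ≤ (1 / 2 : ℝ) ^ (j + 1) := by
        rw [one_div_pow]
        refine one_div_le_one_div_of_le (by positivity) ?_
        have := two_pow_le_blk (j + 1)
        rw [blk_succ] at this
        exact_mod_cast this.trans (Nat.le_succ _)
      rw [blk_succ]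
      push_cast at *
      rw [pow_succ] at h2
      rw [pow_succ]
      linarith
  have h2 : (0 : ℝ) < (1 / 2) ^ j := by positivity
  linarith [h j]

lemma log_blk_le (j : ℕ) : Real.log (blk j) ≤ 3 * 2 ^ j := by
  rcases Nat.eq_zero_or_pos j with rfl | hj
  · simp [blk]
  have h2 : 2 ≤ blk j := by
    calc 2 = 2 ^ 1 := rfl
      _ ≤ 2 ^ j := Nat.pow_le_pow_right (by norm_num) hj
      _ ≤ _ := two_pow_le_blk j
  have hl : 0 < Real.log (blk j) := Real.log_pos (by exact_mod_cast h2)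
  have h1 := log_log_sub_one_le_primeRecipSum h2
  have h3 := primeRecipSum_blk_le j
  rw [← Real.log_pow] at h3
  calc Real.log (blk j) = Real.exp (Real.log (Real.log (blk j))) := (Real.exp_log hl).symm
    _ ≤ Real.exp (1 + Real.log (2 ^ j)) := by
      rw [Real.exp_le_exp]
      linarith
    _ = Real.exp 1 * 2 ^ j := by rw [Real.exp_add, Real.exp_log (by positivity)]
    _ ≤ _ := by
      gcongr
      linarith [Real.exp_one_lt_d9]

lemma exists_two_pow_le_log_blk :
    ∃ C : ℝ, 0 < C ∧ ∀ j : ℕ, 1 ≤ j → (2 : ℝ) ^ j ≤ C * Real.log (blk j) := by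
  obtain ⟨C, hC⟩ := exists_primeRecipSum_le
  refine ⟨Real.exp (1 + C), Real.exp_pos _, fun j hj => ?_⟩
  have h2 : 2 ≤ blk j := by
    calc 2 = 2 ^ 1 := rfl
      _ ≤ 2 ^ j := Nat.pow_le_pow_right (by norm_num) hj
      _ ≤ _ := two_pow_le_blk j
  have hl : 0 < Real.log (blk j) := Real.log_pos (by exact_mod_cast h2)
  have h1 := hC _ h2
  have h3 := le_primeRecipSum_blk j
  rw [← Real.log_pow] at h3
  calc (2 : ℝ) ^ j = Real.exp (Real.log (2 ^ j)) := (Real.exp_log (by positivity)).symm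
    _ ≤ Real.exp ((1 + C) + Real.log (Real.log (blk j))) := by
      rw [Real.exp_le_exp]
      linarith
    _ = _ := by rw [Real.exp_add, Real.exp_log hl]

lemma exists_blk_cover : ∃ C : ℝ, 0 < C ∧ ∀ M : ℝ, 2 ≤ M → ∃ J : ℕ, 1 ≤ J ∧ M ≤ blk J ∧
    (2 : ℝ) ^ J ≤ C * Real.log M ∧ Real.log M ≤ C * 2 ^ J := by
  obtain ⟨C, hC0, hC⟩ := exists_two_pow_le_log_blk
  refine ⟨max (2 * C) 3 + 3, by positivity, fun M hM => ?_⟩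
  have hlM : Real.log 2 ≤ Real.log M := Real.log_le_log (by norm_num) hM
  have hl2 := Real.log_two_gt_d9
  have hCm := le_max_left (2 * C) 3
  have hCm' := le_max_right (2 * C) 3
  have hex : ∃ j, M ≤ blk j := by
    obtain ⟨n, hn⟩ := exists_nat_ge M
    refine ⟨n, hn.trans ?_⟩
    exact_mod_cast Nat.lt_two_pow_self.le.trans (two_pow_le_blk n)
  classical
  have hspec := Nat.find_spec hex
  have hmin := fun {m} => Nat.find_min hex (m := m)
  set J := Nat.find hex
  have hJ : 1 ≤ J := by
    by_contra! h
    have h0 : J = 0 := by omega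
    rw [h0] at hspec
    simp only [blk, Nat.cast_one] at hspec
    linarith
  obtain ⟨i, hi⟩ : ∃ i, J = i + 1 := ⟨J - 1, by omega⟩
  have hlt : (blk i : ℝ) < M := by
    have := hmin (m := i) (by omega)
    push Not at this
    exact this
  refine ⟨J, hJ, hspec, ?_, ?_⟩
  · rcases Nat.eq_zero_or_pos i with rfl | hi0
    · rw [hi]
      norm_num
      nlinarith
    · have h1 := hC i hi0
      have hb : (1 : ℝ) ≤ blk i := by
        exact_mod_cast Nat.one_le_two_pow.trans (two_pow_le_blk i)
      have h2 : Real.log (blk i) ≤ Real.log M := Real.log_le_log (by linarith) hlt.le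
      rw [hi, pow_succ]
      calc (2 : ℝ) ^ i * 2 ≤ 2 * C * Real.log (blk i) := by linarith
        _ ≤ 2 * C * Real.log M := by gcongr
        _ ≤ _ := by
          refine mul_le_mul_of_nonneg_right (by linarith) (Real.log_nonneg (by linarith))
  · calc Real.log M ≤ Real.log (blk J) := Real.log_le_log (by linarith) hspec
      _ ≤ 3 * 2 ^ J := log_blk_le J
      _ ≤ _ := by gcongr; linarith

/-- The index `b` of the block `(blk b, blk (b + 1)]` containing `p`. -/
noncomputable def blockIdx (p : ℕ) : ℕ := sInf {j : ℕ | p ≤ blk (j + 1)}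

lemma blockIdx_lt_iff {p : ℕ} (hp : 2 ≤ p) (j : ℕ) : blockIdx p < j ↔ p ≤ blk j := by
  have hne : {j : ℕ | p ≤ blk (j + 1)}.Nonempty :=
    ⟨p, (Nat.lt_two_pow_self.le.trans (two_pow_le_blk p)).trans
      (blk_strictMono.monotone (Nat.le_succ p))⟩
  constructor
  · intro h
    have h0 : p ≤ blk (blockIdx p + 1) := Nat.sInf_mem hne
    exact h0.trans (blk_strictMono.monotone h)
  · intro h
    rcases j with _ | j
    · simp only [blk] at h
      omega
    · exact Nat.lt_succ_of_le (Nat.sInf_le h)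

lemma sum_inv_block_le (F : Finset ℕ) (b : ℕ) (hF : ∀ p ∈ F, p.Prime ∧ blockIdx p = b) :
    ∑ p ∈ F, (1 : ℝ) / p ≤ Real.log 2 := by
  refine le_trans ?_ (primeRecipSum_blockEnd_le (blk b))
  have hsub : Nat.primesLE (blk b) ⊆ Nat.primesLE (blockEnd (blk b)) :=
    Nat.primesLE_mono (blk_strictMono (Nat.lt_succ_self b)).le
  rw [primeRecipSum, primeRecipSum, ← sum_sdiff hsub, add_sub_cancel_right]
  refine sum_le_sum_of_subset_of_nonneg (fun p hp => ?_) fun _ _ _ => by positivity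
  obtain ⟨hp1, hp2⟩ := hF p hp
  have h1 := blockIdx_lt_iff hp1.two_le (b + 1)
  have h2 := blockIdx_lt_iff hp1.two_le b
  rw [Finset.mem_sdiff, Nat.mem_primesLE, Nat.mem_primesLE]
  exact ⟨⟨h1.1 (by omega), hp1⟩, fun h => by have := h2.2 h.1; omega⟩

/-- The number of elements of `S` in the `b`-th block. -/
noncomputable def blockCount (S : Finset ℕ) (b : ℕ) : ℕ := (S.filter fun p => blockIdx p = b).card

lemma log_prod_le_of_blockCount_le {S : Finset ℕ} {j Q : ℕ}
    (hS : ∀ p ∈ S, p.Prime ∧ blockIdx p < j) (hQ : ∀ b, blockCount S b ≤ Q) :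
    Real.log (∏ p ∈ S, (p : ℝ)) ≤ 6 * Q * 2 ^ j := by
  rw [Real.log_prod fun p hp => by exact_mod_cast (hS p hp).1.ne_zero]
  rw [← sum_fiberwise_of_maps_to (s := S) (t := range j) (g := blockIdx)
    fun p hp => mem_range.2 (hS p hp).2]
  have h1 : ∀ b ∈ range j, ∑ p ∈ S with blockIdx p = b, Real.log (p : ℝ)
      ≤ Q * (3 * 2 ^ (b + 1)) := by
    intro b _
    calc ∑ p ∈ S with blockIdx p = b, Real.log (p : ℝ)
        ≤ ∑ p ∈ S with blockIdx p = b, (3 * 2 ^ (b + 1) : ℝ) := by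
          refine sum_le_sum fun p hp => ?_
          rw [mem_filter] at hp
          have hp' := (hS p hp.1).1
          refine le_trans (Real.log_le_log (by exact_mod_cast hp'.pos) ?_) (log_blk_le (b + 1))
          exact_mod_cast (blockIdx_lt_iff hp'.two_le (b + 1)).1 (by omega)
      _ = blockCount S b * (3 * 2 ^ (b + 1)) := by
          rw [sum_const, nsmul_eq_mul, blockCount]
      _ ≤ _ := by
          gcongr
          exact hQ b
  refine (sum_le_sum h1).trans ?_
  have h2 : ∑ b ∈ range j, (2 : ℝ) ^ b ≤ 2 ^ j := by
    rw [geom_sum_eq (by norm_num)]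
    norm_num
  calc ∑ b ∈ range j, (Q : ℝ) * (3 * 2 ^ (b + 1)) = 6 * Q * ∑ b ∈ range j, (2 : ℝ) ^ b := by
        rw [mul_sum]
        refine sum_congr rfl fun b _ => ?_
        ring
    _ ≤ _ := by gcongr

open scoped Classical

/-- A map into the cyclic group such that for `1 ≤ T ≤ N`, fewer than `T` values lie
in the initial segment `{0, …, T - 1}`. -/
def IsParking {k : ℕ} (N : ℕ) (g : Fin k → ZMod N) : Prop :=
  ∀ T, 1 ≤ T → T ≤ N → #{r | (g r).val < T} < T

lemma card_filter_Ico_cast_eq {N : ℕ} [NeZero N] (x : ZMod N) (t T : ℕ) (hT : T ≤ N) :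
    #{n ∈ Ico t (t + T) | ((n : ℕ) : ZMod N) = x} = if (x - (t : ZMod N)).val < T then 1 else 0 := by
  have key : ∀ n, n < T → ((((t + n : ℕ) : ZMod N) = x) ↔ n = (x - (t : ZMod N)).val) := by
    intro n hn
    constructor
    · rintro rfl
      push_cast
      rw [add_sub_cancel_left, ZMod.val_natCast_of_lt (hn.trans_le hT)]
    · intro h
      rw [Nat.cast_add, h, ZMod.natCast_zmod_val]
      ring
  split_ifs with h
  · rw [card_eq_one]
    refine ⟨t + (x - (t : ZMod N)).val, ?_⟩
    ext n
    rw [mem_filter, mem_Ico, mem_singleton]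
    constructor
    · rintro ⟨⟨h1, h2⟩, h3⟩
      obtain ⟨n, rfl⟩ := Nat.exists_eq_add_of_le h1
      rw [(key n (by omega)).1 h3]
    · rintro rfl
      exact ⟨⟨by omega, by omega⟩, (key _ h).2 rfl⟩
  · rw [card_eq_zero, filter_eq_empty_iff]
    intro n hn h3
    rw [mem_Ico] at hn
    obtain ⟨n, rfl⟩ := Nat.exists_eq_add_of_le hn.1
    have := (key n (by omega)).1 h3
    omega

lemma card_isParking_rotations_le {k N : ℕ} [NeZero N] (g : Fin k → ZMod N) :
    #{c : ZMod N | IsParking N fun r => g r - c} ≤ N - k := by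
  set H : ℕ → ℤ := fun T => (∑ r, #{n ∈ range T | ((n : ℕ) : ZMod N) = g r} : ℕ) - T with hH
  have hstep : ∀ t T : ℕ, T ≤ N →
      H (t + T) = H t + #{r | (g r - (t : ZMod N)).val < T} - T := by
    intro t T hT
    have h1 : ∀ r, #{n ∈ range (t + T) | ((n : ℕ) : ZMod N) = g r}
        = #{n ∈ range t | ((n : ℕ) : ZMod N) = g r}
          + if (g r - (t : ZMod N)).val < T then 1 else 0 := by
      intro r
      rw [← card_filter_Ico_cast_eq (g r) t T hT, range_eq_Ico, range_eq_Ico,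
        ← Ico_union_Ico_eq_Ico (Nat.zero_le t) (Nat.le_add_right t T), filter_union,
        card_union_of_disjoint]
      exact disjoint_filter_filter (Ico_disjoint_Ico_consecutive _ _ _)
    simp only [hH]
    rw [sum_congr rfl fun r _ => h1 r, sum_add_distrib, card_filter]
    push_cast
    ring
  have hper : ∀ t, H (t + N) = H t + k - N := by
    intro t
    rw [hstep t N le_rfl, filter_true_of_mem fun r _ => ZMod.val_lt _]
    simp
  set 𝒢 : Finset (ZMod N) := {c : ZMod N | IsParking N fun r => g r - c} with h𝒢
  rcases 𝒢.eq_empty_or_nonempty with he | hne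
  · simp [he]
  have hdec : ∀ c ∈ 𝒢, ∀ T, 1 ≤ T → T ≤ N → H (c.val + T) < H c.val := by
    intro c hc T h1 h2
    rw [h𝒢, mem_filter] at hc
    have := hc.2 T h1 h2
    rw [hstep _ _ h2, ZMod.natCast_zmod_val]
    have : (#{r | (g r - c).val < T} : ℤ) < T := by exact_mod_cast this
    linarith
  have hlt : ∀ c ∈ 𝒢, ∀ d : ZMod N, c.val < d.val → H d.val < H c.val := by
    intro c hc d hcd
    have := hdec c hc (d.val - c.val) (by omega) (by have := ZMod.val_lt d; omega)
    rwa [Nat.add_sub_cancel' hcd.le] at this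
  obtain ⟨c₁, hc₁, hmin⟩ := exists_min_image 𝒢 ZMod.val hne
  have hcard : 𝒢.card ≤ (Ioc (H c₁.val + k - N) (H c₁.val)).card := by
    refine card_le_card_of_injOn (fun c => H c.val) ?_ ?_
    · intro c hc
      rw [mem_coe] at hc
      rw [mem_coe, mem_Ioc]
      constructor
      · rw [← hper]
        have := hdec c hc (c₁.val + N - c.val) (by have := ZMod.val_lt c; omega)
          (by have := hmin c hc; omega)
        rwa [Nat.add_sub_cancel' (by have := ZMod.val_lt c; omega)] at this
      · rcases (hmin c hc).eq_or_lt with h | h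
        · simp only [h, le_refl]
        · exact (hlt c₁ hc₁ c h).le
    · intro c hc d hd hcd
      simp only at hcd
      rcases lt_trichotomy c.val d.val with h | h | h
      · exact absurd hcd (hlt c hc d h).ne'
      · exact ZMod.val_injective N h
      · exact absurd hcd (hlt d hd c h).ne
  rw [Int.card_Ioc] at hcard
  omega

lemma card_isParking_mul_le (k N : ℕ) [NeZero N] :
    Nat.card {g : Fin k → ZMod N // IsParking N g} * N ≤ N ^ k * (N - k) := by
  rw [Nat.card_eq_fintype_card, Fintype.card_subtype]
  calc #{g : Fin k → ZMod N | IsParking N g} * N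
      = ∑ _c : ZMod N, #{g : Fin k → ZMod N | IsParking N g} := by
        rw [sum_const, card_univ, ZMod.card, smul_eq_mul, mul_comm]
    _ = ∑ c : ZMod N, #{g : Fin k → ZMod N | IsParking N fun r => g r - c} := by
        refine sum_congr rfl fun c _ => ?_
        refine card_bij' (fun g _ r => g r + c) (fun g _ r => g r - c) ?_ ?_ ?_ ?_
        · intro g hg
          simpa using hg
        · intro g hg
          simpa using hg
        · intro g _
          simp
        · intro g _
          simp
    _ = ∑ g : Fin k → ZMod N, #{c : ZMod N | IsParking N fun r => g r - c} := by
        simp only [card_filter]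
        rw [sum_comm]
    _ ≤ ∑ _g : Fin k → ZMod N, (N - k) := sum_le_sum fun g _ => card_isParking_rotations_le g
    _ = _ := by
        rw [sum_const, card_univ, Fintype.card_fun, ZMod.card, Fintype.card_fin, smul_eq_mul]

lemma card_prefix_le_mul_le (k J m : ℕ) :
    #{f ∈ Fintype.piFinset fun _ : Fin k => range J | ∀ j ≤ J, #{r | f r < j} ≤ j + m}
      * (J + m + 1) ≤ (J + m + 1) ^ k * (J + m + 1 - k) := by
  refine le_trans (Nat.mul_le_mul_right _ ?_) (card_isParking_mul_le k (J + m + 1))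
  rw [Nat.card_eq_fintype_card, Fintype.card_subtype]
  have hval : ∀ i < J, ((i + (m + 1) : ℕ) : ZMod (J + m + 1)).val = i + (m + 1) := fun i hi =>
    ZMod.val_natCast_of_lt (by omega)
  refine card_le_card_of_injOn (fun f r => ((f r + (m + 1) : ℕ) : ZMod (J + m + 1))) ?_ ?_
  · intro f hf
    rw [mem_coe, mem_filter, Fintype.mem_piFinset] at hf
    obtain ⟨hf1, hf2⟩ := hf
    rw [mem_coe, mem_filter]
    refine ⟨mem_univ _, fun T hT1 hT2 => ?_⟩
    have hc : #{r | (((f r + (m + 1) : ℕ) : ZMod (J + m + 1))).val < T}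
        = #{r | f r < T - (m + 1)} := by
      congr 1
      ext r
      rw [mem_filter, mem_filter, hval _ (mem_range.1 (hf1 r))]
      simp only [mem_univ, true_and]
      omega
    rw [hc]
    rcases le_or_gt T m with h | h
    · rw [filter_false_of_mem, card_empty]
      · omega
      · intro r _
        omega
    · have := hf2 (T - (m + 1)) (by omega)
      omega
  · intro f hf f' hf' h
    rw [mem_coe, mem_filter, Fintype.mem_piFinset] at hf hf'
    funext r
    have h1 := congrArg ZMod.val (congrFun h r)
    simp only [hval _ (mem_range.1 (hf.1 r)), hval _ (mem_range.1 (hf'.1 r))] at h1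
    omega

lemma sum_pow_card_fiber (k J b : ℕ) (y : ℝ) :
    ∑ f ∈ Fintype.piFinset fun _ : Fin k => range J, y ^ #{r | f r = b}
      = (∑ i ∈ range J, if i = b then y else 1) ^ k := by
  have h := prod_univ_sum (fun _ : Fin k => range J) (fun _ i => if i = b then y else (1 : ℝ))
  rw [prod_const, card_univ, Fintype.card_fin] at h
  rw [h]
  refine sum_congr rfl fun f _ => ?_
  rw [prod_ite, prod_const, prod_const_one, mul_one]

lemma card_large_fiber_le (k J q : ℕ) {y : ℝ} (hy : 1 ≤ y) :
    (#{f ∈ Fintype.piFinset fun _ : Fin k => range J | ∃ b, q ≤ #{r | f r = b} ∧ b < J} : ℝ)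
      ≤ J * (J + y) ^ k / y ^ q := by
  have hy0 : 0 < y := by linarith
  rw [le_div_iff₀ (by positivity)]
  set 𝒯 := Fintype.piFinset fun _ : Fin k => range J
  calc (#{f ∈ 𝒯 | ∃ b, q ≤ #{r | f r = b} ∧ b < J} : ℝ) * y ^ q
      = ∑ f ∈ 𝒯 with ∃ b, q ≤ #{r | f r = b} ∧ b < J, y ^ q := by
        rw [sum_const, nsmul_eq_mul]
    _ ≤ ∑ f ∈ 𝒯 with ∃ b, q ≤ #{r | f r = b} ∧ b < J, ∑ b ∈ range J, y ^ #{r | f r = b} := by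
        refine sum_le_sum fun f hf => ?_
        rw [mem_filter] at hf
        obtain ⟨b, hb1, hb2⟩ := hf.2
        refine (pow_le_pow_right₀ hy hb1).trans ?_
        exact single_le_sum (f := fun b => y ^ #{r | f r = b}) (fun _ _ => by positivity)
          (mem_range.2 hb2)
    _ ≤ ∑ f ∈ 𝒯, ∑ b ∈ range J, y ^ #{r | f r = b} :=
        sum_le_sum_of_subset_of_nonneg (filter_subset _ _) fun _ _ _ => by positivity
    _ = ∑ b ∈ range J, (∑ i ∈ range J, if i = b then y else 1) ^ k := by
        rw [sum_comm]
        exact sum_congr rfl fun b _ => sum_pow_card_fiber k J b y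
    _ ≤ ∑ b ∈ range J, (J + y) ^ k := by
        refine sum_le_sum fun b hb => ?_
        refine pow_le_pow_left₀ (sum_nonneg fun i _ => by split_ifs <;> linarith) ?_ k
        calc ∑ i ∈ range J, (if i = b then y else 1)
            ≤ ∑ i ∈ range J, ((1 : ℝ) + if i = b then y else 0) := by
              refine sum_le_sum fun i _ => ?_
              split_ifs <;> linarith
          _ = J + y := by
              rw [sum_add_distrib, sum_ite_eq' , if_pos hb]
              simp
    _ = _ := by simp

/-- Comparison of a sum over squarefree numbers with `k` prime factors with the number of
placements of `k` balls into `J` boxes. -/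
lemma sum_inv_prod_le {J k : ℕ} (Q : (ℕ → ℕ) → Prop) (𝒮 : Finset (Finset ℕ))
    (h : ∀ S ∈ 𝒮, (∀ p ∈ S, p.Prime ∧ blockIdx p < J) ∧ #S = k ∧ Q (blockCount S)) :
    ∑ S ∈ 𝒮, (∏ p ∈ S, (p : ℝ))⁻¹ ≤ Real.log 2 ^ k / k.factorial *
      #{f ∈ Fintype.piFinset fun _ : Fin k => range J | Q fun b => #{r | f r = b}} := by
  set P : Finset ℕ := 𝒮.biUnion id with hP
  have hPp : ∀ p ∈ P, p.Prime ∧ blockIdx p < J := by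
    intro p hp
    rw [hP, mem_biUnion] at hp
    obtain ⟨S, hS, hpS⟩ := hp
    exact (h S hS).1 p hpS
  set 𝒢 : Finset (Fin k → ℕ) := {g ∈ Fintype.piFinset fun _ => P |
    Function.Injective g ∧ univ.image g ∈ 𝒮} with h𝒢
  set 𝒻 : Finset (Fin k → ℕ) := {f ∈ Fintype.piFinset fun _ => range J |
    Q fun b => #{r | f r = b}} with h𝒻
  rw [div_mul_eq_mul_div, le_div_iff₀ (by positivity)]
  have hfib : ∀ S ∈ 𝒮, (k.factorial : ℝ) * (∏ p ∈ S, (p : ℝ))⁻¹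
      ≤ ∑ g ∈ 𝒢 with univ.image g = S, ∏ r, (1 : ℝ) / g r := by
    intro S hS
    have hcS := (h S hS).2.1
    have e : Fin k ≃ S := (S.equivFinOfCardEq hcS).symm
    have hk : k.factorial ≤ #{g ∈ 𝒢 | univ.image g = S} := by
      have h0 : k.factorial = #(univ : Finset (Equiv.Perm (Fin k))) := by
        rw [card_univ, Fintype.card_perm, Fintype.card_fin]
      rw [h0]
      refine card_le_card_of_injOn (fun σ r => (e (σ r) : ℕ)) ?_ ?_
      · intro σ _
        have hi : univ.image (fun r => (e (σ r) : ℕ)) = S := by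
          ext p
          simp only [mem_image, mem_univ, true_and]
          constructor
          · rintro ⟨r, rfl⟩
            exact (e (σ r)).2
          · intro hp
            exact ⟨σ.symm (e.symm ⟨p, hp⟩), by simp⟩
        rw [mem_coe, mem_filter, h𝒢, mem_filter, Fintype.mem_piFinset]
        refine ⟨⟨fun r => ?_, ?_, by rwa [hi]⟩, hi⟩
        · exact mem_biUnion.2 ⟨S, hS, (e (σ r)).2⟩
        · exact Subtype.val_injective.comp (e.injective.comp σ.injective)
      · intro σ _ τ _ hst
        ext r
        have := congrFun hst r
        simp only at this
        rw [e.injective (Subtype.val_injective this)]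
    calc (k.factorial : ℝ) * (∏ p ∈ S, (p : ℝ))⁻¹
        ≤ #{g ∈ 𝒢 | univ.image g = S} * (∏ p ∈ S, (p : ℝ))⁻¹ := by gcongr
      _ = ∑ g ∈ 𝒢 with univ.image g = S, (∏ p ∈ S, (p : ℝ))⁻¹ := by
          rw [sum_const, nsmul_eq_mul]
      _ = _ := by
          refine sum_congr rfl fun g hg => ?_
          rw [mem_filter, h𝒢, mem_filter] at hg
          rw [← hg.2, prod_image fun a _ b _ hab => hg.1.2.1 hab, ← prod_inv_distrib]
          simp
  have hmap : ∀ g ∈ 𝒢, (fun r => blockIdx (g r)) ∈ 𝒻 := by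
    intro g hg
    rw [h𝒢, mem_filter, Fintype.mem_piFinset] at hg
    rw [h𝒻, mem_filter, Fintype.mem_piFinset]
    refine ⟨fun r => mem_range.2 (hPp _ (hg.1 r)).2, ?_⟩
    convert (h _ hg.2.2).2.2 using 1
    funext b
    rw [blockCount, filter_image, card_image_of_injective _ hg.2.1]
  calc (∑ S ∈ 𝒮, (∏ p ∈ S, (p : ℝ))⁻¹) * k.factorial
      = ∑ S ∈ 𝒮, k.factorial * (∏ p ∈ S, (p : ℝ))⁻¹ := by rw [mul_comm, mul_sum]
    _ ≤ ∑ S ∈ 𝒮, ∑ g ∈ 𝒢 with univ.image g = S, ∏ r, (1 : ℝ) / g r := sum_le_sum hfib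
    _ = ∑ g ∈ 𝒢, ∏ r, (1 : ℝ) / g r := by
        refine sum_fiberwise_of_maps_to (fun g hg => ?_) _
        rw [h𝒢, mem_filter] at hg
        exact hg.2.2
    _ = ∑ f ∈ 𝒻, ∑ g ∈ 𝒢 with (fun r => blockIdx (g r)) = f, ∏ r, (1 : ℝ) / g r :=
        (sum_fiberwise_of_maps_to hmap _).symm
    _ ≤ ∑ f ∈ 𝒻, Real.log 2 ^ k := by
        refine sum_le_sum fun f _ => ?_
        calc ∑ g ∈ 𝒢 with (fun r => blockIdx (g r)) = f, ∏ r, (1 : ℝ) / g r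
            ≤ ∑ g ∈ Fintype.piFinset fun r => {p ∈ P | blockIdx p = f r}, ∏ r, (1 : ℝ) / g r := by
              refine sum_le_sum_of_subset_of_nonneg (fun g hg => ?_) fun _ _ _ => by positivity
              rw [mem_filter, h𝒢, mem_filter, Fintype.mem_piFinset] at hg
              rw [Fintype.mem_piFinset]
              exact fun r => mem_filter.2 ⟨hg.1.1 r, congrFun hg.2 r⟩
          _ = ∏ r, ∑ p ∈ P with blockIdx p = f r, (1 : ℝ) / p :=
              (prod_univ_sum (fun r => {p ∈ P | blockIdx p = f r})
                (fun _ p => (1 : ℝ) / (p : ℝ))).symm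
          _ ≤ ∏ _r : Fin k, Real.log 2 := by
              refine prod_le_prod (fun _ _ => sum_nonneg fun _ _ => by positivity) fun r _ => ?_
              refine sum_inv_block_le _ (f r) fun p hp => ?_
              rw [mem_filter] at hp
              exact ⟨(hPp p hp.1).1, hp.2⟩
          _ = _ := by simp
    _ = _ := by rw [sum_const, nsmul_eq_mul, mul_comm]

/-- The product of a finite set of natural numbers, as a real number. -/
noncomputable abbrev setProd (S : Finset ℕ) : ℝ := ∏ p ∈ S, (p : ℝ)

lemma one_le_setProd {S : Finset ℕ} (hS : ∀ p ∈ S, p.Prime) : 1 ≤ setProd S := by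
  have : 1 ≤ ∏ p ∈ S, p := Nat.one_le_iff_ne_zero.2 (prod_ne_zero_iff.2 fun p hp => (hS p hp).ne_zero)
  rw [setProd, ← Nat.cast_prod]
  exact_mod_cast this

lemma card_le_of_setProd_le (𝒜 : Finset (Finset ℕ)) {X : ℝ} (hX : 0 ≤ X)
    (h : ∀ S ∈ 𝒜, (∀ p ∈ S, p.Prime) ∧ setProd S ≤ X) : (#𝒜 : ℝ) ≤ X := by
  have h1 : #𝒜 ≤ #(Icc 1 ⌊X⌋₊) := by
    refine card_le_card_of_injOn (fun S => ∏ p ∈ S, p) ?_ ?_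
    · intro S hS
      obtain ⟨hS1, hS2⟩ := h S hS
      have h3 := one_le_setProd hS1
      rw [setProd, ← Nat.cast_prod] at h3 hS2
      rw [mem_coe, mem_Icc]
      exact ⟨by exact_mod_cast h3, Nat.le_floor hS2⟩
    · intro S hS T hT hST
      simp only at hST
      rw [← Nat.primeFactors_prod (h S hS).1, hST, Nat.primeFactors_prod (h T hT).1]
  rw [Nat.card_Icc, Nat.add_sub_cancel] at h1
  exact (Nat.cast_le.2 h1).trans (Nat.floor_le hX)

lemma sum_log_setProd_le (𝒜 : Finset (Finset ℕ)) {x : ℝ} (hx : 0 ≤ x)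
    (h : ∀ S ∈ 𝒜, (∀ p ∈ S, p.Prime) ∧ setProd S ≤ x) :
    ∑ S ∈ 𝒜, Real.log (setProd S) ≤ Real.log 4 * x * ∑ S ∈ 𝒜.shadow, (setProd S)⁻¹ := by
  have h1 : ∑ S ∈ 𝒜, Real.log (setProd S) = ∑ w ∈ 𝒜.sigma fun S => S, Real.log (w.2 : ℝ) := by
    rw [sum_sigma]
    refine sum_congr rfl fun S hS => ?_
    exact Real.log_prod fun p hp => by exact_mod_cast ((h S hS).1 p hp).ne_zero
  have hmap : ∀ w ∈ 𝒜.sigma fun S => S, w.1.erase w.2 ∈ 𝒜.shadow := by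
    intro w hw
    rw [mem_sigma] at hw
    exact erase_mem_shadow hw.1 hw.2
  rw [h1, ← sum_fiberwise_of_maps_to hmap, mul_sum]
  refine sum_le_sum fun T hT => ?_
  have hT1 : ∀ p ∈ T, p.Prime := by
    intro p hp
    obtain ⟨S, hS, a, _, rfl⟩ := mem_shadow_iff.1 hT
    exact (h S hS).1 p (mem_of_mem_erase hp)
  have hTp := one_le_setProd hT1
  rw [← sum_image (s := {w ∈ 𝒜.sigma fun S => S | w.1.erase w.2 = T})
    (g := fun w : (_ : Finset ℕ) × ℕ => w.2) (f := fun p : ℕ => Real.log (p : ℝ))]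
  · rw [mul_assoc, ← div_eq_mul_inv]
    refine sum_log_primes_le _ (by positivity) ?_
    intro p hp
    rw [mem_image] at hp
    obtain ⟨⟨S, q⟩, hw, rfl⟩ := hp
    rw [mem_filter, mem_sigma] at hw
    obtain ⟨⟨hS, hq⟩, rfl⟩ := hw
    simp only at hS hq hTp ⊢
    refine ⟨(h S hS).1 q hq, ?_⟩
    rw [le_div_iff₀ (by linarith), setProd, mul_prod_erase S (fun p => (p : ℝ)) hq]
    exact (h S hS).2
  · rintro ⟨S, p⟩ hw ⟨S', p'⟩ hw' hpp
    rw [mem_coe, mem_filter, mem_sigma] at hw hw'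
    simp only at hw hw' hpp
    subst hpp
    have : S = S' := by
      rw [← insert_erase hw.1.2, ← insert_erase hw'.1.2, hw.2, hw'.2]
    rw [this]

lemma card_le_shadow_sum (𝒜 : Finset (Finset ℕ)) {x : ℝ} (hx : 1 < x)
    (h : ∀ S ∈ 𝒜, (∀ p ∈ S, p.Prime) ∧ setProd S ≤ x) :
    (#𝒜 : ℝ) ≤ √x + 4 * (x / Real.log x) * ∑ S ∈ 𝒜.shadow, (setProd S)⁻¹ := by
  have hlx := Real.log_pos hx
  have h0 := card_filter_add_card_filter_not (s := 𝒜) (p := fun S => setProd S ≤ √x)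
  have h1 := card_le_of_setProd_le {S ∈ 𝒜 | setProd S ≤ √x} (Real.sqrt_nonneg x) (by
    intro S hS
    rw [mem_filter] at hS
    exact ⟨(h S hS.1).1, hS.2⟩)
  have h2 : (#{S ∈ 𝒜 | ¬ setProd S ≤ √x} : ℝ) * (Real.log x / 2)
      ≤ Real.log 4 * x * ∑ S ∈ 𝒜.shadow, (setProd S)⁻¹ := by
    refine le_trans ?_ (sum_log_setProd_le 𝒜 (by linarith) h)
    rw [← nsmul_eq_mul, ← sum_const]
    refine le_trans (sum_le_sum fun S hS => ?_) (sum_le_sum_of_subset_of_nonneg (filter_subset _ _)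
      fun S hS _ => Real.log_nonneg (one_le_setProd (h S hS).1))
    rw [mem_filter, not_le] at hS
    rw [← Real.log_sqrt (by linarith)]
    exact Real.log_le_log (Real.sqrt_pos.2 (by linarith)) hS.2.le
  have h3 : (#{S ∈ 𝒜 | ¬ setProd S ≤ √x} : ℝ)
      ≤ 4 * (x / Real.log x) * ∑ S ∈ 𝒜.shadow, (setProd S)⁻¹ := by
    have hs : 0 ≤ ∑ S ∈ 𝒜.shadow, (setProd S)⁻¹ := sum_nonneg fun S _ => by positivity
    have h4 : Real.log 4 * x * ∑ S ∈ 𝒜.shadow, (setProd S)⁻¹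
        ≤ 2 * x * ∑ S ∈ 𝒜.shadow, (setProd S)⁻¹ := by
      gcongr
      rw [log_four]
      have := Real.log_two_lt_d9
      linarith
    rw [← mul_le_mul_iff_left₀ (half_pos hlx)]
    refine (h2.trans h4).trans (le_of_eq ?_)
    field_simp
    ring
  rw [← h0]
  push_cast
  linarith

lemma sum_log_mul_log_le (R : Finset (ℕ × ℕ)) {a b M y : ℝ} (ha : 0 < a) (hb : 0 < b)
    (hM : 0 < M) (hy : 0 < y) (hyM : y ≤ M ^ 2)
    (hR : ∀ w ∈ R, w.1.Prime ∧ w.2.Prime ∧ w.1 * a ≤ M ∧ w.2 * b ≤ M ∧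
      (w.1 * a) * (w.2 * b) ≤ y) :
    ∑ w ∈ R, Real.log w.1 * Real.log w.2 ≤ 8 * (1 + Real.log (M ^ 2 / y)) * (y / (a * b)) := by
  have hlog4 : Real.log 4 ≤ 1.4 := by
    rw [log_four]
    have := Real.log_two_lt_d9
    linarith
  have hlog4' : 0 ≤ Real.log 4 := Real.log_nonneg (by norm_num)
  have hD : 0 ≤ Real.log (M ^ 2 / y) := Real.log_nonneg (by rwa [one_le_div hy])
  set P := R.image Prod.fst with hP
  have hlogp : ∀ p ∈ P, p.Prime ∧ p * a ≤ M := by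
    intro p hp
    obtain ⟨w, hw, rfl⟩ := mem_image.1 hp
    exact ⟨(hR w hw).1, (hR w hw).2.2.1⟩
  have hfib : ∀ p ∈ P, ∀ Y : ℝ, 0 ≤ Y → (∀ w ∈ R, w.1 = p → (w.2 : ℝ) ≤ Y) →
      ∑ w ∈ R with w.1 = p, Real.log w.1 * Real.log w.2 ≤ Real.log p * (Real.log 4 * Y) := by
    intro p hp Y hY h
    have h1 : ∑ w ∈ R with w.1 = p, Real.log w.1 * Real.log w.2
        = Real.log p * ∑ w ∈ R with w.1 = p, Real.log w.2 := by
      rw [mul_sum]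
      refine sum_congr rfl fun w hw => ?_
      rw [(mem_filter.1 hw).2]
    rw [h1, ← sum_image (s := {w ∈ R | w.1 = p}) (g := Prod.snd)
      (f := fun q : ℕ => Real.log (q : ℝ))]
    · refine mul_le_mul_of_nonneg_left (sum_log_primes_le _ hY ?_)
        (Real.log_natCast_nonneg p)
      intro q hq
      obtain ⟨w, hw, rfl⟩ := mem_image.1 hq
      rw [mem_filter] at hw
      exact ⟨(hR w hw.1).2.1, h w hw.1 hw.2⟩
    · intro w hw w' hw' hww
      rw [mem_coe, mem_filter] at hw hw'
      exact Prod.ext (hw.2.trans hw'.2.symm) hww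
  set A := y / (a * M) with hA
  have hA0 : 0 < A := by positivity
  rw [← sum_fiberwise_of_maps_to (t := P) (g := Prod.fst) fun w hw => mem_image_of_mem _ hw,
    ← sum_filter_add_sum_filter_not P (fun p : ℕ => (p : ℝ) ≤ A)]
  have hsmall : ∑ p ∈ P.filter (fun p : ℕ => (p : ℝ) ≤ A), ∑ w ∈ R with w.1 = p, Real.log w.1 * Real.log w.2
      ≤ 1.96 * (y / (a * b)) := by
    calc _ ≤ ∑ p ∈ P.filter (fun p : ℕ => (p : ℝ) ≤ A), Real.log p * (Real.log 4 * (M / b)) := by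
          refine sum_le_sum fun p hp => hfib p (mem_filter.1 hp).1 _ (by positivity) ?_
          intro w hw _
          rw [le_div_iff₀ hb]
          exact (hR w hw).2.2.2.1
      _ = (∑ p ∈ P.filter (fun p : ℕ => (p : ℝ) ≤ A), Real.log p) * (Real.log 4 * (M / b)) := by rw [sum_mul]
      _ ≤ (Real.log 4 * A) * (Real.log 4 * (M / b)) := by
          gcongr
          exact sum_log_primes_le _ hA0.le fun p hp =>
            ⟨(hlogp p (mem_filter.1 hp).1).1, (mem_filter.1 hp).2⟩
      _ ≤ (1.4 * A) * (1.4 * (M / b)) := by gcongr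
      _ = _ := by
          rw [hA]
          field_simp
          ring
  have hlarge : ∑ p ∈ P.filter (fun p : ℕ => ¬ (p : ℝ) ≤ A), ∑ w ∈ R with w.1 = p, Real.log w.1 * Real.log w.2
      ≤ 5.6 * (1 + Real.log (M ^ 2 / y)) * (y / (a * b)) := by
    calc _ ≤ ∑ p ∈ P.filter (fun p : ℕ => ¬ (p : ℝ) ≤ A), Real.log p * (Real.log 4 * (y / (p * a * b))) := by
          refine sum_le_sum fun p hp => hfib p (mem_filter.1 hp).1 _ (by positivity) ?_
          rintro w hw rfl
          have hw0 : (0 : ℝ) < w.1 := by exact_mod_cast (hR w hw).1.pos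
          rw [le_div_iff₀ (by positivity)]
          have := (hR w hw).2.2.2.2
          linarith
      _ = (∑ p ∈ P.filter (fun p : ℕ => ¬ (p : ℝ) ≤ A), Real.log p / p) * (Real.log 4 * (y / (a * b))) := by
          rw [sum_mul]
          refine sum_congr rfl fun p hp => ?_
          have hp0 : (p : ℝ) ≠ 0 := by
            exact_mod_cast (hlogp p (mem_filter.1 hp).1).1.ne_zero
          field_simp
      _ ≤ (4 * (1 + Real.log ((M / a) / A))) * (Real.log 4 * (y / (a * b))) := by
          gcongr
          refine sum_log_div_le _ hA0 ?_ ?_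
          · rw [hA, div_le_div_iff₀ (by positivity) ha]
            nlinarith
          · intro p hp
            rw [mem_filter, not_le] at hp
            refine ⟨(hlogp p hp.1).1, hp.2, ?_⟩
            rw [le_div_iff₀ ha]
            exact (hlogp p hp.1).2
      _ = (4 * (1 + Real.log (M ^ 2 / y))) * (Real.log 4 * (y / (a * b))) := by
          congr 4
          rw [hA]
          field_simp
      _ ≤ (4 * (1 + Real.log (M ^ 2 / y))) * (1.4 * (y / (a * b))) := by gcongr
      _ = _ := by ring
  have h0 : 0 ≤ y / (a * b) := by positivity
  nlinarith [mul_nonneg hD h0]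

lemma setProd_le_of_subset {S T : Finset ℕ} (hT : ∀ p ∈ T, p.Prime) (hST : S ⊆ T) :
    setProd S ≤ setProd T := by
  rw [setProd, setProd, ← prod_sdiff hST]
  refine le_mul_of_one_le_left (prod_nonneg fun _ _ => by positivity) ?_
  exact one_le_setProd fun p hp => hT p (mem_sdiff.1 hp).1

/-- The elements of `S` lying in the blocks of index less than `j`. -/
noncomputable def smoothPart (j : ℕ) (S : Finset ℕ) : Finset ℕ := {p ∈ S | blockIdx p < j}

/-- The elements of `S` lying in the blocks of index at least `j`. -/
noncomputable def roughPart (j : ℕ) (S : Finset ℕ) : Finset ℕ := {p ∈ S | j ≤ blockIdx p}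

/-- A splitting of a set of primes into three parts. -/
structure IsSplit (j : ℕ) (S s a b : Finset ℕ) : Prop where
  union : s ∪ (a ∪ b) = S
  disj : Disjoint a b
  smooth : ∀ p ∈ s, blockIdx p < j
  rough : ∀ p ∈ a ∪ b, j ≤ blockIdx p

lemma IsSplit.disj' {j : ℕ} {S s a b : Finset ℕ} (h : IsSplit j S s a b) :
    Disjoint s (a ∪ b) :=
  disjoint_left.2 fun p hp hp' => absurd (h.smooth p hp) (not_lt.2 (h.rough p hp'))

lemma IsSplit.setProd_eq {j : ℕ} {S s a b : Finset ℕ} (h : IsSplit j S s a b) :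
    setProd S = setProd s * (setProd a * setProd b) := by
  rw [← h.union, setProd, prod_union h.disj', prod_union h.disj]

lemma IsSplit.eq_smoothPart {j : ℕ} {S s a b : Finset ℕ} (h : IsSplit j S s a b) :
    s = smoothPart j S := by
  ext p
  rw [smoothPart, mem_filter, ← h.union, mem_union]
  constructor
  · exact fun hp => ⟨Or.inl hp, h.smooth p hp⟩
  · rintro ⟨hp | hp, hlt⟩
    · exact hp
    · exact absurd (h.rough p hp) (by omega)

lemma IsSplit.eq_roughPart {j : ℕ} {S s a b : Finset ℕ} (h : IsSplit j S s a b) :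
    a ∪ b = roughPart j S := by
  ext p
  rw [roughPart, mem_filter, ← h.union, mem_union (s := s)]
  constructor
  · exact fun hp => ⟨Or.inr hp, h.rough p hp⟩
  · rintro ⟨hp | hp, hlt⟩
    · exact absurd (h.smooth p hp) (by omega)
    · exact hp

lemma IsSplit.erase {j : ℕ} {S s a b : Finset ℕ} (h : IsSplit j S s a b) {p q : ℕ}
    (hp : p ∈ a) (hq : q ∈ b) :
    IsSplit j ((S.erase p).erase q) s (a.erase p) (b.erase q) := by
  have hpb : p ∉ b := disjoint_left.1 h.disj hp
  have hqa : q ∉ a := disjoint_right.1 h.disj hq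
  have hps : p ∉ s := disjoint_right.1 h.disj' (mem_union_left _ hp)
  have hqs : q ∉ s := disjoint_right.1 h.disj' (mem_union_right _ hq)
  refine ⟨?_, h.disj.mono (erase_subset _ _) (erase_subset _ _), h.smooth, ?_⟩
  · rw [← h.union]
    ext r
    simp only [mem_union, mem_erase]
    constructor
    · rintro (hr | ⟨h1, h2⟩ | ⟨h1, h2⟩)
      · exact ⟨fun e => hqs (e ▸ hr), fun e => hps (e ▸ hr), Or.inl hr⟩
      · exact ⟨fun e => hqa (e ▸ h2), h1, Or.inr (Or.inl h2)⟩
      · exact ⟨h1, fun e => hpb (e ▸ h2), Or.inr (Or.inr h2)⟩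
    · rintro ⟨h1, h2, h3 | h3 | h3⟩
      · exact Or.inl h3
      · exact Or.inr (Or.inl ⟨h2, h3⟩)
      · exact Or.inr (Or.inr ⟨h1, h3⟩)
  · intro r hr
    exact h.rough r (union_subset_union (erase_subset _ _) (erase_subset _ _) hr)

lemma sum_log_mul_log_split_le (𝒯 𝒰 : Finset (Finset ℕ)) (j : ℕ) {x M D : ℝ} (hM : 1 < M)
    (hx : 0 < x) (hxM : x ≤ M ^ 2) (hD0 : 0 ≤ D) (s a b : Finset ℕ → Finset ℕ)
    (hp : ∀ S ∈ 𝒯, ∀ p ∈ S, p.Prime) (hsplit : ∀ S ∈ 𝒯, IsSplit j S (s S) (a S) (b S))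
    (hSx : ∀ S ∈ 𝒯, setProd S ≤ x) (ha : ∀ S ∈ 𝒯, setProd (a S) ≤ M)
    (hb : ∀ S ∈ 𝒯, setProd (b S) ≤ M)
    (hD : ∀ S ∈ 𝒯, 1 + Real.log (M ^ 2 * setProd (s S) / x) ≤ D)
    (hU : ∀ S ∈ 𝒯, ∀ p ∈ S, ∀ q ∈ S, p ≠ q → j ≤ blockIdx p → j ≤ blockIdx q →
      (S.erase p).erase q ∈ 𝒰) :
    ∑ S ∈ 𝒯, Real.log (setProd (a S)) * Real.log (setProd (b S))
      ≤ 8 * D * x * ∑ S ∈ 𝒰, 2 ^ #(roughPart j S) * (setProd S)⁻¹ := by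
  have hsS : ∀ S ∈ 𝒯, s S ⊆ S := fun S hS => by
    conv_rhs => rw [← (hsplit S hS).union]
    exact subset_union_left
  have haS : ∀ S ∈ 𝒯, a S ⊆ S := fun S hS => by
    conv_rhs => rw [← (hsplit S hS).union]
    exact subset_union_left.trans subset_union_right
  have hbS : ∀ S ∈ 𝒯, b S ⊆ S := fun S hS => by
    conv_rhs => rw [← (hsplit S hS).union]
    exact subset_union_right.trans subset_union_right
  set W := 𝒯.sigma fun S => a S ×ˢ b S with hW
  have hWmem : ∀ w ∈ W, w.1 ∈ 𝒯 ∧ w.2.1 ∈ a w.1 ∧ w.2.2 ∈ b w.1 := by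
    intro w hw
    rw [hW, mem_sigma, mem_product] at hw
    exact hw
  have h1 : ∑ S ∈ 𝒯, Real.log (setProd (a S)) * Real.log (setProd (b S))
      = ∑ w ∈ W, Real.log (w.2.1 : ℝ) * Real.log (w.2.2 : ℝ) := by
    rw [hW, sum_sigma]
    refine sum_congr rfl fun S hS => ?_
    rw [setProd, setProd, Real.log_prod, Real.log_prod, sum_mul_sum, sum_product]
    · exact fun p hpb => by exact_mod_cast (hp S hS p (hbS S hS hpb)).ne_zero
    · exact fun p hpa => by exact_mod_cast (hp S hS p (haS S hS hpa)).ne_zero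
  set φ : (_ : Finset ℕ) × (ℕ × ℕ) → Finset ℕ × Finset ℕ × Finset ℕ := fun w =>
    (s w.1, (a w.1).erase w.2.1, (b w.1).erase w.2.2) with hφ
  set ψ : Finset ℕ × Finset ℕ × Finset ℕ → Finset ℕ := fun t => t.1 ∪ (t.2.1 ∪ t.2.2) with hψ
  set 𝒬 := W.image φ with h𝒬
  have hQ : ∀ t ∈ 𝒬, IsSplit j (ψ t) t.1 t.2.1 t.2.2 ∧ ψ t ∈ 𝒰 := by
    intro t ht
    obtain ⟨w, hw, rfl⟩ := mem_image.1 ht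
    obtain ⟨hw1, hw2, hw3⟩ := hWmem w hw
    have hs := (hsplit _ hw1).erase hw2 hw3
    have he : ψ (φ w) = (w.1.erase w.2.1).erase w.2.2 := hs.union
    rw [he]
    refine ⟨hs, hU _ hw1 _ (haS _ hw1 hw2) _ (hbS _ hw1 hw3) ?_ ?_ ?_⟩
    · intro h
      exact disjoint_left.1 (hsplit _ hw1).disj hw2 (h ▸ hw3)
    · exact (hsplit _ hw1).rough _ (mem_union_left _ hw2)
    · exact (hsplit _ hw1).rough _ (mem_union_right _ hw3)
  have hfib : ∀ t ∈ 𝒬, ∑ w ∈ W with φ w = t, Real.log (w.2.1 : ℝ) * Real.log (w.2.2 : ℝ)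
      ≤ 8 * D * x * (setProd (ψ t))⁻¹ := by
    intro t ht
    have htp : ∀ T : Finset ℕ, (T = t.1 ∨ T = t.2.1 ∨ T = t.2.2) → 1 ≤ setProd T := by
      obtain ⟨w, hw, rfl⟩ := mem_image.1 ht
      obtain ⟨hw1, hw2, hw3⟩ := hWmem w hw
      rintro T (rfl | rfl | rfl)
      · exact one_le_setProd fun p hpT => hp _ hw1 p (hsS _ hw1 hpT)
      · exact one_le_setProd fun p hpT => hp _ hw1 p (haS _ hw1 (mem_of_mem_erase hpT))
      · exact one_le_setProd fun p hpT => hp _ hw1 p (hbS _ hw1 (mem_of_mem_erase hpT))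
    have ht1 := htp t.1 (Or.inl rfl)
    have ht2 := htp t.2.1 (Or.inr (Or.inl rfl))
    have ht3 := htp t.2.2 (Or.inr (Or.inr rfl))
    have hDt : 1 + Real.log (M ^ 2 / (x / setProd t.1)) ≤ D := by
      obtain ⟨w, hw, rfl⟩ := mem_image.1 ht
      have := hD _ (hWmem w hw).1
      rwa [div_div_eq_mul_div]
    rw [← sum_image (s := {w ∈ W | φ w = t})
      (g := fun w : (_ : Finset ℕ) × (ℕ × ℕ) => w.2)
      (f := fun w : ℕ × ℕ => Real.log (w.1 : ℝ) * Real.log (w.2 : ℝ))]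
    · refine (sum_log_mul_log_le _ (a := setProd t.2.1) (b := setProd t.2.2) (M := M)
        (y := x / setProd t.1) (by linarith) (by linarith) (by linarith)
        (div_pos hx (by linarith)) ((div_le_self hx.le ht1).trans hxM) ?_).trans ?_
      · intro v hv
        obtain ⟨w, hw, rfl⟩ := mem_image.1 hv
        rw [mem_filter] at hw
        obtain ⟨hw, rfl⟩ := hw
        obtain ⟨hw1, hw2, hw3⟩ := hWmem w hw
        have e1 : (w.2.1 : ℝ) * setProd ((a w.1).erase w.2.1) = setProd (a w.1) :=
          mul_prod_erase _ (fun p : ℕ => (p : ℝ)) hw2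
        have e2 : (w.2.2 : ℝ) * setProd ((b w.1).erase w.2.2) = setProd (b w.1) :=
          mul_prod_erase _ (fun p : ℕ => (p : ℝ)) hw3
        refine ⟨hp _ hw1 _ (haS _ hw1 hw2), hp _ hw1 _ (hbS _ hw1 hw3), ?_, ?_, ?_⟩
        · exact e1.trans_le (ha _ hw1)
        · exact e2.trans_le (hb _ hw1)
        · simp only [hφ]
          simp only [hφ] at ht1
          rw [e1, e2, le_div_iff₀ (by linarith)]
          have := hSx _ hw1
          rw [(hsplit _ hw1).setProd_eq] at this
          linarith
      · rw [(hQ t ht).1.setProd_eq]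
        have e : 8 * D * x * (setProd t.1 * (setProd t.2.1 * setProd t.2.2))⁻¹
            = 8 * D * (x / setProd t.1 / (setProd t.2.1 * setProd t.2.2)) := by
          field_simp
        rw [e]
        have hpos : 0 ≤ x / setProd t.1 / (setProd t.2.1 * setProd t.2.2) := by positivity
        gcongr
    · rintro ⟨S, v⟩ hw ⟨S', v'⟩ hw' hvv
      rw [mem_coe, mem_filter] at hw hw'
      simp only at hvv
      subst hvv
      obtain ⟨hw1, hw2, hw3⟩ := hWmem _ hw.1
      obtain ⟨hw1', hw2', hw3'⟩ := hWmem _ hw'.1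
      have e := hw.2.trans hw'.2.symm
      simp only [hφ, Prod.mk.injEq] at e hw1 hw2 hw3 hw1' hw2' hw3'
      have : S = S' := by
        rw [← (hsplit S hw1).union, ← (hsplit S' hw1').union, e.1, ← insert_erase hw2,
          ← insert_erase hw3, e.2.1, e.2.2, insert_erase hw2', insert_erase hw3']
      rw [this]
  rw [h1, ← sum_fiberwise_of_maps_to (t := 𝒬) (g := φ) fun w hw => mem_image_of_mem _ hw]
  refine (sum_le_sum hfib).trans ?_
  rw [← mul_sum]
  refine mul_le_mul_of_nonneg_left ?_ (by positivity)
  rw [← sum_fiberwise_of_maps_to (t := 𝒰) (g := ψ) fun t ht => (hQ t ht).2]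
  refine sum_le_sum fun S _ => ?_
  calc ∑ t ∈ 𝒬 with ψ t = S, (setProd (ψ t))⁻¹ = #{t ∈ 𝒬 | ψ t = S} * (setProd S)⁻¹ := by
        rw [← nsmul_eq_mul, ← sum_const]
        exact sum_congr rfl fun t ht => by rw [(mem_filter.1 ht).2]
    _ ≤ _ := by
        refine mul_le_mul_of_nonneg_right ?_ (inv_nonneg.2 (prod_nonneg fun _ _ => by positivity))
        have : #{t ∈ 𝒬 | ψ t = S} ≤ 2 ^ #(roughPart j S) := by
          rw [← card_powerset]
          refine card_le_card_of_injOn (fun t => t.2.1) ?_ ?_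
          · intro t ht
            rw [mem_coe, mem_filter] at ht
            rw [mem_coe, mem_powerset, ← ht.2, ← (hQ t ht.1).1.eq_roughPart]
            exact subset_union_left
          · intro t ht t' ht' htt
            rw [mem_coe, mem_filter] at ht ht'
            simp only at htt
            have k1 := (hQ t ht.1).1
            have k2 := (hQ t' ht'.1).1
            rw [ht.2] at k1
            rw [ht'.2] at k2
            refine Prod.ext (k1.eq_smoothPart.trans k2.eq_smoothPart.symm) (Prod.ext htt ?_)
            have e1 := k1.eq_roughPart.trans k2.eq_roughPart.symm
            rw [← union_sdiff_cancel_left k1.disj, ← union_sdiff_cancel_left k2.disj, e1, htt]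
        exact_mod_cast this

lemma card_split_le (𝒯 : Finset (Finset ℕ)) (j : ℕ) {A B C : ℝ} (hA : 0 ≤ A) (hB : 0 ≤ B)
    (hC : 0 ≤ C) (s a b : Finset ℕ → Finset ℕ)
    (hp : ∀ S ∈ 𝒯, ∀ p ∈ S, p.Prime) (hsplit : ∀ S ∈ 𝒯, IsSplit j S (s S) (a S) (b S))
    (hs : ∀ S ∈ 𝒯, setProd (s S) ≤ A) (ha : ∀ S ∈ 𝒯, setProd (a S) ≤ B)
    (hb : ∀ S ∈ 𝒯, setProd (b S) ≤ C) : (#𝒯 : ℝ) ≤ A * (B * C) := by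
  have h1 : #𝒯 ≤ #(𝒯.image s ×ˢ (𝒯.image a ×ˢ 𝒯.image b)) := by
    refine card_le_card_of_injOn (fun S => (s S, a S, b S)) ?_ ?_
    · intro S hS
      rw [mem_coe] at hS
      rw [mem_coe, mem_product, mem_product]
      exact ⟨mem_image_of_mem _ hS, mem_image_of_mem _ hS, mem_image_of_mem _ hS⟩
    · intro S hS T hT hST
      simp only [Prod.mk.injEq] at hST
      rw [← (hsplit S hS).union, ← (hsplit T hT).union, hST.1, hST.2.1, hST.2.2]
  have hsub : ∀ S ∈ 𝒯, ∀ p, (p ∈ s S ∨ p ∈ a S ∨ p ∈ b S) → p.Prime := by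
    intro S hS p h
    refine hp S hS p ?_
    rw [← (hsplit S hS).union, mem_union, mem_union]
    exact h
  rw [card_product, card_product] at h1
  refine (Nat.cast_le (α := ℝ).2 h1).trans ?_
  push_cast
  have k1 : (#(𝒯.image s) : ℝ) ≤ A := card_le_of_setProd_le _ hA fun T hT => by
    obtain ⟨S, hS, rfl⟩ := mem_image.1 hT
    exact ⟨fun p h => hsub S hS p (Or.inl h), hs S hS⟩
  have k2 : (#(𝒯.image a) : ℝ) ≤ B := card_le_of_setProd_le _ hB fun T hT => by
    obtain ⟨S, hS, rfl⟩ := mem_image.1 hT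
    exact ⟨fun p h => hsub S hS p (Or.inr (Or.inl h)), ha S hS⟩
  have k3 : (#(𝒯.image b) : ℝ) ≤ C := card_le_of_setProd_le _ hC fun T hT => by
    obtain ⟨S, hS, rfl⟩ := mem_image.1 hT
    exact ⟨fun p h => hsub S hS p (Or.inr (Or.inr h)), hb S hS⟩
  gcongr

/-- `S` is a set of primes with product at most `x` which splits into two sets with products
at most `M`. -/
structure IsFactorable (x M : ℝ) (S : Finset ℕ) : Prop where
  prime : ∀ p ∈ S, p.Prime
  le : setProd S ≤ x
  split : ∃ S₁ S₂, S₁ ∪ S₂ = S ∧ Disjoint S₁ S₂ ∧ setProd S₁ ≤ M ∧ setProd S₂ ≤ M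

lemma card_factorable_le (𝒯 𝒰 : Finset (Finset ℕ)) (j : ℕ) {x M D : ℝ} (hM : 1 < M)
    (hx : 0 < x) (hxM : x ≤ M ^ 2) (hD0 : 0 ≤ D) (hT : ∀ S ∈ 𝒯, IsFactorable x M S)
    (hs : ∀ S ∈ 𝒯, setProd (smoothPart j S) ≤ M ^ (1 / 8 : ℝ))
    (hD : ∀ S ∈ 𝒯, 1 + Real.log (M ^ 2 * setProd (smoothPart j S) / x) ≤ D)
    (hU : ∀ S ∈ 𝒯, ∀ p ∈ S, ∀ q ∈ S, p ≠ q → j ≤ blockIdx p → j ≤ blockIdx q →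
      (S.erase p).erase q ∈ 𝒰) :
    (#𝒯 : ℝ) ≤ 2 * M ^ (11 / 8 : ℝ) + 128 * (x * D / Real.log M ^ 2) *
      ∑ S ∈ 𝒰, 2 ^ #(roughPart j S) * (setProd S)⁻¹ := by
  have hM0 : 0 < M := by linarith
  have hlM := Real.log_pos hM
  choose! S₁ S₂ hS using fun S hS => (hT S hS).split
  have hp : ∀ S ∈ 𝒯, ∀ p ∈ S, p.Prime := fun S hS => (hT S hS).prime
  set s := smoothPart j with hs_def
  set a := fun S => roughPart j (S₁ S) with ha_def
  set b := fun S => roughPart j (S₂ S) with hb_def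
  have hsplit : ∀ S ∈ 𝒯, IsSplit j S (s S) (a S) (b S) := by
    intro S hST
    obtain ⟨h1, h2, -, -⟩ := hS S hST
    refine ⟨?_, h2.mono (filter_subset _ _) (filter_subset _ _), ?_, ?_⟩
    · ext p
      have : p ∈ S ↔ p ∈ S₁ S ∨ p ∈ S₂ S := by
        conv_lhs => rw [← h1]
        exact mem_union
      simp only [s, a, b, smoothPart, roughPart, mem_union, mem_filter, this]
      have := lt_or_ge (blockIdx p) j
      tauto
    · intro p h
      exact (mem_filter.1 h).2
    · intro p h
      rcases mem_union.1 h with h | h <;> exact (mem_filter.1 h).2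
  have ha : ∀ S ∈ 𝒯, setProd (a S) ≤ M := by
    intro S hST
    obtain ⟨h1, -, h3, -⟩ := hS S hST
    refine (setProd_le_of_subset (fun p h => hp S hST p ?_) (filter_subset _ _)).trans h3
    rw [← h1]
    exact mem_union_left _ h
  have hb : ∀ S ∈ 𝒯, setProd (b S) ≤ M := by
    intro S hST
    obtain ⟨h1, -, -, h3⟩ := hS S hST
    refine (setProd_le_of_subset (fun p h => hp S hST p ?_) (filter_subset _ _)).trans h3
    rw [← h1]
    exact mem_union_right _ h
  have hpow : M ^ (11 / 8 : ℝ) = M ^ (1 / 8 : ℝ) * (M ^ (1 / 4 : ℝ) * M) := by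
    nth_rewrite 4 [← Real.rpow_one M]
    rw [← Real.rpow_add hM0, ← Real.rpow_add hM0]
    norm_num
  set 𝒯a := {S ∈ 𝒯 | setProd (a S) ≤ M ^ (1 / 4 : ℝ)}
  set 𝒯b := {S ∈ 𝒯 | setProd (b S) ≤ M ^ (1 / 4 : ℝ)}
  set 𝒯c := {S ∈ 𝒯 | M ^ (1 / 4 : ℝ) < setProd (a S) ∧ M ^ (1 / 4 : ℝ) < setProd (b S)}
  have hcov : 𝒯 ⊆ 𝒯a ∪ (𝒯b ∪ 𝒯c) := by
    intro S hST
    simp only [𝒯a, 𝒯b, 𝒯c, mem_union, mem_filter, hST, true_and]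
    by_cases h1 : setProd (a S) ≤ M ^ (1 / 4 : ℝ)
    · exact Or.inl h1
    · by_cases h2 : setProd (b S) ≤ M ^ (1 / 4 : ℝ)
      · exact Or.inr (Or.inl h2)
      · exact Or.inr (Or.inr ⟨not_le.1 h1, not_le.1 h2⟩)
  have ka : (#𝒯a : ℝ) ≤ M ^ (11 / 8 : ℝ) := by
    rw [hpow]
    have hi : ∀ S ∈ 𝒯a, S ∈ 𝒯 := fun S h => (mem_filter.1 h).1
    exact card_split_le 𝒯a j (by positivity) (by positivity) hM0.le s a b (fun S h => hp S (hi S h))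
      (fun S h => hsplit S (hi S h)) (fun S h => hs S (hi S h)) (fun S h => (mem_filter.1 h).2)
      (fun S h => hb S (hi S h))
  have kb : (#𝒯b : ℝ) ≤ M ^ (11 / 8 : ℝ) := by
    rw [hpow, mul_comm (M ^ (1 / 4 : ℝ)) M]
    have hi : ∀ S ∈ 𝒯b, S ∈ 𝒯 := fun S h => (mem_filter.1 h).1
    exact card_split_le 𝒯b j (by positivity) hM0.le (by positivity) s a b (fun S h => hp S (hi S h))
      (fun S h => hsplit S (hi S h)) (fun S h => hs S (hi S h)) (fun S h => ha S (hi S h))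
      (fun S h => (mem_filter.1 h).2)
  have kc : (#𝒯c : ℝ) * (Real.log M / 4) ^ 2
      ≤ 8 * D * x * ∑ S ∈ 𝒰, 2 ^ #(roughPart j S) * (setProd S)⁻¹ := by
    have hi : ∀ S ∈ 𝒯c, S ∈ 𝒯 := fun S h => (mem_filter.1 h).1
    refine le_trans ?_ (sum_log_mul_log_split_le 𝒯c 𝒰 j hM hx hxM hD0 s a b
      (fun S h => hp S (hi S h)) (fun S h => hsplit S (hi S h)) (fun S h => (hT S (hi S h)).le)
      (fun S h => ha S (hi S h)) (fun S h => hb S (hi S h)) (fun S h => hD S (hi S h))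
      (fun S h => hU S (hi S h)))
    rw [← nsmul_eq_mul, ← sum_const]
    refine sum_le_sum fun S h => ?_
    obtain ⟨h1, h2⟩ := (mem_filter.1 h).2
    have e : Real.log (M ^ (1 / 4 : ℝ)) = Real.log M / 4 := by
      rw [Real.log_rpow hM0]
      ring
    have e1 := Real.log_le_log (by positivity) h1.le
    have e2 := Real.log_le_log (by positivity) h2.le
    rw [e] at e1 e2
    rw [pow_two]
    exact mul_le_mul e1 e2 (by positivity) (by linarith)
  have kc' : (#𝒯c : ℝ) ≤ 128 * (x * D / Real.log M ^ 2) *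
      ∑ S ∈ 𝒰, 2 ^ #(roughPart j S) * (setProd S)⁻¹ := by
    rw [← mul_le_mul_iff_left₀ (show 0 < (Real.log M / 4) ^ 2 by positivity)]
    refine kc.trans (le_of_eq ?_)
    field_simp
    ring
  have hc := (card_le_card hcov).trans ((card_union_le _ _).trans
    (Nat.add_le_add_left (card_union_le _ _) _))
  have hc' : (#𝒯 : ℝ) ≤ #𝒯a + (#𝒯b + #𝒯c) := by exact_mod_cast hc
  linarith

lemma pow_div_factorial_le_self (J k : ℕ) :
    (J : ℝ) ^ k / k.factorial ≤ (J : ℝ) ^ J / J.factorial := by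
  rw [div_le_div_iff₀ (by positivity) (by positivity)]
  rcases le_total J k with h | h
  · have h1 := Nat.factorial_mul_pow_sub_le_factorial h
    calc (J : ℝ) ^ k * J.factorial = J ^ J * (J.factorial * (J : ℝ) ^ (k - J)) := by
          rw [← Nat.add_sub_cancel' h, pow_add, Nat.add_sub_cancel_left]
          ring
      _ ≤ _ := by
          gcongr
          exact_mod_cast h1
  · have h1 := Nat.factorial_mul_descFactorial (Nat.sub_le J k)
    have h2 := Nat.descFactorial_le_pow J (J - k)
    rw [Nat.sub_sub_self h] at h1
    calc (J : ℝ) ^ k * J.factorial = J ^ k * (k.factorial * J.descFactorial (J - k)) := by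
          rw [← h1]
          push_cast
          ring
      _ ≤ J ^ k * (k.factorial * (J : ℝ) ^ (J - k)) := by
          gcongr
          exact_mod_cast h2
      _ = _ := by
          have e : (J : ℝ) ^ J = J ^ k * J ^ (J - k) := by rw [← pow_add, Nat.add_sub_cancel' h]
          rw [e]
          ring

/-- An upper bound for the maximum of `J ^ k / k!`. -/
noncomputable def poissonMax (J : ℕ) : ℝ := Real.exp J / √J

lemma poissonMax_nonneg (J : ℕ) : 0 ≤ poissonMax J := by
  rw [poissonMax]
  positivity

lemma pow_div_factorial_le {J : ℕ} (hJ : 1 ≤ J) (k : ℕ) :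
    (J : ℝ) ^ k / k.factorial ≤ poissonMax J := by
  refine (pow_div_factorial_le_self J k).trans ?_
  have hJ0 : (0 : ℝ) < J := by exact_mod_cast hJ
  have h := Stirling.le_factorial_stirling J
  rw [poissonMax, div_le_div_iff₀ (by positivity) (by positivity)]
  have h1 : √(J : ℝ) ≤ √(2 * Real.pi * J) := by
    refine Real.sqrt_le_sqrt ?_
    nlinarith [Real.pi_gt_three]
  have h2 : (J : ℝ) ^ J = Real.exp J * (J / Real.exp 1) ^ J := by
    rw [div_pow, ← Real.exp_nat_mul, mul_one]
    field_simp
  calc (J : ℝ) ^ J * √J ≤ J ^ J * √(2 * Real.pi * J) := by gcongr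
    _ = Real.exp J * (√(2 * Real.pi * J) * (J / Real.exp 1) ^ J) := by
        rw [h2]
        ring
    _ ≤ _ := by gcongr

/-- A set of primes lying in the first `J` blocks. -/
def IsBlockSet (J : ℕ) (S : Finset ℕ) : Prop := ∀ p ∈ S, p.Prime ∧ blockIdx p < J

lemma sum_inv_setProd_of_card_eq {J k : ℕ} (hJ : 1 ≤ J) {Γ : ℝ} (hΓ : 0 ≤ Γ)
    (Q : (ℕ → ℕ) → Prop)
    (𝒮 : Finset (Finset ℕ)) (h : ∀ S ∈ 𝒮, IsBlockSet J S ∧ #S = k ∧ Q (blockCount S))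
    (hc : (#{f ∈ Fintype.piFinset fun _ : Fin k => range J | Q fun b => #{r | f r = b}} : ℝ)
      ≤ Γ * J ^ k) :
    ∑ S ∈ 𝒮, (setProd S)⁻¹ ≤ Γ * (Real.log 2 ^ k * poissonMax J) := by
  have hl2 : 0 ≤ Real.log 2 := Real.log_nonneg (by norm_num)
  refine (sum_inv_prod_le Q 𝒮 h).trans ?_
  calc _ ≤ Real.log 2 ^ k / k.factorial * (Γ * J ^ k) := by gcongr
    _ = Γ * (Real.log 2 ^ k * (J ^ k / k.factorial)) := by ring
    _ ≤ _ := by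
        gcongr
        exact pow_div_factorial_le hJ k

lemma card_piFinset_filter_le (J k : ℕ) (P : (Fin k → ℕ) → Prop) :
    (#{f ∈ Fintype.piFinset fun _ : Fin k => range J | P f} : ℝ) ≤ 1 * J ^ k := by
  rw [one_mul]
  have := card_filter_le (Fintype.piFinset fun _ : Fin k => range J) P
  rw [Fintype.card_piFinset_const, card_range] at this
  exact_mod_cast this

lemma sum_inv_setProd_of_le_card {J n : ℕ} (hJ : 1 ≤ J) {Γ : ℝ} (hΓ : 0 ≤ Γ)
    (Q : (ℕ → ℕ) → Prop) (𝒮 : Finset (Finset ℕ))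
    (h : ∀ S ∈ 𝒮, IsBlockSet J S ∧ n ≤ #S ∧ Q (blockCount S))
    (hc : ∀ S ∈ 𝒮, (#{f ∈ Fintype.piFinset fun _ : Fin #S => range J |
      Q fun b => #{r | f r = b}} : ℝ) ≤ Γ * J ^ #S) :
    ∑ S ∈ 𝒮, (setProd S)⁻¹ ≤ 4 * Γ * (Real.log 2 ^ n * poissonMax J) := by
  have hl2 : 0 ≤ Real.log 2 := Real.log_nonneg (by norm_num)
  have hl2' := Real.log_two_lt_d9
  have hE := poissonMax_nonneg J
  rw [← sum_fiberwise_of_maps_to (t := 𝒮.image card) (g := card) fun S hS =>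
    mem_image_of_mem _ hS]
  have h1 : ∀ k ∈ 𝒮.image card, ∑ S ∈ 𝒮 with #S = k, (setProd S)⁻¹
      ≤ Γ * (Real.log 2 ^ k * poissonMax J) := by
    intro k hk
    obtain ⟨S₀, hS₀, rfl⟩ := mem_image.1 hk
    refine sum_inv_setProd_of_card_eq hJ hΓ Q _ (fun S hS => ?_) (hc S₀ hS₀)
    rw [mem_filter] at hS
    exact ⟨(h S hS.1).1, hS.2, (h S hS.1).2.2⟩
  refine (sum_le_sum h1).trans ?_
  rw [← mul_sum, ← sum_mul]
  have h2 : ∑ k ∈ 𝒮.image card, Real.log 2 ^ k ≤ 4 * Real.log 2 ^ n := by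
    have hs := summable_geometric_of_lt_one hl2 (by linarith)
    have e : ∀ k ∈ 𝒮.image card, Real.log 2 ^ k = Real.log 2 ^ n * Real.log 2 ^ (k - n) := by
      intro k hk
      obtain ⟨S₀, hS₀, rfl⟩ := mem_image.1 hk
      rw [← pow_add, Nat.add_sub_cancel' (h S₀ hS₀).2.1]
    rw [sum_congr rfl e, ← mul_sum, mul_comm]
    refine mul_le_mul_of_nonneg_right ?_ (by positivity)
    rw [← sum_image (s := 𝒮.image card) (g := fun k => k - n) (f := fun k => Real.log 2 ^ k)]
    · refine (hs.sum_le_tsum _ fun _ _ => by positivity).trans ?_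
      rw [tsum_geometric_of_lt_one hl2 (by linarith), inv_le_comm₀ (by linarith) (by norm_num)]
      linarith
    · intro k hk k' hk' hkk
      obtain ⟨S₀, hS₀, rfl⟩ := mem_image.1 hk
      obtain ⟨S₁, hS₁, rfl⟩ := mem_image.1 hk'
      have := (h S₀ hS₀).2.1
      have := (h S₁ hS₁).2.1
      simp only at hkk
      omega
  calc _ ≤ Γ * (4 * Real.log 2 ^ n * poissonMax J) := by gcongr
    _ = _ := by ring

lemma sum_two_pow_div_setProd_le {J n : ℕ} (hJ : 1 ≤ J) (𝒮 : Finset (Finset ℕ))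
    (h : ∀ S ∈ 𝒮, IsBlockSet J S ∧ #S ≤ n) :
    ∑ S ∈ 𝒮, 2 ^ #S * (setProd S)⁻¹ ≤ 4 * ((2 * Real.log 2) ^ n * poissonMax J) := by
  have hl2 := Real.log_two_gt_d9
  have hE := poissonMax_nonneg J
  rw [← sum_fiberwise_of_maps_to (t := range (n + 1)) (g := card) fun S hS =>
    mem_range.2 (Nat.lt_succ_of_le (h S hS).2)]
  have h1 : ∀ k ∈ range (n + 1), ∑ S ∈ 𝒮 with #S = k, 2 ^ #S * (setProd S)⁻¹
      ≤ (2 * Real.log 2) ^ k * poissonMax J := by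
    intro k _
    calc ∑ S ∈ 𝒮 with #S = k, 2 ^ #S * (setProd S)⁻¹
        = 2 ^ k * ∑ S ∈ 𝒮 with #S = k, (setProd S)⁻¹ := by
          rw [mul_sum]
          exact sum_congr rfl fun S hS => by rw [(mem_filter.1 hS).2]
      _ ≤ 2 ^ k * (1 * (Real.log 2 ^ k * poissonMax J)) := by
          gcongr
          refine sum_inv_setProd_of_card_eq hJ zero_le_one (fun _ => True) _ (fun S hS => ?_)
            (card_piFinset_filter_le J k _)
          rw [mem_filter] at hS
          exact ⟨(h S hS.1).1, hS.2, trivial⟩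
      _ = _ := by
          rw [mul_pow]
          ring
  refine (sum_le_sum h1).trans ?_
  rw [← sum_mul, geom_sum_eq (by linarith)]
  rw [← mul_assoc]
  refine mul_le_mul_of_nonneg_right ?_ hE
  rw [div_le_iff₀ (by linarith), pow_succ]
  have : 0 ≤ (2 * Real.log 2) ^ n := by positivity
  nlinarith

lemma IsFactorable.isBlockSet {x M : ℝ} {S : Finset ℕ} (h : IsFactorable x M S) {J : ℕ}
    (hJ : M ≤ blk J) : IsBlockSet J S := by
  intro p hp
  refine ⟨h.prime p hp, (blockIdx_lt_iff (h.prime p hp).two_le J).2 ?_⟩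
  obtain ⟨S₁, S₂, hS, -, h1, h2⟩ := h.split
  have key : ∀ T ⊆ S, p ∈ T → (p : ℝ) ≤ setProd T := by
    intro T hT hpT
    have := setProd_le_of_subset (fun q hq => h.prime q (hT hq)) (singleton_subset_iff.2 hpT)
    rwa [setProd, prod_singleton] at this
  have : (p : ℝ) ≤ blk J := by
    rw [← hS, mem_union] at hp
    rcases hp with hp | hp
    · exact (key S₁ (hS ▸ subset_union_left) hp).trans (h1.trans hJ)
    · exact (key S₂ (hS ▸ subset_union_right) hp).trans (h2.trans hJ)
  exact_mod_cast this

lemma blockCount_erase_le (S : Finset ℕ) (p b : ℕ) :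
    blockCount (S.erase p) b ≤ blockCount S b :=
  card_le_card (filter_subset_filter _ (erase_subset _ _))

lemma blockCount_le_erase (S : Finset ℕ) (p b : ℕ) :
    blockCount S b ≤ blockCount (S.erase p) b + 1 := by
  rw [blockCount, blockCount, filter_erase]
  exact Nat.sub_le_iff_le_add.1 pred_card_le_card_erase

lemma card_smoothPart (S : Finset ℕ) (j : ℕ) :
    #(smoothPart j S) = ∑ b ∈ range j, blockCount S b := by
  rw [smoothPart, card_eq_sum_card_fiberwise (t := range j) (f := blockIdx)
    fun p hp => by simpa using (mem_filter.1 hp).2]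
  refine sum_congr rfl fun b hb => ?_
  rw [blockCount, filter_filter]
  congr 1
  ext p
  rw [mem_filter, mem_filter]
  rw [mem_range] at hb
  constructor
  · rintro ⟨h1, h2, h3⟩
    exact ⟨h1, h3⟩
  · rintro ⟨h1, rfl⟩
    exact ⟨h1, hb, rfl⟩

lemma card_filter_lt_eq_sum {k : ℕ} (f : Fin k → ℕ) (j : ℕ) :
    ∑ b ∈ range j, #{r | f r = b} = #{r | f r < j} := by
  rw [card_eq_sum_card_fiberwise (s := {r | f r < j}) (t := range j) (f := f)
    fun r hr => by simpa using hr]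
  refine sum_congr rfl fun b hb => ?_
  rw [filter_filter]
  congr 1
  ext r
  rw [mem_filter, mem_filter]
  rw [mem_range] at hb
  constructor
  · rintro ⟨h1, rfl⟩
    exact ⟨h1, hb, rfl⟩
  · rintro ⟨h1, h2, h3⟩
    exact ⟨h1, h3⟩

lemma card_le_of_shadow_weight {J n : ℕ} (hJ : 1 ≤ J) {x Γ : ℝ} (hx : 1 < x) (hΓ : 0 ≤ Γ)
    (𝒯 : Finset (Finset ℕ)) (Q : (ℕ → ℕ) → Prop)
    (h : ∀ S ∈ 𝒯, IsBlockSet J S ∧ setProd S ≤ x ∧ n + 1 ≤ #S ∧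
      ∀ p ∈ S, Q (blockCount (S.erase p)))
    (hc : ∀ S ∈ 𝒯, ∀ k, #S = k + 1 → (#{f ∈ Fintype.piFinset fun _ : Fin k => range J |
      Q fun b => #{r | f r = b}} : ℝ) ≤ Γ * J ^ k) :
    (#𝒯 : ℝ) ≤ √x + 16 * Γ * (x / Real.log x) * (Real.log 2 ^ n * poissonMax J) := by
  have hlx := Real.log_pos hx
  refine (card_le_shadow_sum 𝒯 hx fun S hS => ⟨fun p hp => ((h S hS).1 p hp).1,
    (h S hS).2.1⟩).trans ?_
  have key : ∑ S ∈ 𝒯.shadow, (setProd S)⁻¹ ≤ 4 * Γ * (Real.log 2 ^ n * poissonMax J) := by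
    refine sum_inv_setProd_of_le_card hJ hΓ Q _ ?_ ?_
    · intro T hT
      obtain ⟨S, hS, p, hp, rfl⟩ := mem_shadow_iff.1 hT
      obtain ⟨h1, h2, h3, h4⟩ := h S hS
      refine ⟨fun q hq => h1 q (mem_of_mem_erase hq), ?_, h4 p hp⟩
      rw [card_erase_of_mem hp]
      omega
    · intro T hT
      obtain ⟨S, hS, p, hp, rfl⟩ := mem_shadow_iff.1 hT
      refine hc S hS _ ?_
      rw [card_erase_add_one hp]
  have : 0 ≤ x / Real.log x := by positivity
  nlinarith [mul_le_mul_of_nonneg_left key this]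

lemma card_many_factors_le {J n : ℕ} (hJ : 1 ≤ J) {x : ℝ} (hx : 1 < x)
    (𝒯 : Finset (Finset ℕ)) (h : ∀ S ∈ 𝒯, IsBlockSet J S ∧ setProd S ≤ x ∧ n + 1 ≤ #S) :
    (#𝒯 : ℝ) ≤ √x + 16 * (x / Real.log x) * (Real.log 2 ^ n * poissonMax J) := by
  have := card_le_of_shadow_weight (n := n) hJ hx zero_le_one 𝒯 (fun _ => True)
    (fun S hS => ⟨(h S hS).1, (h S hS).2.1, (h S hS).2.2, fun _ _ => trivial⟩)
    (fun S _ k _ => card_piFinset_filter_le J k _)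
  rwa [mul_one] at this

lemma add_pow_le_exp {J k : ℕ} (hJ : 1 ≤ J) (hk : k ≤ 2 * J) {y : ℝ} (hy : 0 ≤ y) :
    ((J : ℝ) + y) ^ k ≤ Real.exp (2 * y) * J ^ k := by
  have hJ0 : (0 : ℝ) < J := by exact_mod_cast hJ
  have e : (J : ℝ) + y = (1 + y / J) * J := by field_simp
  rw [e, mul_pow]
  refine mul_le_mul_of_nonneg_right ?_ (by positivity)
  calc (1 + y / J) ^ k ≤ Real.exp (y / J) ^ k := by
        refine pow_le_pow_left₀ (by positivity) ?_ k
        linarith [Real.add_one_le_exp (y / J)]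
    _ = Real.exp (k * (y / J)) := (Real.exp_nat_mul _ _).symm
    _ ≤ _ := by
        refine Real.exp_le_exp.2 ?_
        have : (k : ℝ) ≤ 2 * J := by exact_mod_cast hk
        rw [mul_div_assoc', div_le_iff₀ hJ0]
        nlinarith

lemma card_crowded_le {J n q : ℕ} (hJ : 1 ≤ J) {x : ℝ} (hx : 1 < x)
    (𝒯 : Finset (Finset ℕ)) (h : ∀ S ∈ 𝒯, IsBlockSet J S ∧ setProd S ≤ x ∧ n + 1 ≤ #S ∧
      #S ≤ 2 * J ∧ ∃ b, q + 1 ≤ blockCount S b) :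
    (#𝒯 : ℝ) ≤ √x + 16 * (J * Real.exp (2 * Real.exp 2) / Real.exp 2 ^ q) * (x / Real.log x) *
      (Real.log 2 ^ n * poissonMax J) := by
  refine card_le_of_shadow_weight (n := n) hJ hx (by positivity) 𝒯
    (fun z => ∃ b, q ≤ z b ∧ b < J) ?_ ?_
  · intro S hS
    obtain ⟨h1, h2, h3, -, b, hb⟩ := h S hS
    refine ⟨h1, h2, h3, fun p hp => ⟨b, ?_, ?_⟩⟩
    · have := blockCount_le_erase S p b
      omega
    · have : 0 < blockCount S b := by omega
      obtain ⟨r, hr⟩ := card_pos.1 this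
      rw [mem_filter] at hr
      rw [← hr.2]
      exact (h1 r hr.1).2
  · intro S hS k hk
    refine (card_large_fiber_le k J q (y := Real.exp 2) (Real.one_le_exp (by norm_num))).trans ?_
    have := add_pow_le_exp hJ (k := k) (by have := (h S hS).2.2.2.1; omega) (Real.exp_pos 2).le
    calc (J : ℝ) * (J + Real.exp 2) ^ k / Real.exp 2 ^ q
        ≤ J * (Real.exp (2 * Real.exp 2) * J ^ k) / Real.exp 2 ^ q := by gcongr
      _ = _ := by ring

lemma card_ballot_le {J n m w : ℕ} (hJ : 1 ≤ J) {x : ℝ} (hx : 1 < x) (hw : J + m + 1 ≤ n + w)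
    (𝒯 : Finset (Finset ℕ)) (h : ∀ S ∈ 𝒯, IsBlockSet J S ∧ setProd S ≤ x ∧ n + 1 ≤ #S ∧
      #S ≤ 2 * J ∧ ∀ j ≤ J, #(smoothPart j S) ≤ j + m) :
    (#𝒯 : ℝ) ≤ √x + 16 * (w * Real.exp (2 * (m + 1)) / J) * (x / Real.log x) *
      (Real.log 2 ^ n * poissonMax J) := by
  refine card_le_of_shadow_weight (n := n) hJ hx (by positivity) 𝒯
    (fun z => ∀ j ≤ J, ∑ b ∈ range j, z b ≤ j + m) ?_ ?_
  · intro S hS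
    obtain ⟨h1, h2, h3, -, h4⟩ := h S hS
    refine ⟨h1, h2, h3, fun p hp j hj => ?_⟩
    refine (sum_le_sum fun b _ => blockCount_erase_le S p b).trans ?_
    rw [← card_smoothPart]
    exact h4 j hj
  · intro S hS k hk
    simp only [card_filter_lt_eq_sum]
    have h1 := card_prefix_le_mul_le k J m
    set X := #{f ∈ Fintype.piFinset fun _ : Fin k => range J | ∀ j ≤ J, #{r | f r < j} ≤ j + m}
    have h2 : J + m + 1 - k ≤ w := by
      have := (h S hS).2.2.1
      omega
    have h3 : X * (J + m + 1) ≤ (J + m + 1) ^ k * w := h1.trans (Nat.mul_le_mul_left _ h2)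
    have h4 : (X : ℝ) * (J + m + 1) ≤ (J + (m + 1)) ^ k * w := by
      rw [← add_assoc]
      exact_mod_cast h3
    have h5 := add_pow_le_exp hJ (k := k) (by have := (h S hS).2.2.2.1; omega)
      (show (0 : ℝ) ≤ m + 1 by positivity)
    have hJ0 : (0 : ℝ) < J := by exact_mod_cast hJ
    rw [div_mul_eq_mul_div, le_div_iff₀ hJ0]
    calc (X : ℝ) * J ≤ X * (J + m + 1) := by
          gcongr
          linarith [(Nat.cast_nonneg m : (0 : ℝ) ≤ m)]
      _ ≤ (J + (m + 1)) ^ k * w := h4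
      _ ≤ (Real.exp (2 * (m + 1)) * J ^ k) * w := by gcongr
      _ = _ := by ring

lemma card_few_factors_le {J n : ℕ} (hJ : 1 ≤ J) {x M : ℝ} (hM : 1 < M) (hx : 0 < x)
    (hxM : x ≤ M ^ 2) (𝒯 : Finset (Finset ℕ))
    (h : ∀ S ∈ 𝒯, IsFactorable x M S ∧ IsBlockSet J S ∧ #S ≤ n) :
    (#𝒯 : ℝ) ≤ 2 * M ^ (11 / 8 : ℝ) +
      512 * (x * (1 + Real.log (M ^ 2 / x)) / Real.log M ^ 2) *
        ((2 * Real.log 2) ^ n * poissonMax J) := by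
  have hlM := Real.log_pos hM
  have hu : 0 ≤ Real.log (M ^ 2 / x) := Real.log_nonneg (by rwa [one_le_div hx])
  have hs : ∀ S : Finset ℕ, smoothPart 0 S = ∅ := fun S => filter_false_of_mem fun _ _ => by simp
  have hr : ∀ S : Finset ℕ, roughPart 0 S = S := fun S => filter_true_of_mem fun _ _ => by simp
  have hsp : ∀ S : Finset ℕ, setProd (smoothPart 0 S) = 1 := fun S => by simp [hs, setProd]
  set 𝒰 := 𝒯.shadow.shadow
  have := card_factorable_le 𝒯 𝒰 0 hM hx hxM (D := 1 + Real.log (M ^ 2 / x)) (by linarith)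
    (fun S hS => (h S hS).1) (fun S _ => by
      rw [hsp]
      exact Real.one_le_rpow hM.le (by norm_num)) (fun S _ => by rw [hsp, mul_one])
    (fun S hS p hp q hq hpq _ _ =>
      erase_mem_shadow (erase_mem_shadow hS hp) (mem_erase.2 ⟨hpq.symm, hq⟩))
  refine this.trans ?_
  have h2 := sum_two_pow_div_setProd_le (n := n) hJ 𝒰 (by
    intro T hT
    obtain ⟨S', hS', q, hq, rfl⟩ := mem_shadow_iff.1 hT
    obtain ⟨S, hS, p, hp, rfl⟩ := mem_shadow_iff.1 hS'
    obtain ⟨-, h1, h2⟩ := h S hS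
    refine ⟨fun r hr => h1 r (mem_of_mem_erase (mem_of_mem_erase hr)), ?_⟩
    exact (card_le_card ((erase_subset _ _).trans (erase_subset _ _))).trans h2)
  simp only [hr]
  have h3 : 0 ≤ x * (1 + Real.log (M ^ 2 / x)) / Real.log M ^ 2 := by positivity
  nlinarith [mul_le_mul_of_nonneg_left h2 h3]

/-- The walk `j ↦ #(smoothPart j S) - j` exceeds `m` for the first time at `j`. -/
def IsFirstPassage (m j : ℕ) (S : Finset ℕ) : Prop :=
  j + m + 1 ≤ #(smoothPart j S) ∧ ∀ i < j, #(smoothPart i S) ≤ i + m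

lemma exists_isFirstPassage {m j : ℕ} {S : Finset ℕ} (h : j + m + 1 ≤ #(smoothPart j S)) :
    ∃ i ≤ j, IsFirstPassage m i S := by
  have hex : ∃ i, i + m + 1 ≤ #(smoothPart i S) := ⟨j, h⟩
  refine ⟨Nat.find hex, Nat.find_min' hex h, Nat.find_spec hex, fun i hi => ?_⟩
  have := Nat.find_min hex hi
  omega

lemma IsFirstPassage.unique {m i j : ℕ} {S : Finset ℕ} (hi : IsFirstPassage m i S)
    (hj : IsFirstPassage m j S) : i = j := by
  rcases lt_trichotomy i j with h | h | h
  · have := hj.2 i h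
    have := hi.1
    omega
  · exact h
  · have := hi.2 j h
    have := hj.1
    omega

lemma smoothPart_erase {i p : ℕ} (h : i ≤ blockIdx p) (S : Finset ℕ) :
    smoothPart i (S.erase p) = smoothPart i S := by
  rw [smoothPart, filter_erase, erase_eq_of_notMem, smoothPart]
  rw [mem_filter]
  omega

lemma IsFirstPassage.erase {m j p : ℕ} {S : Finset ℕ} (hS : IsFirstPassage m j S)
    (h : j ≤ blockIdx p) : IsFirstPassage m j (S.erase p) := by
  refine ⟨?_, fun i hi => ?_⟩
  · rw [smoothPart_erase h]
    exact hS.1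
  · rw [smoothPart_erase (hi.le.trans h)]
    exact hS.2 i hi

lemma card_smoothPart_add_card_roughPart (j : ℕ) (S : Finset ℕ) :
    #(smoothPart j S) + #(roughPart j S) = #S := by
  rw [smoothPart, roughPart, ← card_filter_add_card_filter_not (s := S) (p := fun p => blockIdx p < j)]
  simp only [not_lt]

lemma card_first_passage_at_le {J m Q j : ℕ} (hQ : 1 ≤ Q) {x M : ℝ} (hM : 1 < M)
    (hx : 0 < x) (hxM : x ≤ M ^ 2) (hj : 48 * Q * 2 ^ j ≤ Real.log M) (𝒯 : Finset (Finset ℕ))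
    (h : ∀ S ∈ 𝒯, IsFactorable x M S ∧ IsBlockSet J S ∧ (∀ b, blockCount S b ≤ Q) ∧
      IsFirstPassage m j S) :
    (#𝒯 : ℝ) ≤ 2 * M ^ (11 / 8 : ℝ) +
      896 * (x * (1 + Real.log (M ^ 2 / x)) * Q / Real.log M ^ 2) / 2 ^ m *
        ∑ T ∈ 𝒯.shadow.shadow with IsFirstPassage m j T, 2 ^ #T * (setProd T)⁻¹ := by
  have hlM := Real.log_pos hM
  have hM0 : 0 < M := by linarith
  have hu : 0 ≤ Real.log (M ^ 2 / x) := Real.log_nonneg (by rwa [one_le_div hx])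
  have hQ' : (1 : ℝ) ≤ Q := by exact_mod_cast hQ
  have h2j : (1 : ℝ) ≤ 2 ^ j := one_le_pow₀ (by norm_num)
  have hprime : ∀ S ∈ 𝒯, ∀ p ∈ smoothPart j S, p.Prime := fun S hS p hp =>
    (h S hS).1.prime p (mem_filter.1 hp).1
  have hlog : ∀ S ∈ 𝒯, Real.log (setProd (smoothPart j S)) ≤ 6 * Q * 2 ^ j := by
    intro S hS
    refine log_prod_le_of_blockCount_le (fun p hp => ⟨hprime S hS p hp, (mem_filter.1 hp).2⟩) ?_
    intro b
    refine le_trans ?_ ((h S hS).2.2.1 b)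
    exact card_le_card (filter_subset_filter _ (filter_subset _ _))
  have hQ2 : 1 ≤ (Q : ℝ) * 2 ^ j := by nlinarith
  have hmain := card_factorable_le 𝒯 {T ∈ 𝒯.shadow.shadow | IsFirstPassage m j T} j hM hx hxM
    (D := (1 + Real.log (M ^ 2 / x)) * (7 * Q * 2 ^ j)) (by positivity) (fun S hS => (h S hS).1)
    (fun S hS => ?_) (fun S hS => ?_) (fun S hS p hp q hq hpq hjp hjq => ?_)
  · refine hmain.trans ?_
    rw [add_le_add_iff_left]
    have hkey : ∀ T ∈ {T ∈ 𝒯.shadow.shadow | IsFirstPassage m j T},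
        2 ^ #(roughPart j T) * (setProd T)⁻¹
          ≤ 1 / (2 ^ j * 2 ^ m) * (2 ^ #T * (setProd T)⁻¹) := by
      intro T hT
      rw [← mul_assoc]
      refine mul_le_mul_of_nonneg_right ?_ (inv_nonneg.2 (prod_nonneg fun _ _ => by positivity))
      rw [one_div_mul_eq_div, le_div_iff₀ (by positivity), ← pow_add, ← pow_add]
      refine pow_le_pow_right₀ (by norm_num) ?_
      have h1 := (mem_filter.1 hT).2.1
      have h2 := card_smoothPart_add_card_roughPart j T
      omega
    refine (mul_le_mul_of_nonneg_left (sum_le_sum hkey) (by positivity)).trans (le_of_eq ?_)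
    rw [← mul_sum]
    field_simp
    ring
  · rw [← Real.log_le_log_iff (by linarith [one_le_setProd (hprime S hS)]) (by positivity),
      Real.log_rpow hM0]
    have := hlog S hS
    linarith
  · have h1 := one_le_setProd (hprime S hS)
    have e : M ^ 2 * setProd (smoothPart j S) / x = M ^ 2 / x * setProd (smoothPart j S) := by
      ring
    rw [e, Real.log_mul (by positivity) (by linarith)]
    have := hlog S hS
    nlinarith [mul_nonneg hu (by linarith : (0 : ℝ) ≤ 7 * (Q * 2 ^ j) - 1)]
  · rw [mem_filter]
    exact ⟨erase_mem_shadow (erase_mem_shadow hS hp) (mem_erase.2 ⟨hpq.symm, hq⟩),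
      ((h S hS).2.2.2.erase hjp).erase hjq⟩

lemma card_first_passage_le {J n m Q j₀ : ℕ} (hJ : 1 ≤ J) (hQ : 1 ≤ Q) {x M : ℝ} (hM : 1 < M)
    (hx : 0 < x) (hxM : x ≤ M ^ 2) (hj : 48 * Q * 2 ^ j₀ ≤ Real.log M) (𝒯 : Finset (Finset ℕ))
    (h : ∀ S ∈ 𝒯, IsFactorable x M S ∧ IsBlockSet J S ∧ #S ≤ n ∧ (∀ b, blockCount S b ≤ Q) ∧
      ∃ j ≤ j₀, j + m + 1 ≤ #(smoothPart j S)) :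
    (#𝒯 : ℝ) ≤ 2 * (j₀ + 1) * M ^ (11 / 8 : ℝ) +
      3584 * (x * (1 + Real.log (M ^ 2 / x)) * Q / Real.log M ^ 2) / 2 ^ m *
        ((2 * Real.log 2) ^ n * poissonMax J) := by
  have hlM := Real.log_pos hM
  have hu : 0 ≤ Real.log (M ^ 2 / x) := Real.log_nonneg (by rwa [one_le_div hx])
  have hcov : 𝒯 ⊆ (range (j₀ + 1)).biUnion fun j => {S ∈ 𝒯 | IsFirstPassage m j S} := by
    intro S hS
    obtain ⟨j, hj1, hj2⟩ := (h S hS).2.2.2.2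
    obtain ⟨i, hi1, hi2⟩ := exists_isFirstPassage hj2
    exact mem_biUnion.2 ⟨i, mem_range.2 (by omega), mem_filter.2 ⟨hS, hi2⟩⟩
  have h1 : (#𝒯 : ℝ) ≤ ∑ j ∈ range (j₀ + 1), (#{S ∈ 𝒯 | IsFirstPassage m j S} : ℝ) := by
    exact_mod_cast (card_le_card hcov).trans card_biUnion_le
  set A := 896 * (x * (1 + Real.log (M ^ 2 / x)) * Q / Real.log M ^ 2) / 2 ^ m with hA
  have hA0 : 0 ≤ A := by positivity
  set 𝒰 := 𝒯.shadow.shadow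
  have h2 : ∀ j ∈ range (j₀ + 1), (#{S ∈ 𝒯 | IsFirstPassage m j S} : ℝ) ≤
      2 * M ^ (11 / 8 : ℝ) + A * ∑ T ∈ 𝒰 with IsFirstPassage m j T, 2 ^ #T * (setProd T)⁻¹ := by
    intro j hjr
    refine (card_first_passage_at_le (J := J) (m := m) hQ hM hx hxM (j := j) (le_trans ?_ hj) _
      fun S hS => ?_).trans ?_
    · gcongr
      · norm_num
      · exact Nat.lt_succ_iff.1 (mem_range.1 hjr)
    · rw [mem_filter] at hS
      obtain ⟨k1, k2, -, k3, -⟩ := h S hS.1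
      exact ⟨k1, k2, k3, hS.2⟩
    · rw [add_le_add_iff_left]
      refine mul_le_mul_of_nonneg_left ?_ hA0
      refine sum_le_sum_of_subset_of_nonneg (filter_subset_filter _ ?_) fun T _ _ =>
        mul_nonneg (by positivity) (inv_nonneg.2 (prod_nonneg fun _ _ => by positivity))
      exact shadow_mono (shadow_mono (filter_subset _ _))
  have h3 : ∑ j ∈ range (j₀ + 1), ∑ T ∈ 𝒰 with IsFirstPassage m j T, 2 ^ #T * (setProd T)⁻¹
      ≤ ∑ T ∈ 𝒰, 2 ^ #T * (setProd T)⁻¹ := by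
    rw [← sum_biUnion]
    · refine sum_le_sum_of_subset_of_nonneg (biUnion_subset.2 fun j _ => filter_subset _ _)
        fun T _ _ => mul_nonneg (by positivity) (inv_nonneg.2 (prod_nonneg fun _ _ => by positivity))
    · intro i _ j _ hij
      refine disjoint_left.2 fun T hT hT' => hij ?_
      exact (mem_filter.1 hT).2.unique (mem_filter.1 hT').2
  have h4 := sum_two_pow_div_setProd_le (n := n) hJ 𝒰 (by
    intro T hT
    obtain ⟨S', hS', q, hq, rfl⟩ := mem_shadow_iff.1 hT
    obtain ⟨S, hS, p, hp, rfl⟩ := mem_shadow_iff.1 hS'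
    obtain ⟨-, k1, k2, -⟩ := h S hS
    refine ⟨fun r hr => k1 r (mem_of_mem_erase (mem_of_mem_erase hr)), ?_⟩
    exact (card_le_card ((erase_subset _ _).trans (erase_subset _ _))).trans k2)
  calc (#𝒯 : ℝ) ≤ _ := h1.trans (sum_le_sum h2)
    _ = 2 * (j₀ + 1) * M ^ (11 / 8 : ℝ) + A * ∑ j ∈ range (j₀ + 1),
          ∑ T ∈ 𝒰 with IsFirstPassage m j T, 2 ^ #T * (setProd T)⁻¹ := by
        rw [sum_add_distrib, sum_const, card_range, ← mul_sum, nsmul_eq_mul]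
        push_cast
        ring
    _ ≤ 2 * (j₀ + 1) * M ^ (11 / 8 : ℝ) +
          A * (4 * ((2 * Real.log 2) ^ n * poissonMax J)) := by
        gcongr
        exact h3.trans h4
    _ = _ := by
        rw [hA]
        ring

lemma exists_walk_parameters {C : ℝ} (hC : 1 ≤ C) : ∃ K : ℝ, 1 ≤ K ∧ ∀ J : ℕ, 1 ≤ J →
    ∃ m q i : ℕ, m ≤ J ∧ 48 * C * (q + 1) ≤ 2 ^ i ∧
      ((2 * Real.log 2) ^ m)⁻¹ ≤ K * (J : ℝ) ^ (-(1 / 50) : ℝ) ∧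
      Real.log 2 ^ m ≤ K * (J : ℝ) ^ (-(1 / 50) : ℝ) ∧
      (q + 1) * Real.log 2 ^ m ≤ K * (J : ℝ) ^ (-(1 / 50) : ℝ) ∧
      J / Real.exp 2 ^ q * (Real.log 2 ^ m)⁻¹ ≤ K * (J : ℝ) ^ (-(1 / 50) : ℝ) ∧
      ((2 * m + i + 1 : ℕ) : ℝ) * Real.exp (2 * ((m + i : ℕ) + 1)) / J * (Real.log 2 ^ m)⁻¹
        ≤ K * (J : ℝ) ^ (-(1 / 50) : ℝ) := by
  have ha1 := Real.log_two_gt_d9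
  have ha2 := Real.log_two_lt_d9
  set B := 10000 * C with hB
  refine ⟨204 + 2 * B * (Real.exp 2 * B ^ 3), ?_, fun J hJ => ?_⟩
  · have : 0 ≤ 2 * B * (Real.exp 2 * B ^ 3) := by positivity
    linarith
  set K := 204 + 2 * B * (Real.exp 2 * B ^ 3) with hK
  have hB0 : 10000 ≤ B := by linarith
  have hK0 : 0 ≤ 2 * B * (Real.exp 2 * B ^ 3) := by positivity
  have hJ0 : (0 : ℝ) < J := by exact_mod_cast hJ
  have hJ1 : (1 : ℝ) ≤ J := by exact_mod_cast hJ
  set s := Real.log J / 100 with hs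
  have hs0 : 0 ≤ s := by
    have := Real.log_nonneg hJ1
    positivity
  have hJs : (J : ℝ) = Real.exp (100 * s) := by
    rw [hs, mul_div_cancel₀ _ (by norm_num), Real.exp_log hJ0]
  have hR : (J : ℝ) ^ (-(1 / 50) : ℝ) = Real.exp (-2 * s) := by
    rw [Real.rpow_def_of_pos hJ0, hs]
    congr 1
    ring
  have hes := Real.add_one_le_exp s
  set m := ⌊10 * s⌋₊ with hm
  set q := ⌈100 * s⌉₊ with hq
  have hm1 : (m : ℝ) ≤ 10 * s := Nat.floor_le (by positivity)
  have hm2 : 10 * s - 1 ≤ m := (Nat.sub_one_lt_floor _).le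
  have hq1 : 100 * s ≤ q := Nat.le_ceil _
  have hq2 : (q : ℝ) ≤ 100 * s + 1 := (Nat.ceil_lt_add_one (by positivity)).le
  have hqe : (q : ℝ) + 1 ≤ 102 * Real.exp s := by linarith
  obtain ⟨i, hi1, hi2⟩ : ∃ i : ℕ, 48 * C * (q + 1) ≤ 2 ^ i ∧ (2 : ℝ) ^ i ≤ B * Real.exp s := by
    have hex : ∃ i : ℕ, 48 * C * (q + 1) ≤ (2 : ℝ) ^ i := by
      obtain ⟨i, hi⟩ := pow_unbounded_of_one_lt (48 * C * (q + 1)) (one_lt_two (α := ℝ))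
      exact ⟨i, hi.le⟩
    refine ⟨Nat.find hex, Nat.find_spec hex, ?_⟩
    have h48 : 48 * C * (q + 1) ≤ 48 * C * (102 * Real.exp s) := by gcongr
    have hCe : 0 ≤ C * Real.exp s := by positivity
    rcases Nat.eq_zero_or_pos (Nat.find hex) with h0 | h0
    · rw [h0, pow_zero]
      nlinarith
    · have := Nat.find_min hex (Nat.sub_lt h0 one_pos)
      rw [not_le] at this
      have e : (2 : ℝ) ^ Nat.find hex = 2 * 2 ^ (Nat.find hex - 1) := by
        rw [← pow_succ', Nat.sub_add_cancel h0]
      rw [e, hB]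
      nlinarith
  have ham : Real.log 2 ^ m ≤ 2 * Real.exp (-3 * s) := by
    calc Real.log 2 ^ m ≤ Real.exp (-0.3) ^ m := by
          refine pow_le_pow_left₀ (by linarith) ?_ m
          have := Real.add_one_le_exp (-0.3)
          linarith
      _ = Real.exp (m * (-0.3)) := (Real.exp_nat_mul _ _).symm
      _ ≤ Real.exp (0.5 + -3 * s) := Real.exp_le_exp.2 (by linarith)
      _ = Real.exp 0.5 * Real.exp (-3 * s) := Real.exp_add _ _
      _ ≤ _ := by
          gcongr
          rw [← Real.le_log_iff_exp_le (by norm_num)]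
          linarith
  have ham' : (Real.log 2 ^ m)⁻¹ ≤ Real.exp (10 * s) := by
    rw [← inv_pow]
    calc (Real.log 2)⁻¹ ^ m ≤ Real.exp 1 ^ m := by
          refine pow_le_pow_left₀ (by positivity) ?_ m
          rw [inv_le_comm₀ (by linarith) (by positivity), ← Real.exp_neg]
          have := Real.exp_neg_one_lt_d9
          linarith
      _ = Real.exp (m * 1) := (Real.exp_nat_mul _ _).symm
      _ ≤ _ := Real.exp_le_exp.2 (by linarith)
  have h2am : ((2 * Real.log 2) ^ m)⁻¹ ≤ 2 * Real.exp (-2 * s) := by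
    rw [← inv_pow]
    calc (2 * Real.log 2)⁻¹ ^ m ≤ Real.exp (-0.25) ^ m := by
          refine pow_le_pow_left₀ (by positivity) ?_ m
          have := Real.add_one_le_exp (-0.25)
          rw [inv_le_comm₀ (by linarith) (by positivity)]
          rw [inv_le_comm₀ (by positivity) (by linarith)]
          refine le_trans ?_ this
          rw [inv_le_comm₀ (by linarith) (by norm_num)]
          linarith
      _ = Real.exp (m * (-0.25)) := (Real.exp_nat_mul _ _).symm
      _ ≤ Real.exp (0.5 + -2 * s) := Real.exp_le_exp.2 (by linarith)
      _ = Real.exp 0.5 * Real.exp (-2 * s) := Real.exp_add _ _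
      _ ≤ _ := by
          gcongr
          rw [← Real.le_log_iff_exp_le (by norm_num)]
          linarith
  have hE : 0 < Real.exp (-2 * s) := Real.exp_pos _
  have h32 : Real.exp (-3 * s) ≤ Real.exp (-2 * s) := Real.exp_le_exp.2 (by linarith)
  rw [hR]
  refine ⟨m, q, i, ?_, hi1, ?_, ?_, ?_, ?_, ?_⟩
  · have : (m : ℝ) ≤ J := by
      rw [hJs]
      linarith [Real.add_one_le_exp (100 * s)]
    exact_mod_cast this
  · refine h2am.trans (mul_le_mul_of_nonneg_right (by linarith) hE.le)
  · refine ham.trans (mul_le_mul (by linarith) h32 (Real.exp_pos _).le (by linarith))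
  · calc (q + 1) * Real.log 2 ^ m ≤ (102 * Real.exp s) * (2 * Real.exp (-3 * s)) := by gcongr
      _ = 204 * Real.exp (-2 * s) := by
          have : Real.exp (-2 * s) = Real.exp s * Real.exp (-3 * s) := by
            rw [← Real.exp_add]
            congr 1
            ring
          rw [this]
          ring
      _ ≤ _ := mul_le_mul_of_nonneg_right (by linarith) hE.le
  · calc J / Real.exp 2 ^ q * (Real.log 2 ^ m)⁻¹
        ≤ Real.exp (100 * s) / Real.exp (200 * s) * Real.exp (10 * s) := by
          rw [hJs]
          gcongr
          rw [← Real.exp_nat_mul]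
          exact Real.exp_le_exp.2 (by linarith)
      _ = Real.exp (-90 * s) := by
          rw [← Real.exp_sub, ← Real.exp_add]
          congr 1
          ring
      _ ≤ 1 * Real.exp (-2 * s) := by
          rw [one_mul]
          exact Real.exp_le_exp.2 (by linarith)
      _ ≤ _ := mul_le_mul_of_nonneg_right (by linarith) hE.le
  · have hi : (i : ℝ) ≤ B * Real.exp s := by
      refine le_trans ?_ hi2
      exact_mod_cast Nat.lt_two_pow_self.le
    have hw : ((2 * m + i + 1 : ℕ) : ℝ) ≤ 2 * B * Real.exp s := by
      push_cast
      nlinarith [Real.exp_pos s]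
    have hexp : Real.exp (2 * ((m + i : ℕ) + 1)) ≤
        Real.exp 2 * Real.exp (20 * s) * (B * Real.exp s) ^ 3 := by
      have e : Real.exp (2 * ((m + i : ℕ) + 1)) =
          Real.exp 2 * Real.exp (2 * m) * Real.exp (i * 2) := by
        rw [← Real.exp_add, ← Real.exp_add]
        congr 1
        push_cast
        ring
      have e8 : Real.exp 2 ≤ 2 ^ 3 := by
        have h1 := Real.exp_one_lt_d9
        have h2 : Real.exp 2 = Real.exp 1 * Real.exp 1 := by
          rw [← Real.exp_add]
          norm_num
        rw [h2]
        nlinarith [Real.exp_pos 1]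
      have h1 : Real.exp (2 * m) ≤ Real.exp (20 * s) := Real.exp_le_exp.2 (by linarith)
      have h2 : Real.exp (i * 2) ≤ (B * Real.exp s) ^ 3 := by
        calc Real.exp (i * 2) = Real.exp 2 ^ i := Real.exp_nat_mul _ _
          _ ≤ (2 ^ 3) ^ i := by gcongr
          _ = (2 ^ i) ^ 3 := by rw [← pow_mul, ← pow_mul, mul_comm]
          _ ≤ _ := by gcongr
      rw [e]
      exact mul_le_mul (mul_le_mul_of_nonneg_left h1 (Real.exp_pos 2).le) h2 (Real.exp_pos _).le
        (by positivity)
    calc ((2 * m + i + 1 : ℕ) : ℝ) * Real.exp (2 * ((m + i : ℕ) + 1)) / J * (Real.log 2 ^ m)⁻¹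
        ≤ (2 * B * Real.exp s) * (Real.exp 2 * Real.exp (20 * s) * (B * Real.exp s) ^ 3) /
          Real.exp (100 * s) * Real.exp (10 * s) := by
          rw [← hJs]
          gcongr
      _ = 2 * B * (Real.exp 2 * B ^ 3) * Real.exp (-66 * s) := by
          have : Real.exp (-66 * s) = Real.exp s * (Real.exp (20 * s) * Real.exp s ^ 3) /
              Real.exp (100 * s) * Real.exp (10 * s) := by
            rw [← Real.exp_nat_mul, ← Real.exp_add, ← Real.exp_add, ← Real.exp_sub, ← Real.exp_add]
            congr 1
            push_cast
            ring
          rw [this]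
          ring
      _ ≤ _ := by
          refine mul_le_mul (by linarith) (Real.exp_le_exp.2 (by linarith)) (Real.exp_pos _).le
            (by linarith)

lemma card_le_card_filter_add {ι : Type*} (s : Finset ι) (p₁ p₂ p₃ p₄ p₅ : ι → Prop)
    [DecidablePred p₁] [DecidablePred p₂] [DecidablePred p₃] [DecidablePred p₄] [DecidablePred p₅]
    (h : ∀ a ∈ s, p₁ a ∨ p₂ a ∨ p₃ a ∨ p₄ a ∨ p₅ a) :
    #s ≤ #(s.filter p₁) + #(s.filter p₂) + #(s.filter p₃) + #(s.filter p₄) + #(s.filter p₅) := by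
  have hs : s ⊆ s.filter p₁ ∪ s.filter p₂ ∪ s.filter p₃ ∪ s.filter p₄ ∪ s.filter p₅ := by
    intro a ha
    have := h a ha
    simp only [mem_union, mem_filter, ha, true_and]
    tauto
  refine (card_le_card hs).trans ((card_union_le _ _).trans ?_)
  gcongr
  refine (card_union_le _ _).trans ?_
  gcongr
  refine (card_union_le _ _).trans ?_
  gcongr
  exact card_union_le _ _

lemma card_factorable_le_sum {J m q i : ℕ} (hJ : 1 ≤ J) (hm : m ≤ J) {x M C : ℝ} (hM : 1 < M)
    (hMx : M ≤ x) (hxM : x ≤ M ^ 2) (hMJ : M ≤ blk J) (hC : 0 < C)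
    (hi : 48 * C * (q + 1) ≤ 2 ^ i) (hJM : (2 : ℝ) ^ J ≤ C * Real.log M)
    (𝒯 : Finset (Finset ℕ)) (h : ∀ S ∈ 𝒯, IsFactorable x M S) :
    (#𝒯 : ℝ) ≤ (3 * √x + 2 * (J + 2) * M ^ (11 / 8 : ℝ)) +
      512 * (x * (1 + Real.log (M ^ 2 / x)) / Real.log M ^ 2) *
        ((2 * Real.log 2) ^ (J - m) * poissonMax J) +
      16 * (x / Real.log x) * (Real.log 2 ^ (J + m) * poissonMax J) +
      16 * (J * Real.exp (2 * Real.exp 2) / Real.exp 2 ^ q) * (x / Real.log x) *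
        (Real.log 2 ^ (J - m) * poissonMax J) +
      3584 * (x * (1 + Real.log (M ^ 2 / x)) * (q + 1 : ℕ) / Real.log M ^ 2) / 2 ^ m *
        ((2 * Real.log 2) ^ (J + m) * poissonMax J) +
      16 * ((2 * m + i + 1 : ℕ) * Real.exp (2 * ((m + i : ℕ) + 1)) / J) * (x / Real.log x) *
        (Real.log 2 ^ (J - m) * poissonMax J) := by
  have hx1 : 1 < x := hM.trans_le hMx
  have hx0 : 0 < x := by linarith
  have hu : 0 ≤ Real.log (M ^ 2 / x) := Real.log_nonneg (by rwa [one_le_div hx0])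
  have hb : ∀ S ∈ 𝒯, IsBlockSet J S := fun S hS => (h S hS).isBlockSet hMJ
  have hl2 : 0 < Real.log 2 := Real.log_pos (by norm_num)
  have hE := poissonMax_nonneg J
  have hA := card_few_factors_le hJ hM hx0 hxM (𝒯.filter fun S => #S ≤ J - m) fun S hS =>
    have hS := mem_filter.1 hS
    ⟨h S hS.1, hb S hS.1, hS.2⟩
  have hB := card_many_factors_le hJ hx1 (𝒯.filter fun S => J + m + 1 ≤ #S) fun S hS =>
    have hS := mem_filter.1 hS
    ⟨hb S hS.1, (h S hS.1).le, hS.2⟩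
  have hD := card_crowded_le hJ hx1
    (𝒯.filter fun S => J - m + 1 ≤ #S ∧ #S ≤ J + m ∧ ∃ b, q + 1 ≤ blockCount S b) fun S hS =>
      have hS := mem_filter.1 hS
      ⟨hb S hS.1, (h S hS.1).le, hS.2.1, hS.2.2.1.trans (by omega), hS.2.2.2⟩
  have hG := card_ballot_le (n := J - m) (m := m + i) (w := 2 * m + i + 1) hJ hx1 (by omega)
    (𝒯.filter fun S => J - m + 1 ≤ #S ∧ #S ≤ J + m ∧ ∀ j ≤ J, #(smoothPart j S) ≤ j + (m + i))
    fun S hS =>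
      have hS := mem_filter.1 hS
      ⟨hb S hS.1, (h S hS.1).le, hS.2.1, hS.2.2.1.trans (by omega), hS.2.2.2⟩
  have hF : (#(𝒯.filter fun S => #S ≤ J + m ∧ (∀ b, blockCount S b ≤ q + 1) ∧
      ∃ j, j + i ≤ J ∧ j + m + 1 ≤ #(smoothPart j S)) : ℝ) ≤ 2 * (J + 1) * M ^ (11 / 8 : ℝ) +
      3584 * (x * (1 + Real.log (M ^ 2 / x)) * (q + 1 : ℕ) / Real.log M ^ 2) / 2 ^ m *
        ((2 * Real.log 2) ^ (J + m) * poissonMax J) := by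
    by_cases hiJ : i ≤ J
    · have hj : 48 * ((q + 1 : ℕ) : ℝ) * 2 ^ (J - i) ≤ Real.log M := by
        have h1 : (2 : ℝ) ^ J = 2 ^ (J - i) * 2 ^ i := by rw [← pow_add, Nat.sub_add_cancel hiJ]
        have h2 : C * (48 * ((q + 1 : ℕ) : ℝ) * 2 ^ (J - i)) ≤ C * Real.log M := by
          calc C * (48 * ((q + 1 : ℕ) : ℝ) * 2 ^ (J - i))
              = 2 ^ (J - i) * (48 * C * (q + 1)) := by push_cast; ring
            _ ≤ 2 ^ (J - i) * 2 ^ i := by gcongr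
            _ ≤ _ := h1 ▸ hJM
        exact le_of_mul_le_mul_left h2 hC
      refine (card_first_passage_le (n := J + m) (m := m) hJ (Nat.le_add_left 1 q) hM hx0 hxM hj _
        fun S hS => ?_).trans ?_
      · obtain ⟨h1, h2, h3, j, h4, h5⟩ := mem_filter.1 hS
        exact ⟨h S h1, hb S h1, h2, h3, j, by omega, h5⟩
      · have : ((J - i : ℕ) : ℝ) ≤ J := by exact_mod_cast Nat.sub_le J i
        gcongr
    · rw [filter_false_of_mem]
      · rw [card_empty, Nat.cast_zero]
        have := poissonMax_nonneg J
        positivity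
      · rintro S - ⟨-, -, j, hj, -⟩
        omega
  have hcover := card_le_card_filter_add 𝒯 (fun S => #S ≤ J - m) (fun S => J + m + 1 ≤ #S)
    (fun S => J - m + 1 ≤ #S ∧ #S ≤ J + m ∧ ∃ b, q + 1 ≤ blockCount S b)
    (fun S => #S ≤ J + m ∧ (∀ b, blockCount S b ≤ q + 1) ∧
      ∃ j, j + i ≤ J ∧ j + m + 1 ≤ #(smoothPart j S))
    (fun S => J - m + 1 ≤ #S ∧ #S ≤ J + m ∧ ∀ j ≤ J, #(smoothPart j S) ≤ j + (m + i)) ?_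
  · have hcover' : (#𝒯 : ℝ) ≤ _ := Nat.cast_le.2 hcover
    push_cast at hcover' hA hB hD hG hF ⊢
    linarith
  · intro S _
    by_cases h1 : #S ≤ J - m
    · exact Or.inl h1
    by_cases h2 : J + m + 1 ≤ #S
    · exact Or.inr (Or.inl h2)
    have h3 : J - m + 1 ≤ #S := by omega
    have h4 : #S ≤ J + m := by omega
    by_cases h5 : ∃ b, q + 1 ≤ blockCount S b
    · exact Or.inr (Or.inr (Or.inl ⟨h3, h4, h5⟩))
    push Not at h5
    by_cases h6 : ∃ j, j + i ≤ J ∧ j + m + 1 ≤ #(smoothPart j S)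
    · exact Or.inr (Or.inr (Or.inr (Or.inl ⟨h4, fun b => (h5 b).le, h6⟩)))
    push Not at h6
    refine Or.inr (Or.inr (Or.inr (Or.inr ⟨h3, h4, fun j hj => ?_⟩)))
    by_cases hji : j + i ≤ J
    · have := h6 j hji
      omega
    · have : #(smoothPart j S) ≤ #S := card_le_card (filter_subset _ _)
      omega

lemma inv_sq_le_log_two_pow_mul {J : ℕ} (hJ : 1 ≤ J) :
    ((J : ℝ) ^ 2)⁻¹ ≤ Real.log 2 ^ J * poissonMax J * (J : ℝ) ^ (-(1 / 50) : ℝ) := by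
  have hJ1 : (1 : ℝ) ≤ J := by exact_mod_cast hJ
  have hJ0 : (0 : ℝ) < J := by linarith
  have h1 : (1 : ℝ) ≤ Real.log 2 ^ J * Real.exp J := by
    rw [← mul_one (J : ℝ), Real.exp_nat_mul, ← mul_pow]
    refine one_le_pow₀ ?_
    nlinarith [Real.log_two_gt_d9, Real.exp_one_gt_d9]
  have h2 : √(J : ℝ) ≤ J := Real.sqrt_le_self_iff.2 (Or.inr hJ1)
  have h3 : (J : ℝ)⁻¹ ≤ (J : ℝ) ^ (-(1 / 50) : ℝ) := by
    rw [← Real.rpow_neg_one]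
    exact Real.rpow_le_rpow_of_exponent_le hJ1 (by norm_num)
  have h4 : (J : ℝ)⁻¹ ≤ Real.log 2 ^ J * poissonMax J := by
    rw [poissonMax, ← mul_div_assoc, le_div_iff₀ (by positivity)]
    refine le_trans ?_ h1
    rw [inv_mul_le_iff₀ hJ0]
    linarith
  calc ((J : ℝ) ^ 2)⁻¹ = (J : ℝ)⁻¹ * (J : ℝ)⁻¹ := by rw [pow_two, mul_inv]
    _ ≤ _ := mul_le_mul h4 h3 (by positivity) (le_trans (by positivity) h4)

lemma sqrt_add_rpow_le {J : ℕ} (hJ : 1 ≤ J) {x M C : ℝ} (hM : 1 < M) (hx : M ^ (15 / 8 : ℝ) ≤ x)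
    (hxM : x ≤ M ^ 2) (hJM : (2 : ℝ) ^ J ≤ C * Real.log M) :
    3 * √x + 2 * (J + 2) * M ^ (11 / 8 : ℝ) ≤ 3456 * C ^ 3 * ((x / Real.log M) *
      (Real.log 2 ^ J * poissonMax J * (J : ℝ) ^ (-(1 / 50) : ℝ))) := by
  have hJ1 : (1 : ℝ) ≤ J := by exact_mod_cast hJ
  have hM0 : 0 < M := by linarith
  have hl := Real.log_pos hM
  set ℓ := Real.log M with hℓ
  have hx0 : 0 < x := (Real.rpow_pos_of_pos hM0 _).trans_le hx
  have hJC : (J : ℝ) ≤ C * ℓ := le_trans (by exact_mod_cast Nat.lt_two_pow_self.le) hJM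
  have hs : √x ≤ M ^ (11 / 8 : ℝ) := by
    calc √x ≤ M := Real.sqrt_le_iff.2 ⟨hM0.le, hxM⟩
      _ = M ^ (1 : ℝ) := (Real.rpow_one M).symm
      _ ≤ _ := Real.rpow_le_rpow_of_exponent_le hM.le (by norm_num)
  have hp : 0 < M ^ (11 / 8 : ℝ) := Real.rpow_pos_of_pos hM0 _
  have h4 : ℓ ^ 4 * M ^ (11 / 8 : ℝ) ≤ 384 * x := by
    have h5 := Real.pow_div_factorial_le_exp (ℓ / 2) (by positivity) 4
    have h6 : Real.exp (ℓ / 2) = M ^ (1 / 2 : ℝ) := by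
      rw [Real.rpow_def_of_pos hM0, hℓ]
      congr 1
      ring
    rw [h6] at h5
    have h7 : ℓ ^ 4 ≤ 384 * M ^ (1 / 2 : ℝ) := by
      norm_num [Nat.factorial] at h5 ⊢
      linarith
    calc ℓ ^ 4 * M ^ (11 / 8 : ℝ) ≤ 384 * M ^ (1 / 2 : ℝ) * M ^ (11 / 8 : ℝ) := by gcongr
      _ = 384 * M ^ (15 / 8 : ℝ) := by
          rw [mul_assoc, ← Real.rpow_add hM0]
          norm_num
      _ ≤ _ := by gcongr
  have hq := inv_sq_le_log_two_pow_mul hJ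
  set q := Real.log 2 ^ J * poissonMax J * (J : ℝ) ^ (-(1 / 50) : ℝ)
  have hq' : 1 ≤ (J : ℝ) ^ 2 * q := by
    rwa [inv_le_iff_one_le_mul₀' (by positivity)] at hq
  have hq0 : 0 ≤ q := le_trans (by positivity) hq
  calc 3 * √x + 2 * (J + 2) * M ^ (11 / 8 : ℝ) ≤ 9 * J * M ^ (11 / 8 : ℝ) := by
        nlinarith
    _ ≤ 9 * J * M ^ (11 / 8 : ℝ) * ((J : ℝ) ^ 2 * q) := le_mul_of_one_le_right (by positivity) hq'
    _ = 9 * (J : ℝ) ^ 3 * M ^ (11 / 8 : ℝ) * q := by ring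
    _ ≤ 9 * (C * ℓ) ^ 3 * M ^ (11 / 8 : ℝ) * q := by gcongr
    _ = 9 * C ^ 3 * (ℓ ^ 4 * M ^ (11 / 8 : ℝ)) / ℓ * q := by field_simp
    _ ≤ 9 * C ^ 3 * (384 * x) / ℓ * q := by
        have : 0 ≤ C := by
          by_contra hc
          have := mul_neg_of_neg_of_pos (not_le.1 hc) hl
          linarith
        gcongr
    _ = _ := by ring

lemma card_factorable_le_blocks : ∃ C : ℝ, 1 ≤ C ∧ ∀ M : ℝ, 2 ≤ M → ∃ J : ℕ, 1 ≤ J ∧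
    (2 : ℝ) ^ J ≤ C * Real.log M ∧ Real.log M ≤ C * 2 ^ J ∧
    ∀ x : ℝ, M ^ (15 / 8 : ℝ) ≤ x → x ≤ M ^ 2 →
      ∀ 𝒯 : Finset (Finset ℕ), (∀ S ∈ 𝒯, IsFactorable x M S) →
        (#𝒯 : ℝ) ≤ C * ((1 + Real.log (M ^ 2 / x)) * (x / Real.log M) *
          (Real.log 2 ^ J * poissonMax J * (J : ℝ) ^ (-(1 / 50) : ℝ))) := by
  obtain ⟨C₁, hC₁, hcover⟩ := exists_blk_cover
  set C₀ := max C₁ 1 with hC₀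
  have h1C : 1 ≤ C₀ := le_max_right _ _
  obtain ⟨K, hK1, hK⟩ := exists_walk_parameters h1C
  set e := Real.exp (2 * Real.exp 2)
  have he : 0 < e := Real.exp_pos _
  have hCK : 0 ≤ C₀ * K := by positivity
  refine ⟨C₀ + (3456 * C₀ ^ 3 + 512 * (C₀ * K) + 16 * K + 16 * (e * K) + 3584 * (C₀ * K) + 16 * K),
    ?_, fun M hM => ?_⟩
  · have : 0 ≤ 3456 * C₀ ^ 3 + 512 * (C₀ * K) + 16 * K + 16 * (e * K) + 3584 * (C₀ * K) + 16 * K := by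
      positivity
    linarith
  obtain ⟨J, hJ, hMJ, h2J, hlJ⟩ := hcover M hM
  obtain ⟨m, q, i, hm, hi, k1, k2, k3, k4, k5⟩ := hK J hJ
  have hM1 : 1 < M := by linarith
  have hl := Real.log_pos hM1
  have h2J' : (2 : ℝ) ^ J ≤ C₀ * Real.log M := h2J.trans (by gcongr; exact le_max_left _ _)
  have hle : C₀ ≤ C₀ + (3456 * C₀ ^ 3 + 512 * (C₀ * K) + 16 * K + 16 * (e * K) +
      3584 * (C₀ * K) + 16 * K) := by
    rw [le_add_iff_nonneg_right]
    positivity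
  refine ⟨J, hJ, h2J'.trans (by gcongr), hlJ.trans ?_, fun x hx hxM 𝒯 hT => ?_⟩
  · gcongr
    exact (le_max_left _ _).trans hle
  have hMx : M ≤ x := by
    refine le_trans ?_ hx
    conv_lhs => rw [← Real.rpow_one M]
    exact Real.rpow_le_rpow_of_exponent_le hM1.le (by norm_num)
  have hx0 : 0 < x := by linarith
  have hu : 0 ≤ Real.log (M ^ 2 / x) := Real.log_nonneg (by rwa [one_le_div hx0])
  have main := card_factorable_le_sum hJ hm hM1 hMx hxM hMJ (by linarith) hi h2J' 𝒯 hT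
  have hsq := sqrt_add_rpow_le hJ hM1 hx hxM h2J'
  have hE := poissonMax_nonneg J
  have ha : 0 < Real.log 2 := Real.log_pos (by norm_num)
  have hJ0 : (0 : ℝ) < J := by exact_mod_cast hJ
  have hX : x / Real.log x ≤ x / Real.log M := by gcongr
  have hlx : 0 ≤ x / Real.log x := div_nonneg hx0.le (Real.log_nonneg (by linarith))
  set a := Real.log 2
  set E := poissonMax J
  set R := (J : ℝ) ^ (-(1 / 50) : ℝ)
  have hR : 0 < R := Real.rpow_pos_of_pos hJ0 _
  set ℓ := Real.log M
  set U := 1 + Real.log (M ^ 2 / x)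
  have hU : 1 ≤ U := by linarith
  set X := x / ℓ
  have hX0 : 0 < X := by positivity
  have hUX : X ≤ U * X := le_mul_of_one_le_left hX0.le hU
  have e1 : a ^ (J - m) = a ^ J * (a ^ m)⁻¹ := by
    rw [pow_sub₀ _ ha.ne' hm]
  have e2 : (2 * a) ^ (J - m) = 2 ^ J * a ^ J * ((2 * a) ^ m)⁻¹ := by
    rw [pow_sub₀ _ (by positivity) hm, mul_pow]
  have t1 : 512 * (x * U / ℓ ^ 2) * ((2 * a) ^ (J - m) * E) ≤
      512 * (C₀ * K) * (U * X * (a ^ J * E * R)) := by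
    calc 512 * (x * U / ℓ ^ 2) * ((2 * a) ^ (J - m) * E)
        ≤ 512 * (x * U / ℓ ^ 2) * (((C₀ * ℓ) * a ^ J * (K * R)) * E) := by
          rw [e2]
          gcongr
      _ = _ := by
          simp only [X]
          field_simp
  have t2 : 16 * (x / Real.log x) * (a ^ (J + m) * E) ≤ 16 * K * (U * X * (a ^ J * E * R)) := by
    calc 16 * (x / Real.log x) * (a ^ (J + m) * E)
        = 16 * (x / Real.log x) * (a ^ J * a ^ m * E) := by rw [pow_add]
      _ ≤ 16 * (U * X) * (a ^ J * (K * R) * E) := by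
          gcongr
          exact hX.trans hUX
      _ = _ := by ring
  have t3 : 16 * (J * e / Real.exp 2 ^ q) * (x / Real.log x) * (a ^ (J - m) * E) ≤
      16 * (e * K) * (U * X * (a ^ J * E * R)) := by
    calc 16 * (J * e / Real.exp 2 ^ q) * (x / Real.log x) * (a ^ (J - m) * E)
        = 16 * (J / Real.exp 2 ^ q * (a ^ m)⁻¹) * e * (x / Real.log x) * (a ^ J * E) := by
          rw [e1]
          ring
      _ ≤ 16 * (K * R) * e * (U * X) * (a ^ J * E) := by
          gcongr
          exact hX.trans hUX
      _ = _ := by ring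
  have t4 : 3584 * (x * U * (q + 1 : ℕ) / ℓ ^ 2) / 2 ^ m * ((2 * a) ^ (J + m) * E) ≤
      3584 * (C₀ * K) * (U * X * (a ^ J * E * R)) := by
    calc 3584 * (x * U * (q + 1 : ℕ) / ℓ ^ 2) / 2 ^ m * ((2 * a) ^ (J + m) * E)
        = 3584 * (x * U / ℓ ^ 2) * ((q + 1) * a ^ m) * (2 ^ J * a ^ J * E) := by
          rw [mul_pow, pow_add, pow_add]
          push_cast
          field_simp
      _ ≤ 3584 * (x * U / ℓ ^ 2) * (K * R) * ((C₀ * ℓ) * a ^ J * E) := by gcongr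
      _ = _ := by
          simp only [X]
          field_simp
  have t5 : 16 * ((2 * m + i + 1 : ℕ) * Real.exp (2 * ((m + i : ℕ) + 1)) / J) * (x / Real.log x) *
      (a ^ (J - m) * E) ≤ 16 * K * (U * X * (a ^ J * E * R)) := by
    calc 16 * ((2 * m + i + 1 : ℕ) * Real.exp (2 * ((m + i : ℕ) + 1)) / J) * (x / Real.log x) *
          (a ^ (J - m) * E)
        = 16 * ((2 * m + i + 1 : ℕ) * Real.exp (2 * ((m + i : ℕ) + 1)) / J * (a ^ m)⁻¹) *
          (x / Real.log x) * (a ^ J * E) := by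
          rw [e1]
          ring
      _ ≤ 16 * (K * R) * (U * X) * (a ^ J * E) := by
          gcongr
          exact hX.trans hUX
      _ = _ := by ring
  have hZ : 0 ≤ a ^ J * E * R := by positivity
  have t0 : 3456 * C₀ ^ 3 * (X * (a ^ J * E * R)) ≤ 3456 * C₀ ^ 3 * (U * X * (a ^ J * E * R)) := by
    gcongr
  have hZ' : 0 ≤ C₀ * (U * X * (a ^ J * E * R)) := by positivity
  calc (#𝒯 : ℝ) ≤ _ := main
    _ ≤ 3456 * C₀ ^ 3 * (U * X * (a ^ J * E * R)) + 512 * (C₀ * K) * (U * X * (a ^ J * E * R)) +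
        16 * K * (U * X * (a ^ J * E * R)) + 16 * (e * K) * (U * X * (a ^ J * E * R)) +
        3584 * (C₀ * K) * (U * X * (a ^ J * E * R)) + 16 * K * (U * X * (a ^ J * E * R)) := by
        gcongr
        exact hsq.trans t0
    _ ≤ C₀ * (U * X * (a ^ J * E * R)) + (3456 * C₀ ^ 3 * (U * X * (a ^ J * E * R)) +
        512 * (C₀ * K) * (U * X * (a ^ J * E * R)) +
        16 * K * (U * X * (a ^ J * E * R)) + 16 * (e * K) * (U * X * (a ^ J * E * R)) +
        3584 * (C₀ * K) * (U * X * (a ^ J * E * R)) + 16 * K * (U * X * (a ^ J * E * R))) :=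
        le_add_of_nonneg_left hZ'
    _ = _ := by ring

/-- The proportion of products in an `M × M` multiplication table, up to a constant. -/
noncomputable def saving (M : ℝ) : ℝ :=
  Real.log M ^ (-erdosC) * Real.log (Real.log M) ^ (-(13 / 25) : ℝ)

lemma one_half_lt_one_add_log_log_two_div : 1 / 2 < (1 + Real.log (Real.log 2)) / Real.log 2 := by
  have ha1 := Real.log_two_gt_d9
  have ha2 := Real.log_two_lt_d9
  have hl2 : 0 < Real.log 2 := by linarith
  have h1 : Real.exp (-(1 / 2)) ≤ Real.log 2 := by
    rw [Real.exp_neg, inv_le_comm₀ (Real.exp_pos _) hl2]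
    have h2 := Real.add_one_le_exp (1 / 2 : ℝ)
    refine le_trans ?_ h2
    rw [inv_le_comm₀ hl2 (by norm_num)]
    norm_num
    linarith
  have := (Real.le_log_iff_exp_le hl2).2 h1
  rw [lt_div_iff₀ hl2]
  linarith

lemma erdosC_lt_half : erdosC < 1 / 2 := by
  have := one_half_lt_one_add_log_log_two_div
  rw [erdosC]
  linarith

lemma card_factorable_le_saving : ∃ C M₀ : ℝ, 0 < C ∧ 3 ≤ M₀ ∧ ∀ M : ℝ, M₀ ≤ M → ∀ x : ℝ,
    M ^ (15 / 8 : ℝ) ≤ x → x ≤ M ^ 2 → ∀ 𝒯 : Finset (Finset ℕ),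
      (∀ S ∈ 𝒯, IsFactorable x M S) →
        (#𝒯 : ℝ) ≤ C * ((1 + Real.log (M ^ 2 / x)) * x * saving M) := by
  obtain ⟨C, hC1, hC⟩ := card_factorable_le_blocks
  have hC0 : 0 < C := by linarith
  set κ := (1 + Real.log (Real.log 2)) / Real.log 2 with hκ
  have hl2 : 0 < Real.log 2 := Real.log_pos (by norm_num)
  have hκ0 : 0 ≤ κ := by linarith [one_half_lt_one_add_log_log_two_div]
  have hc : erdosC = 1 - κ := rfl
  refine ⟨C * C ^ κ * 2, Real.exp (Real.exp (2 * Real.log C + 1)), by positivity, ?_,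
    fun M hM x hx hxM 𝒯 hT => ?_⟩
  · have h1 : Real.exp 1 ≤ Real.exp (2 * Real.log C + 1) :=
      Real.exp_le_exp.2 (by linarith [Real.log_nonneg hC1])
    have h2 := Real.exp_one_gt_d9
    have h3 := Real.add_one_le_exp (Real.exp (2 * Real.log C + 1))
    linarith
  have hM0 : 0 < M := (Real.exp_pos _).trans_le hM
  have hl : Real.exp (2 * Real.log C + 1) ≤ Real.log M := (Real.le_log_iff_exp_le hM0).2 hM
  have hl0 : 0 < Real.log M := (Real.exp_pos _).trans_le hl
  have hll : 2 * Real.log C + 1 ≤ Real.log (Real.log M) := (Real.le_log_iff_exp_le hl0).2 hl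
  have hlC := Real.log_nonneg hC1
  have hM2 : 2 ≤ M := by
    have h3 := Real.add_one_le_exp (Real.exp (2 * Real.log C + 1))
    have h4 := Real.add_one_le_exp (2 * Real.log C + 1)
    linarith
  obtain ⟨J, hJ, h2J, hlJ, hcard⟩ := hC M hM2
  have hJ0 : (0 : ℝ) < J := by exact_mod_cast hJ
  have hx0 : 0 < x := (Real.rpow_pos_of_pos hM0 _).trans_le hx
  have hu : 0 ≤ Real.log (M ^ 2 / x) := Real.log_nonneg (by rwa [one_le_div hx0])
  refine (hcard x hx hxM 𝒯 hT).trans ?_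
  have hJll : Real.log (Real.log M) / 2 ≤ J := by
    have h1 := Real.log_le_log hl0 hlJ
    rw [Real.log_mul hC0.ne' (by positivity), Real.log_pow] at h1
    nlinarith [Real.log_two_lt_d9]
  have hpow : Real.log 2 ^ J * Real.exp J ≤ C ^ κ * Real.log M ^ κ := by
    calc Real.log 2 ^ J * Real.exp J = ((2 : ℝ) ^ J) ^ κ := by
          rw [Real.rpow_def_of_pos (by positivity), Real.log_pow, hκ]
          conv_lhs => rw [← Real.exp_log hl2, ← Real.exp_nat_mul, ← Real.exp_add]
          congr 1
          field_simp
          ring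
      _ ≤ (C * Real.log M) ^ κ := Real.rpow_le_rpow (by positivity) h2J hκ0
      _ = _ := Real.mul_rpow hC0.le hl0.le
  have hJp : (√(J : ℝ))⁻¹ * (J : ℝ) ^ (-(1 / 50) : ℝ) ≤ 2 * Real.log (Real.log M) ^ (-(13 / 25) : ℝ) := by
    calc (√(J : ℝ))⁻¹ * (J : ℝ) ^ (-(1 / 50) : ℝ) = (J : ℝ) ^ (-(13 / 25) : ℝ) := by
          rw [Real.sqrt_eq_rpow, ← Real.rpow_neg hJ0.le, ← Real.rpow_add hJ0]
          norm_num
      _ ≤ (Real.log (Real.log M) / 2) ^ (-(13 / 25) : ℝ) :=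
          Real.rpow_le_rpow_of_nonpos (by linarith) hJll (by norm_num)
      _ = 2 ^ (13 / 25 : ℝ) * Real.log (Real.log M) ^ (-(13 / 25) : ℝ) := by
          rw [Real.div_rpow (by linarith) (by norm_num), Real.rpow_neg (by norm_num : (0 : ℝ) ≤ 2)]
          field_simp
      _ ≤ 2 * Real.log (Real.log M) ^ (-(13 / 25) : ℝ) := by
          have h2 : (2 : ℝ) ^ (13 / 25 : ℝ) ≤ 2 ^ (1 : ℝ) :=
            Real.rpow_le_rpow_of_exponent_le (by norm_num) (by norm_num)
          rw [Real.rpow_one] at h2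
          have : 0 ≤ Real.log (Real.log M) ^ (-(13 / 25) : ℝ) :=
            Real.rpow_nonneg (by linarith) _
          gcongr
  have hκl : Real.log M ^ (-erdosC) = Real.log M ^ κ / Real.log M := by
    rw [hc, neg_sub, Real.rpow_sub_one hl0.ne']
  calc C * ((1 + Real.log (M ^ 2 / x)) * (x / Real.log M) *
        (Real.log 2 ^ J * poissonMax J * (J : ℝ) ^ (-(1 / 50) : ℝ)))
      = C * ((1 + Real.log (M ^ 2 / x)) * (x / Real.log M) *
        ((Real.log 2 ^ J * Real.exp J) * ((√(J : ℝ))⁻¹ * (J : ℝ) ^ (-(1 / 50) : ℝ)))) := by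
        rw [poissonMax]
        ring
    _ ≤ C * ((1 + Real.log (M ^ 2 / x)) * (x / Real.log M) *
        ((C ^ κ * Real.log M ^ κ) * (2 * Real.log (Real.log M) ^ (-(13 / 25) : ℝ)))) := by
        gcongr
    _ = _ := by
        rw [saving, hκl]
        ring

/-- The set of products in the `M × M` multiplication table. -/
noncomputable def mulTable (M : ℕ) : Finset ℕ := image₂ (· * ·) (Icc 1 M) (Icc 1 M)

lemma mem_mulTable {M n : ℕ} :
    n ∈ mulTable M ↔ ∃ a b, (1 ≤ a ∧ a ≤ M) ∧ (1 ≤ b ∧ b ≤ M) ∧ a * b = n := by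
  simp [mulTable, mem_image₂]

lemma setProd_primeFactors {n : ℕ} (hn : Squarefree n) : setProd n.primeFactors = n := by
  conv_rhs => rw [← Nat.prod_primeFactors_of_squarefree hn]
  simp

lemma exists_sq_mul_setProd {M a b : ℕ} (ha : 1 ≤ a) (haM : a ≤ M) (hb : 1 ≤ b) (hbM : b ≤ M) :
    ∃ D S, 1 ≤ D ∧ D ≤ M ∧ a * b = D ^ 2 * ∏ p ∈ S, p ∧ S ⊆ range (M + 1) ∧
      IsFactorable (((a * b : ℕ) : ℝ) / (D : ℝ) ^ 2) M S := by
  obtain ⟨a', c, hac, ha'⟩ := Nat.sq_mul_squarefree a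
  obtain ⟨b', d, hbd, hb'⟩ := Nat.sq_mul_squarefree b
  obtain ⟨u, v, huv, hu, hv⟩ := Nat.exists_coprime a' b'
  set g := a'.gcd b'
  have hab : a * b = (c * d * g) ^ 2 * (u * v) := by
    rw [← hac, ← hbd, hu, hv]
    ring
  have hab0 : a * b ≠ 0 := by positivity
  have hD0 : c * d * g ≠ 0 := by
    rintro h
    rw [hab, h] at hab0
    simp at hab0
  have huS : Squarefree u := ha'.squarefree_of_dvd ⟨g, hu⟩
  have hvS : Squarefree v := hb'.squarefree_of_dvd ⟨g, hv⟩
  have hua : u ≤ M := (Nat.le_of_dvd ha ⟨c ^ 2 * g, by rw [← hac, hu]; ring⟩).trans haM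
  have hvb : v ≤ M := (Nat.le_of_dvd hb ⟨d ^ 2 * g, by rw [← hbd, hv]; ring⟩).trans hbM
  have hdisj := huv.disjoint_primeFactors
  have hprod : ∏ p ∈ u.primeFactors ∪ v.primeFactors, p = u * v := by
    rw [prod_union hdisj, Nat.prod_primeFactors_of_squarefree huS,
      Nat.prod_primeFactors_of_squarefree hvS]
  have huv0 : 1 ≤ u * v := Nat.one_le_iff_ne_zero.2 fun h => hab0 (by rw [hab, h, mul_zero])
  refine ⟨c * d * g, u.primeFactors ∪ v.primeFactors, Nat.one_le_iff_ne_zero.2 hD0, ?_, ?_, ?_,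
    ?_, ?_, ⟨u.primeFactors, v.primeFactors, rfl, hdisj, ?_, ?_⟩⟩
  · refine (Nat.pow_le_pow_iff_left two_ne_zero).1 ?_
    calc (c * d * g) ^ 2 ≤ (c * d * g) ^ 2 * (u * v) := Nat.le_mul_of_pos_right _ huv0
      _ = a * b := hab.symm
      _ ≤ M * M := Nat.mul_le_mul haM hbM
      _ = M ^ 2 := (sq M).symm
  · rw [hprod, hab]
  · intro p hp
    rw [mem_union] at hp
    rw [mem_range]
    rcases hp with hp | hp
    · exact Nat.lt_succ_of_le ((Nat.le_of_mem_primeFactors hp).trans hua)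
    · exact Nat.lt_succ_of_le ((Nat.le_of_mem_primeFactors hp).trans hvb)
  · intro p hp
    rw [mem_union] at hp
    rcases hp with hp | hp <;> exact Nat.prime_of_mem_primeFactors hp
  · have h1 : setProd (u.primeFactors ∪ v.primeFactors) = ((u * v : ℕ) : ℝ) := by
      rw [← hprod]
      simp
    have h2 : (0 : ℝ) < ((c * d * g : ℕ) : ℝ) ^ 2 := by positivity
    rw [h1, le_div_iff₀ h2, hab]
    push_cast
    exact le_of_eq (by ring)
  · rw [setProd_primeFactors huS]
    exact_mod_cast hua
  · rw [setProd_primeFactors hvS]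
    exact_mod_cast hvb

lemma card_mulTable_le_sum {M : ℕ} {x : ℝ} : (#((mulTable M).filter fun n : ℕ => (n : ℝ) ≤ x) : ℝ) ≤
    ∑ D ∈ Icc 1 M, (#{S ∈ (range (M + 1)).powerset | IsFactorable (x / (D : ℝ) ^ 2) M S} : ℝ) := by
  have hsub : ((mulTable M).filter fun n : ℕ => (n : ℝ) ≤ x) ⊆ (Icc 1 M).biUnion fun D =>
      ({S ∈ (range (M + 1)).powerset | IsFactorable (x / (D : ℝ) ^ 2) M S}).image
        fun S => D ^ 2 * ∏ p ∈ S, p := by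
    intro n hn
    rw [mem_filter, mem_mulTable] at hn
    obtain ⟨⟨a, b, ⟨ha, haM⟩, ⟨hb, hbM⟩, rfl⟩, hx⟩ := hn
    obtain ⟨D, S, hD1, hDM, hab, hS, hf⟩ := exists_sq_mul_setProd ha haM hb hbM
    rw [mem_biUnion]
    refine ⟨D, mem_Icc.2 ⟨hD1, hDM⟩, mem_image.2 ⟨S, mem_filter.2 ⟨mem_powerset.2 hS, ?_⟩, hab.symm⟩⟩
    exact ⟨hf.prime, hf.le.trans (by gcongr), hf.split⟩
  have h1 := (card_le_card hsub).trans (card_biUnion_le.trans (sum_le_sum fun D _ => card_image_le))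
  exact_mod_cast h1

lemma rpow_neg_le_saving : ∃ M₀ : ℝ, 3 ≤ M₀ ∧ ∀ M : ℝ, M₀ ≤ M →
    M ^ (-(1 / 64) : ℝ) ≤ 8192 * saving M := by
  refine ⟨Real.exp (Real.exp 1), ?_, fun M hM => ?_⟩
  · have h1 := Real.add_one_le_exp (Real.exp 1)
    have h2 := Real.exp_one_gt_d9
    linarith
  have hM0 : 0 < M := (Real.exp_pos _).trans_le hM
  have hl : Real.exp 1 ≤ Real.log M := (Real.le_log_iff_exp_le hM0).2 hM
  have hl0 : 0 < Real.log M := (Real.exp_pos _).trans_le hl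
  have hll : 1 ≤ Real.log (Real.log M) := (Real.le_log_iff_exp_le hl0).2 hl
  have hl1 : 1 ≤ Real.log M := by linarith [Real.exp_one_gt_d9]
  have h1 : (Real.log M)⁻¹ ≤ Real.log M ^ (-erdosC) := by
    rw [← Real.rpow_neg_one]
    exact Real.rpow_le_rpow_of_exponent_le hl1 (by linarith [erdosC_lt_half])
  have h2 : (Real.log M)⁻¹ ≤ Real.log (Real.log M) ^ (-(13 / 25) : ℝ) := by
    calc (Real.log M)⁻¹ ≤ (Real.log (Real.log M))⁻¹ := by
          gcongr
          linarith [Real.log_le_sub_one_of_pos hM0]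
      _ ≤ _ := by
          rw [← Real.rpow_neg_one]
          exact Real.rpow_le_rpow_of_exponent_le hll (by norm_num)
  have h3 : (Real.log M ^ 2)⁻¹ ≤ saving M := by
    rw [sq, mul_inv, saving]
    exact mul_le_mul h1 h2 (by positivity) (by positivity)
  have h4 := Real.pow_div_factorial_le_exp (Real.log M / 64) (by positivity) 2
  have h5 : M ^ (-(1 / 64) : ℝ) = (Real.exp (Real.log M / 64))⁻¹ := by
    rw [Real.rpow_def_of_pos hM0, ← Real.exp_neg]
    congr 1
    ring
  rw [h5]
  refine le_trans ?_ (mul_le_mul_of_nonneg_left h3 (by norm_num))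
  rw [← div_eq_mul_inv, inv_le_comm₀ (Real.exp_pos _) (by positivity), inv_div]
  norm_num [Nat.factorial] at h4
  linarith

lemma saving_nonneg {M : ℝ} (hM : 3 ≤ M) : 0 ≤ saving M := by
  have h1 : 1 ≤ Real.log M := by
    rw [Real.le_log_iff_exp_le (by linarith)]
    linarith [Real.exp_one_lt_d9]
  exact mul_nonneg (Real.rpow_nonneg (by linarith) _) (Real.rpow_nonneg (Real.log_nonneg h1) _)

lemma summable_rpow_neg_three_halves : Summable fun D : ℕ => (D : ℝ) ^ (-(3 / 2) : ℝ) :=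
  Real.summable_nat_rpow.2 (by norm_num)

lemma card_mulTable_le : ∃ C M₀ : ℝ, 0 < C ∧ 3 ≤ M₀ ∧ ∀ M : ℕ, M₀ ≤ M → ∀ x : ℝ,
    (M : ℝ) ^ (31 / 16 : ℝ) ≤ x → x ≤ (M : ℝ) ^ 2 →
      (#((mulTable M).filter fun n : ℕ => (n : ℝ) ≤ x) : ℝ) ≤
        C * ((1 + Real.log ((M : ℝ) ^ 2 / x)) * x * saving M) := by
  obtain ⟨C, M₀, hC, hM₀, hfac⟩ := card_factorable_le_saving
  obtain ⟨M₁, hM₁, hsav⟩ := rpow_neg_le_saving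
  set W := ∑' D : ℕ, (D : ℝ) ^ (-(3 / 2) : ℝ) with hW
  have hW0 : 0 ≤ W := tsum_nonneg fun D => Real.rpow_nonneg (Nat.cast_nonneg D) _
  refine ⟨(4 * C + 8192) * (W + 1), max M₀ M₁, by positivity, hM₀.trans (le_max_left _ _),
    fun M hM x hx hxM => ?_⟩
  have hM0 : M₀ ≤ M := (le_max_left _ _).trans hM
  have hM1 : M₁ ≤ M := (le_max_right _ _).trans hM
  have hM3 : (3 : ℝ) ≤ M := hM₀.trans hM0
  have hMp : (0 : ℝ) < M := by linarith
  have hx0 : 0 < x := (Real.rpow_pos_of_pos hMp _).trans_le hx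
  have hu : 0 ≤ Real.log ((M : ℝ) ^ 2 / x) := Real.log_nonneg (by rwa [one_le_div hx0])
  have hg := saving_nonneg hM3
  set u := Real.log ((M : ℝ) ^ 2 / x) with hudef
  have key : ∀ D ∈ Icc 1 M,
      (#{S ∈ (range (M + 1)).powerset | IsFactorable (x / (D : ℝ) ^ 2) M S} : ℝ) ≤
        (4 * C + 8192) * ((1 + u) * x * saving M) * (D : ℝ) ^ (-(3 / 2) : ℝ) := by
    intro D hD
    have hD1 : (1 : ℝ) ≤ D := by exact_mod_cast (mem_Icc.1 hD).1
    have hD0 : (0 : ℝ) < D := by linarith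
    have hp0 : 0 < (D : ℝ) ^ (-(3 / 2) : ℝ) := Real.rpow_pos_of_pos hD0 _
    have hD2 : ((D : ℝ) ^ 2)⁻¹ = (D : ℝ) ^ (-(1 / 2) : ℝ) * (D : ℝ) ^ (-(3 / 2) : ℝ) := by
      rw [← Real.rpow_add hD0, ← Real.rpow_natCast, ← Real.rpow_neg hD0.le]
      norm_num
    have hxs : 0 ≤ x * saving M * (D : ℝ) ^ (-(3 / 2) : ℝ) := by positivity
    by_cases hDM : (D : ℝ) ≤ (M : ℝ) ^ (1 / 32 : ℝ)
    · have h1 : (M : ℝ) ^ (15 / 8 : ℝ) ≤ x / (D : ℝ) ^ 2 := by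
        rw [le_div_iff₀ (by positivity)]
        calc (M : ℝ) ^ (15 / 8 : ℝ) * (D : ℝ) ^ 2
            ≤ (M : ℝ) ^ (15 / 8 : ℝ) * ((M : ℝ) ^ (1 / 32 : ℝ)) ^ 2 := by gcongr
          _ = (M : ℝ) ^ (31 / 16 : ℝ) := by
              rw [← Real.rpow_natCast ((M : ℝ) ^ (1 / 32 : ℝ)), ← Real.rpow_mul hMp.le,
                ← Real.rpow_add hMp]
              norm_num
          _ ≤ x := hx
      have h2 : x / (D : ℝ) ^ 2 ≤ (M : ℝ) ^ 2 :=
        (div_le_self hx0.le (one_le_pow₀ hD1)).trans hxM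
      have h3 := hfac M hM0 _ h1 h2
        {S ∈ (range (M + 1)).powerset | IsFactorable (x / (D : ℝ) ^ 2) M S}
        fun S hS => (mem_filter.1 hS).2
      refine h3.trans ?_
      have h4 : Real.log ((M : ℝ) ^ 2 / (x / (D : ℝ) ^ 2)) = u + 2 * Real.log D := by
        rw [hudef, div_div_eq_mul_div, mul_div_right_comm, Real.log_mul (by positivity)
          (by positivity), Real.log_pow]
        norm_num
      have h5 : 1 + 2 * Real.log D ≤ 4 * (D : ℝ) ^ (1 / 2 : ℝ) := by
        have h6 := Real.log_le_sub_one_of_pos (Real.rpow_pos_of_pos hD0 (1 / 2))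
        rw [Real.log_rpow hD0] at h6
        linarith
      have h7 := Real.log_nonneg hD1
      have h8 : 1 + (u + 2 * Real.log D) ≤ (1 + u) * (4 * (D : ℝ) ^ (1 / 2 : ℝ)) := by
        calc 1 + (u + 2 * Real.log D) ≤ (1 + u) * (1 + 2 * Real.log D) := by nlinarith
          _ ≤ _ := by gcongr
      rw [h4]
      calc C * ((1 + (u + 2 * Real.log D)) * (x / (D : ℝ) ^ 2) * saving M)
          ≤ C * ((1 + u) * (4 * (D : ℝ) ^ (1 / 2 : ℝ)) * (x / (D : ℝ) ^ 2) * saving M) := by gcongr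
        _ = 4 * C * ((1 + u) * x * saving M) *
            ((D : ℝ) ^ (1 / 2 : ℝ) * (D : ℝ) ^ (-(1 / 2) : ℝ)) * (D : ℝ) ^ (-(3 / 2) : ℝ) := by
            rw [div_eq_mul_inv x, hD2]
            ring
        _ = 4 * C * ((1 + u) * x * saving M) * (D : ℝ) ^ (-(3 / 2) : ℝ) := by
            rw [← Real.rpow_add hD0]
            norm_num
        _ ≤ _ := by
            gcongr
            linarith
    · have h1 := card_le_of_setProd_le
        {S ∈ (range (M + 1)).powerset | IsFactorable (x / (D : ℝ) ^ 2) M S}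
        (X := x / (D : ℝ) ^ 2) (by positivity)
        fun S hS => ⟨(mem_filter.1 hS).2.prime, (mem_filter.1 hS).2.le⟩
      have h2 : (D : ℝ) ^ (-(1 / 2) : ℝ) ≤ (M : ℝ) ^ (-(1 / 64) : ℝ) := by
        calc (D : ℝ) ^ (-(1 / 2) : ℝ) ≤ ((M : ℝ) ^ (1 / 32 : ℝ)) ^ (-(1 / 2) : ℝ) :=
              Real.rpow_le_rpow_of_nonpos (Real.rpow_pos_of_pos hMp _) (not_le.1 hDM).le (by norm_num)
          _ = _ := by
              rw [← Real.rpow_mul hMp.le]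
              norm_num
      refine h1.trans ?_
      calc x / (D : ℝ) ^ 2 = x * (D : ℝ) ^ (-(1 / 2) : ℝ) * (D : ℝ) ^ (-(3 / 2) : ℝ) := by
            rw [div_eq_mul_inv x, hD2]
            ring
        _ ≤ x * (8192 * saving M) * (D : ℝ) ^ (-(3 / 2) : ℝ) := by
            gcongr
            exact h2.trans (hsav M hM1)
        _ = 8192 * (1 * x * saving M) * (D : ℝ) ^ (-(3 / 2) : ℝ) := by ring
        _ ≤ _ := by
            gcongr <;> linarith
  have hxs : 0 ≤ (1 + u) * x * saving M := by positivity
  calc (#((mulTable M).filter fun n : ℕ => (n : ℝ) ≤ x) : ℝ) ≤ _ := card_mulTable_le_sum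
    _ ≤ ∑ D ∈ Icc 1 M, (4 * C + 8192) * ((1 + u) * x * saving M) * (D : ℝ) ^ (-(3 / 2) : ℝ) :=
        sum_le_sum key
    _ = (4 * C + 8192) * ((1 + u) * x * saving M) * ∑ D ∈ Icc 1 M, (D : ℝ) ^ (-(3 / 2) : ℝ) := by
        rw [mul_sum]
    _ ≤ (4 * C + 8192) * ((1 + u) * x * saving M) * (W + 1) := by
        gcongr
        have := summable_rpow_neg_three_halves.sum_le_tsum (Icc 1 M)
          fun D _ => Real.rpow_nonneg (Nat.cast_nonneg D) _
        linarith
    _ = _ := by ring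

lemma mem_mulTable_bounds {M n : ℕ} (hn : n ∈ mulTable M) : 1 ≤ n ∧ n ≤ M ^ 2 := by
  obtain ⟨a, b, ⟨ha, haM⟩, ⟨hb, hbM⟩, rfl⟩ := mem_mulTable.1 hn
  exact ⟨Nat.mul_pos ha hb, (Nat.mul_le_mul haM hbM).trans_eq (sq M).symm⟩

lemma one_add_log_le_card {z : ℝ} (hz : 1 ≤ z) {V : ℕ} (hV : z < 2 ^ V) :
    1 + Real.log z ≤ 2 * (#((range V).filter fun v : ℕ => (2 : ℝ) ^ v ≤ z) : ℝ) := by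
  obtain ⟨k, hk1, hk2⟩ := exists_nat_pow_near hz one_lt_two
  have hsub : range (k + 1) ⊆ (range V).filter fun v : ℕ => (2 : ℝ) ^ v ≤ z := by
    intro v hv
    have hvz : (2 : ℝ) ^ v ≤ z :=
      (pow_le_pow_right₀ one_le_two (Nat.lt_succ_iff.1 (mem_range.1 hv))).trans hk1
    exact mem_filter.2 ⟨mem_range.2 ((pow_lt_pow_iff_right₀ one_lt_two).1 (hvz.trans_lt hV)), hvz⟩
  have h1 : ((k + 1 : ℕ) : ℝ) ≤ #((range V).filter fun v : ℕ => (2 : ℝ) ^ v ≤ z) := by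
    have := card_le_card hsub
    rw [card_range] at this
    exact_mod_cast this
  have h2 : Real.log z ≤ (k + 1 : ℕ) * Real.log 2 := by
    rw [← Real.log_pow]
    exact Real.log_le_log (by linarith) hk2.le
  push_cast at h1 h2
  have h3 : (0 : ℝ) ≤ k := Nat.cast_nonneg k
  nlinarith [Real.log_two_lt_d9]

lemma sum_add_one_mul_half_pow_le (V : ℕ) : ∑ v ∈ range V, ((v : ℝ) + 1) * (1 / 2) ^ v ≤ 4 := by
  have h : ∀ V : ℕ, ∑ v ∈ range V, ((v : ℝ) + 1) * (1 / 2) ^ v = 4 - (2 * V + 4) * (1 / 2) ^ V := by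
    intro V
    induction V with
    | zero => norm_num
    | succ V ih =>
      rw [sum_range_succ, ih, pow_succ]
      push_cast
      ring
  rw [h]
  have : (0 : ℝ) ≤ (2 * V + 4) * (1 / 2) ^ V := by positivity
  linarith

lemma sum_one_add_log_mulTable_le {M : ℕ} {C : ℝ} (hM : 1 ≤ M) (hCg : 0 ≤ C)
    (h : ∀ x : ℝ, (M : ℝ) ^ (31 / 16 : ℝ) ≤ x → x ≤ (M : ℝ) ^ 2 →
      (#((mulTable M).filter fun n : ℕ => (n : ℝ) ≤ x) : ℝ) ≤
        C * ((1 + Real.log ((M : ℝ) ^ 2 / x)) * x)) :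
    ∑ A ∈ (mulTable M).filter fun n : ℕ => (M : ℝ) ^ (31 / 16 : ℝ) ≤ n,
      (1 + Real.log ((M : ℝ) ^ 2 / A)) ≤ 8 * C * (M : ℝ) ^ 2 := by
  have hM0 : (0 : ℝ) < M := by exact_mod_cast hM
  set P := (mulTable M).filter fun n : ℕ => (M : ℝ) ^ (31 / 16 : ℝ) ≤ n with hP
  have h1 : ∀ A ∈ P, 1 + Real.log ((M : ℝ) ^ 2 / A) ≤
      2 * (#((range (2 * M)).filter fun v : ℕ => (2 : ℝ) ^ v ≤ (M : ℝ) ^ 2 / A) : ℝ) := by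
    intro A hA
    obtain ⟨hA1, hA2⟩ := mem_mulTable_bounds (mem_filter.1 hA).1
    have hA0 : (1 : ℝ) ≤ A := by exact_mod_cast hA1
    refine one_add_log_le_card ?_ ?_
    · rw [one_le_div (by linarith)]
      exact_mod_cast hA2
    · refine (div_le_self (by positivity) hA0).trans_lt ?_
      rw [mul_comm, pow_mul]
      exact pow_lt_pow_left₀ (by exact_mod_cast Nat.lt_two_pow_self) hM0.le two_ne_zero
  have h2 : ∀ v ∈ range (2 * M),
      (#(P.filter fun A : ℕ => (2 : ℝ) ^ v ≤ (M : ℝ) ^ 2 / A) : ℝ) ≤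
        C * (M : ℝ) ^ 2 * (((v : ℝ) + 1) * (1 / 2) ^ v) := by
    intro v _
    rcases (P.filter fun A : ℕ => (2 : ℝ) ^ v ≤ (M : ℝ) ^ 2 / A).eq_empty_or_nonempty with h0 | ⟨B, hB⟩
    · rw [h0, card_empty, Nat.cast_zero]
      positivity
    have hle : ∀ A ∈ P.filter fun A : ℕ => (2 : ℝ) ^ v ≤ (M : ℝ) ^ 2 / A,
        (A : ℝ) ≤ (M : ℝ) ^ 2 / 2 ^ v := by
      intro A hA
      have hA' := mem_filter.1 hA
      have hA1 := (mem_mulTable_bounds (mem_filter.1 hA'.1).1).1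
      have hA0 : (0 : ℝ) < A := by exact_mod_cast hA1
      rw [le_div_iff₀ (by positivity), mul_comm]
      exact (le_div_iff₀ hA0).1 hA'.2
    have hB1 : (M : ℝ) ^ (31 / 16 : ℝ) ≤ B := (mem_filter.1 (mem_filter.1 hB).1).2
    have h3 := h ((M : ℝ) ^ 2 / 2 ^ v) (hB1.trans (hle B hB))
      (div_le_self (by positivity) (one_le_pow₀ one_le_two))
    calc (#(P.filter fun A : ℕ => (2 : ℝ) ^ v ≤ (M : ℝ) ^ 2 / A) : ℝ)
        ≤ #((mulTable M).filter fun n : ℕ => (n : ℝ) ≤ (M : ℝ) ^ 2 / 2 ^ v) := by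
          refine Nat.cast_le.2 (card_le_card fun A hA => ?_)
          exact mem_filter.2 ⟨(mem_filter.1 (mem_filter.1 hA).1).1, hle A hA⟩
      _ ≤ _ := h3
      _ = C * (M : ℝ) ^ 2 * ((1 + v * Real.log 2) * (1 / 2) ^ v) := by
          rw [div_div_cancel₀ (by positivity), Real.log_pow, one_div, inv_pow, div_eq_mul_inv]
          ring
      _ ≤ _ := by
          have : (v : ℝ) * Real.log 2 ≤ v := mul_le_of_le_one_right (Nat.cast_nonneg v)
            (by linarith [Real.log_two_lt_d9])
          rw [add_comm (v : ℝ)]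
          gcongr
  calc ∑ A ∈ P, (1 + Real.log ((M : ℝ) ^ 2 / A))
      ≤ ∑ A ∈ P, 2 * (#((range (2 * M)).filter fun v : ℕ => (2 : ℝ) ^ v ≤ (M : ℝ) ^ 2 / A) : ℝ) :=
        sum_le_sum h1
    _ = 2 * ∑ v ∈ range (2 * M), (#(P.filter fun A : ℕ => (2 : ℝ) ^ v ≤ (M : ℝ) ^ 2 / A) : ℝ) := by
        rw [← mul_sum]
        congr 1
        rw [← Nat.cast_sum, ← Nat.cast_sum, Nat.cast_inj]
        exact sum_card_bipartiteAbove_eq_sum_card_bipartiteBelow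
          (fun (A : ℕ) (v : ℕ) => (2 : ℝ) ^ v ≤ (M : ℝ) ^ 2 / A)
    _ ≤ 2 * ∑ v ∈ range (2 * M), C * (M : ℝ) ^ 2 * (((v : ℝ) + 1) * (1 / 2) ^ v) := by
        gcongr with v hv
        exact h2 v hv
    _ = 2 * (C * (M : ℝ) ^ 2 * ∑ v ∈ range (2 * M), ((v : ℝ) + 1) * (1 / 2) ^ v) := by
        rw [← mul_sum]
    _ ≤ 2 * (C * (M : ℝ) ^ 2 * 4) := by
        gcongr
        exact sum_add_one_mul_half_pow_le _
    _ = _ := by ring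

lemma card_filter_natCast_le (P : Finset ℕ) (hP : ∀ n ∈ P, 1 ≤ n) {y : ℝ} (hy : 0 ≤ y) :
    (#(P.filter fun n : ℕ => (n : ℝ) ≤ y) : ℝ) ≤ y := by
  have h1 : P.filter (fun n : ℕ => (n : ℝ) ≤ y) ⊆ Icc 1 ⌊y⌋₊ := fun n hn =>
    mem_Icc.2 ⟨hP n (mem_filter.1 hn).1, Nat.le_floor (mem_filter.1 hn).2⟩
  have h2 := card_le_card h1
  rw [Nat.card_Icc, Nat.add_sub_cancel] at h2
  exact (Nat.cast_le.2 h2).trans (Nat.floor_le hy)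

lemma sum_inv_mul_card_le : ∃ C M₀ : ℝ, 0 < C ∧ 3 ≤ M₀ ∧ ∀ M : ℕ, M₀ ≤ M → ∀ κ : ℝ, 1 ≤ κ →
    ∑ A ∈ mulTable M, (A : ℝ)⁻¹ * #((mulTable M).filter fun B : ℕ => (B : ℝ) ≤ κ * A) ≤
      κ * ((M : ℝ) ^ (31 / 16 : ℝ) + C * ((M : ℝ) * saving M) ^ 2) := by
  obtain ⟨C, M₀, hC, hM₀, hcard⟩ := card_mulTable_le
  refine ⟨8 * C ^ 2, M₀, by positivity, hM₀, fun M hM κ hκ => ?_⟩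
  have hM3 : (3 : ℝ) ≤ M := hM₀.trans hM
  have hM0 : (0 : ℝ) < M := by linarith
  have hg := saving_nonneg hM3
  have hp : (M : ℝ) ^ (31 / 16 : ℝ) ≤ (M : ℝ) ^ 2 := by
    rw [← Real.rpow_natCast]
    exact Real.rpow_le_rpow_of_exponent_le (by linarith) (by norm_num)
  have hpos : ∀ n ∈ mulTable M, 1 ≤ n := fun n hn => (mem_mulTable_bounds hn).1
  have hsum := sum_one_add_log_mulTable_le (M := M) (C := C * saving M)
    (by exact_mod_cast hM0) (by positivity) (fun x hx hxM => (hcard M hM x hx hxM).trans_eq (by ring))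
  rw [← sum_filter_add_sum_filter_not (mulTable M) fun n : ℕ => (M : ℝ) ^ (31 / 16 : ℝ) ≤ n]
  have hlarge : ∑ A ∈ (mulTable M).filter fun n : ℕ => (M : ℝ) ^ (31 / 16 : ℝ) ≤ n,
      (A : ℝ)⁻¹ * #((mulTable M).filter fun B : ℕ => (B : ℝ) ≤ κ * A) ≤
      κ * (8 * C ^ 2 * ((M : ℝ) * saving M) ^ 2) := by
    calc _ ≤ ∑ A ∈ (mulTable M).filter fun n : ℕ => (M : ℝ) ^ (31 / 16 : ℝ) ≤ n,
          κ * (C * saving M) * (1 + Real.log ((M : ℝ) ^ 2 / A)) := by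
          refine sum_le_sum fun A hA => ?_
          obtain ⟨hA, hAM⟩ := mem_filter.1 hA
          obtain ⟨hA1, hA2⟩ := mem_mulTable_bounds hA
          have hA0 : (0 : ℝ) < A := by exact_mod_cast hA1
          have hA2' : (A : ℝ) ≤ (M : ℝ) ^ 2 := by exact_mod_cast hA2
          have hl : 0 ≤ Real.log ((M : ℝ) ^ 2 / A) := Real.log_nonneg (by rwa [one_le_div hA0])
          rw [inv_mul_le_iff₀ hA0]
          have hAκ : (A : ℝ) ≤ κ * A := le_mul_of_one_le_left hA0.le hκ
          by_cases hκA : κ * A ≤ (M : ℝ) ^ 2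
          · refine (hcard M hM (κ * A) (hAM.trans hAκ) hκA).trans ?_
            have : Real.log ((M : ℝ) ^ 2 / (κ * A)) ≤ Real.log ((M : ℝ) ^ 2 / A) :=
              Real.log_le_log (by positivity) (by gcongr)
            calc C * ((1 + Real.log ((M : ℝ) ^ 2 / (κ * A))) * (κ * A) * saving M)
                ≤ C * ((1 + Real.log ((M : ℝ) ^ 2 / A)) * (κ * A) * saving M) := by gcongr
              _ = _ := by ring
          · have h1 := hcard M hM _ hp le_rfl
            rw [div_self (by positivity), Real.log_one, add_zero, one_mul] at h1
            calc (#((mulTable M).filter fun B : ℕ => (B : ℝ) ≤ κ * A) : ℝ)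
                ≤ #((mulTable M).filter fun B : ℕ => (B : ℝ) ≤ (M : ℝ) ^ 2) := by
                  refine Nat.cast_le.2 (card_le_card fun B hB => mem_filter.2 ⟨(mem_filter.1 hB).1, ?_⟩)
                  exact_mod_cast (mem_mulTable_bounds (mem_filter.1 hB).1).2
              _ ≤ C * ((M : ℝ) ^ 2 * saving M) := h1
              _ ≤ C * ((κ * A) * saving M) := by
                  gcongr
                  exact (not_le.1 hκA).le
              _ = A * (κ * (C * saving M) * 1) := by ring
              _ ≤ _ := by
                  gcongr
                  linarith
      _ = κ * (C * saving M) * ∑ A ∈ (mulTable M).filter fun n : ℕ => (M : ℝ) ^ (31 / 16 : ℝ) ≤ n,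
          (1 + Real.log ((M : ℝ) ^ 2 / A)) := by rw [mul_sum]
      _ ≤ κ * (C * saving M) * (8 * (C * saving M) * (M : ℝ) ^ 2) := by gcongr
      _ = _ := by ring
  have hsmall : ∑ A ∈ (mulTable M).filter fun n : ℕ => ¬ (M : ℝ) ^ (31 / 16 : ℝ) ≤ n,
      (A : ℝ)⁻¹ * #((mulTable M).filter fun B : ℕ => (B : ℝ) ≤ κ * A) ≤
      κ * (M : ℝ) ^ (31 / 16 : ℝ) := by
    calc _ ≤ ∑ A ∈ (mulTable M).filter fun n : ℕ => ¬ (M : ℝ) ^ (31 / 16 : ℝ) ≤ n, κ := by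
          refine sum_le_sum fun A hA => ?_
          have hA0 : (0 : ℝ) < A := by exact_mod_cast hpos A (mem_filter.1 hA).1
          rw [inv_mul_le_iff₀ hA0, mul_comm (A : ℝ)]
          exact card_filter_natCast_le _ hpos (by positivity)
      _ = κ * #((mulTable M).filter fun n : ℕ => ¬ (M : ℝ) ^ (31 / 16 : ℝ) ≤ n) := by
          rw [sum_const, nsmul_eq_mul, mul_comm]
      _ ≤ κ * #((mulTable M).filter fun n : ℕ => (n : ℝ) ≤ (M : ℝ) ^ (31 / 16 : ℝ)) := by
          gcongr with n
          exact fun h => (not_le.1 h).le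
      _ ≤ _ := by
          gcongr
          exact card_filter_natCast_le _ hpos (by positivity)
  linarith

/-- The `α` for which some pair of products in the `M × M` multiplication table nearly vanishes. -/
def nearRatioSet (M : ℕ) (κ ε : ℝ) : Set ℝ :=
  {α | ∃ A ∈ mulTable M, ∃ B ∈ mulTable M, (B : ℝ) ≤ κ * A ∧ |α * A - B| ≤ ε}

lemma volume_nearRatioSet_le (M : ℕ) (κ : ℝ) {ε : ℝ} (hε : 0 ≤ ε) :
    volume (nearRatioSet M κ ε) ≤ ENNReal.ofReal (2 * ε *
      ∑ A ∈ mulTable M, (A : ℝ)⁻¹ * #((mulTable M).filter fun B : ℕ => (B : ℝ) ≤ κ * A)) := by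
  have hsub : nearRatioSet M κ ε ⊆ ⋃ A ∈ mulTable M,
      ⋃ B ∈ (mulTable M).filter fun B : ℕ => (B : ℝ) ≤ κ * A,
        Metric.closedBall ((B : ℝ) / A) (ε / A) := by
    rintro α ⟨A, hA, B, hB, hBA, h⟩
    have hA0 : (0 : ℝ) < A := by exact_mod_cast (mem_mulTable_bounds hA).1
    simp only [Set.mem_iUnion]
    refine ⟨A, hA, B, mem_filter.2 ⟨hB, hBA⟩, ?_⟩
    rw [Metric.mem_closedBall, Real.dist_eq, le_div_iff₀ hA0]
    calc |α - B / A| * A = |(α - B / A) * A| := by rw [abs_mul, abs_of_pos hA0]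
      _ = |α * A - B| := by rw [sub_mul, div_mul_cancel₀ _ hA0.ne']
      _ ≤ ε := h
  calc volume (nearRatioSet M κ ε) ≤ _ := measure_mono hsub
    _ ≤ ∑ A ∈ mulTable M, volume (⋃ B ∈ (mulTable M).filter fun B : ℕ => (B : ℝ) ≤ κ * A,
        Metric.closedBall ((B : ℝ) / A) (ε / A)) := measure_biUnion_finset_le _ _
    _ ≤ ∑ A ∈ mulTable M, ENNReal.ofReal (2 * ε *
        ((A : ℝ)⁻¹ * #((mulTable M).filter fun B : ℕ => (B : ℝ) ≤ κ * A))) := by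
        refine sum_le_sum fun A hA => (measure_biUnion_finset_le _ _).trans ?_
        simp only [Real.volume_closedBall, sum_const, nsmul_eq_mul]
        rw [← ENNReal.ofReal_natCast, ← ENNReal.ofReal_mul (Nat.cast_nonneg _)]
        refine ENNReal.ofReal_le_ofReal (le_of_eq ?_)
        ring
    _ = _ := by
        rw [mul_sum, ENNReal.ofReal_sum_of_nonneg fun A _ => by positivity]

lemma erdosC_nonneg : 0 ≤ erdosC := by
  have hl2 : 0 < Real.log 2 := Real.log_pos (by norm_num)
  rw [erdosC, sub_nonneg, div_le_one hl2]
  linarith [Real.log_le_sub_one_of_pos hl2]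

lemma summable_inv_mul_log_rpow :
    Summable fun t : ℕ => (t : ℝ)⁻¹ * Real.log (t + 2) ^ (-(26 / 25) : ℝ) := by
  have hlog : ∀ t : ℕ, 0 < Real.log ((t : ℝ) + 2) := fun t =>
    Real.log_pos (by linarith [(Nat.cast_nonneg t : (0 : ℝ) ≤ t)])
  rw [← summable_condensed_iff_of_nonneg]
  · rw [← summable_nat_add_iff 1]
    refine Summable.of_nonneg_of_le (f := fun k : ℕ => 4 * ((k + 1 : ℕ) : ℝ) ^ (-(26 / 25) : ℝ))
      (fun k => mul_nonneg (by positivity) (mul_nonneg (by positivity)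
        (Real.rpow_nonneg (hlog _).le _))) (fun k => ?_) ?_
    · have hk : (0 : ℝ) < ((k + 1 : ℕ) : ℝ) := by positivity
      have h1 : ((k + 1 : ℕ) : ℝ) / 2 ≤ Real.log (((2 ^ (k + 1) : ℕ) : ℝ) + 2) := by
        calc ((k + 1 : ℕ) : ℝ) / 2 ≤ (k + 1 : ℕ) * Real.log 2 := by
              nlinarith [Real.log_two_gt_d9]
          _ = Real.log (2 ^ (k + 1)) := (Real.log_pow _ _).symm
          _ ≤ _ := by
              refine Real.log_le_log (by positivity) ?_
              push_cast
              linarith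
      have h2 : (2 : ℝ) ^ (26 / 25 : ℝ) ≤ 4 := by
        calc (2 : ℝ) ^ (26 / 25 : ℝ) ≤ 2 ^ (2 : ℝ) :=
              Real.rpow_le_rpow_of_exponent_le (by norm_num) (by norm_num)
          _ = 4 := by norm_num
      rw [Nat.cast_pow, Nat.cast_ofNat, ← mul_assoc, mul_inv_cancel₀ (by positivity), one_mul]
      rw [Nat.cast_pow, Nat.cast_ofNat] at h1
      calc Real.log ((2 : ℝ) ^ (k + 1) + 2) ^ (-(26 / 25) : ℝ)
          ≤ (((k + 1 : ℕ) : ℝ) / 2) ^ (-(26 / 25) : ℝ) :=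
            Real.rpow_le_rpow_of_nonpos (by positivity) h1 (by norm_num)
        _ = 2 ^ (26 / 25 : ℝ) * ((k + 1 : ℕ) : ℝ) ^ (-(26 / 25) : ℝ) := by
            rw [Real.div_rpow hk.le (by norm_num), Real.rpow_neg (by norm_num : (0 : ℝ) ≤ 2)]
            field_simp
        _ ≤ _ := by gcongr
    · exact ((summable_nat_add_iff 1).2 (Real.summable_nat_rpow.2 (by norm_num))).mul_left 4
  · exact fun t => mul_nonneg (by positivity) (Real.rpow_nonneg (hlog t).le _)
  · intro m n hm hmn
    have hm0 : (0 : ℝ) < m := by exact_mod_cast hm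
    have hmn' : (m : ℝ) ≤ n := by exact_mod_cast hmn
    have h1 : Real.log ((n : ℝ) + 2) ^ (-(26 / 25) : ℝ) ≤ Real.log ((m : ℝ) + 2) ^ (-(26 / 25) : ℝ) :=
      Real.rpow_le_rpow_of_nonpos (hlog m) (Real.log_le_log (by positivity) (by linarith))
        (by norm_num)
    have h2 : (0 : ℝ) ≤ Real.log ((n : ℝ) + 2) ^ (-(26 / 25) : ℝ) := Real.rpow_nonneg (hlog n).le _
    exact mul_le_mul (inv_anti₀ hm0 hmn') h1 h2 (by positivity)

/-- The gap threshold for indices of size about `4 ^ t`. -/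
noncomputable def gapBound (t : ℕ) : ℝ := (t : ℝ) ^ (2 * erdosC - 1) / 4 ^ t

lemma gapBound_nonneg (t : ℕ) : 0 ≤ gapBound t := by
  rw [gapBound]
  positivity

lemma saving_mul_two_pow_sq_le {D t : ℕ} (hD : 1 ≤ D) (ht : 2 ≤ t) :
    saving ((D * 2 ^ (t + 2) : ℕ) : ℝ) ^ 2 ≤
      16 * ((t : ℝ) ^ (-(2 * erdosC)) * Real.log (t + 2) ^ (-(26 / 25) : ℝ)) := by
  have ht2 : (2 : ℝ) ≤ t := by exact_mod_cast ht
  have hD1 : (1 : ℝ) ≤ D := by exact_mod_cast hD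
  have hc := erdosC_nonneg
  have hc2 := erdosC_lt_half
  set M : ℝ := ((D * 2 ^ (t + 2) : ℕ) : ℝ) with hM
  have hlM : ((t : ℝ) + 2) / 2 ≤ Real.log M := by
    calc ((t : ℝ) + 2) / 2 ≤ (t + 2 : ℕ) * Real.log 2 := by
          push_cast
          nlinarith [Real.log_two_gt_d9]
      _ = Real.log (2 ^ (t + 2)) := (Real.log_pow _ _).symm
      _ ≤ Real.log M := by
          refine Real.log_le_log (by positivity) ?_
          rw [hM]
          push_cast
          exact le_mul_of_one_le_left (by positivity) hD1
  have hl2 : 0 < Real.log ((t : ℝ) + 2) := Real.log_pos (by linarith)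
  have hllM : Real.log (t + 2) / 2 ≤ Real.log (Real.log M) := by
    refine le_trans ?_ (Real.log_le_log (by positivity) hlM)
    have h4 : 2 * Real.log 2 ≤ Real.log ((t : ℝ) + 2) := by
      have h5 : Real.log ((2 : ℝ) ^ 2) ≤ Real.log ((t : ℝ) + 2) :=
        Real.log_le_log (by norm_num) (by linarith)
      rw [Real.log_pow] at h5
      exact_mod_cast h5
    rw [Real.log_div (by positivity) (by norm_num)]
    linarith
  have hhalf : ∀ {y s : ℝ}, 0 < y → 0 ≤ s → s ≤ 1 → (y / 2) ^ (-s) ≤ 2 * y ^ (-s) := by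
    intro y s hy hs0 hs1
    rw [Real.div_rpow hy.le (by norm_num), Real.rpow_neg (by norm_num : (0 : ℝ) ≤ 2), div_inv_eq_mul,
      mul_comm]
    have : (2 : ℝ) ^ s ≤ 2 ^ (1 : ℝ) := Real.rpow_le_rpow_of_exponent_le (by norm_num) hs1
    rw [Real.rpow_one] at this
    gcongr
  have h1 : Real.log M ^ (-erdosC) ≤ 2 * (t : ℝ) ^ (-erdosC) :=
    (Real.rpow_le_rpow_of_nonpos (by positivity) (by linarith : (t : ℝ) / 2 ≤ _) (by linarith)).trans
      (hhalf (by linarith) hc (by linarith))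
  have h2 : Real.log (Real.log M) ^ (-(13 / 25) : ℝ) ≤ 2 * Real.log (t + 2) ^ (-(13 / 25) : ℝ) :=
    (Real.rpow_le_rpow_of_nonpos (by positivity) hllM (by norm_num)).trans
      (hhalf hl2 (by norm_num) (by norm_num))
  have h3 : 0 ≤ Real.log (Real.log M) := le_trans (by positivity) hllM
  have h4 : 0 ≤ Real.log M := le_trans (by positivity) hlM
  calc saving M ^ 2 ≤ ((2 * (t : ℝ) ^ (-erdosC)) * (2 * Real.log (t + 2) ^ (-(13 / 25) : ℝ))) ^ 2 := by
        rw [saving]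
        gcongr
    _ = 16 * (((t : ℝ) ^ (-erdosC)) ^ 2 * (Real.log (t + 2) ^ (-(13 / 25) : ℝ)) ^ 2) := by ring
    _ = _ := by
        rw [← Real.rpow_natCast, ← Real.rpow_natCast, ← Real.rpow_mul (by positivity),
          ← Real.rpow_mul hl2.le]
        congr 3
        · push_cast
          ring
        · norm_num

lemma tsum_volume_nearRatioSet_ne_top (D : ℕ) (hD : 1 ≤ D) (κ : ℝ) (hκ : 1 ≤ κ) :
    ∃ t₀ : ℕ, ∑' t : ℕ, volume (nearRatioSet (D * 2 ^ (t + t₀ + 2)) κ (gapBound (t + t₀))) ≠ ⊤ := by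
  obtain ⟨C, M₀, hC, hM₀, hsum⟩ := sum_inv_mul_card_le
  refine ⟨⌈M₀⌉₊ + 2, ?_⟩
  set t₀ := ⌈M₀⌉₊ + 2
  have hD0 : (0 : ℝ) < D := by exact_mod_cast hD
  set b : ℕ → ℝ := fun t => 2 * κ * (4 * D) ^ (31 / 16 : ℝ) * ((2 : ℝ) ^ (-(1 / 16) : ℝ)) ^ t +
    512 * κ * C * D ^ 2 * ((t : ℝ)⁻¹ * Real.log (t + 2) ^ (-(26 / 25) : ℝ)) with hb
  have hbs : Summable b := by
    refine Summable.add (Summable.mul_left _ ?_) (summable_inv_mul_log_rpow.mul_left _)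
    exact summable_geometric_of_lt_one (by positivity)
      (Real.rpow_lt_one_of_one_lt_of_neg (by norm_num) (by norm_num))
  have hb0 : ∀ t, 0 ≤ b t := by
    intro t
    have : 0 ≤ Real.log ((t : ℝ) + 2) :=
      Real.log_nonneg (by linarith [(Nat.cast_nonneg t : (0 : ℝ) ≤ t)])
    simp only [hb]
    positivity
  have hle : ∀ t, volume (nearRatioSet (D * 2 ^ (t + t₀ + 2)) κ (gapBound (t + t₀))) ≤
      ENNReal.ofReal (b (t + t₀)) := by
    intro t
    set s := t + t₀ with hs
    have hs2 : 2 ≤ s := by omega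
    have hs1 : (1 : ℝ) ≤ s := by exact_mod_cast (by omega : 1 ≤ s)
    have hs0 : (0 : ℝ) < s := by linarith
    have hMs : M₀ ≤ ((D * 2 ^ (s + 2) : ℕ) : ℝ) := by
      refine (Nat.le_ceil M₀).trans (Nat.cast_le.2 ?_)
      calc ⌈M₀⌉₊ ≤ s + 2 := by omega
        _ ≤ 2 ^ (s + 2) := Nat.lt_two_pow_self.le
        _ ≤ _ := Nat.le_mul_of_pos_left _ hD
    refine (volume_nearRatioSet_le _ κ (gapBound_nonneg s)).trans (ENNReal.ofReal_le_ofReal ?_)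
    have hsv := saving_mul_two_pow_sq_le hD hs2
    have hε : gapBound s ≤ ((4 : ℝ) ^ s)⁻¹ := by
      rw [gapBound, div_eq_mul_inv]
      exact mul_le_of_le_one_left (by positivity)
        (Real.rpow_le_one_of_one_le_of_nonpos hs1 (by linarith [erdosC_lt_half]))
    have hε0 := gapBound_nonneg s
    set M : ℕ := D * 2 ^ (s + 2) with hM
    have hM' : (M : ℝ) = 4 * D * 2 ^ s := by
      rw [hM]
      push_cast
      ring
    have t1 : gapBound s * (M : ℝ) ^ (31 / 16 : ℝ) ≤
        (4 * D) ^ (31 / 16 : ℝ) * ((2 : ℝ) ^ (-(1 / 16) : ℝ)) ^ s := by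
      calc gapBound s * (M : ℝ) ^ (31 / 16 : ℝ) ≤ ((4 : ℝ) ^ s)⁻¹ * (M : ℝ) ^ (31 / 16 : ℝ) := by
            gcongr
        _ = (4 * D) ^ (31 / 16 : ℝ) * (((4 : ℝ) ^ s)⁻¹ * ((2 : ℝ) ^ s) ^ (31 / 16 : ℝ)) := by
            rw [hM', Real.mul_rpow (by positivity) (by positivity)]
            ring
        _ = _ := by
            congr 1
            have h4 : (4 : ℝ) ^ s = 2 ^ ((2 : ℝ) * s) := by
              rw [Real.rpow_mul (by norm_num), Real.rpow_natCast]
              norm_num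
            rw [h4, ← Real.rpow_natCast, ← Real.rpow_natCast, ← Real.rpow_mul (by norm_num),
              ← Real.rpow_mul (by norm_num), ← Real.rpow_neg (by norm_num),
              ← Real.rpow_add (by norm_num)]
            congr 1
            ring
    have t2 : gapBound s * ((M : ℝ) * saving M) ^ 2 ≤
        256 * D ^ 2 * ((s : ℝ)⁻¹ * Real.log (s + 2) ^ (-(26 / 25) : ℝ)) := by
      calc gapBound s * ((M : ℝ) * saving M) ^ 2 = gapBound s * (M : ℝ) ^ 2 * saving M ^ 2 := by ring
        _ ≤ gapBound s * (M : ℝ) ^ 2 *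
            (16 * ((s : ℝ) ^ (-(2 * erdosC)) * Real.log (s + 2) ^ (-(26 / 25) : ℝ))) := by gcongr
        _ = 256 * D ^ 2 * (((s : ℝ) ^ (2 * erdosC - 1) * (s : ℝ) ^ (-(2 * erdosC))) *
            Real.log (s + 2) ^ (-(26 / 25) : ℝ)) := by
            have h4 : ((2 : ℝ) ^ s) ^ 2 = 4 ^ s := by
              rw [← pow_mul, mul_comm, pow_mul]
              norm_num
            rw [gapBound, hM', mul_pow, h4]
            field_simp
            ring
        _ = _ := by
            rw [← Real.rpow_add hs0, ← Real.rpow_neg_one]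
            ring_nf
    calc 2 * gapBound s * _ ≤ 2 * gapBound s *
          (κ * ((M : ℝ) ^ (31 / 16 : ℝ) + C * ((M : ℝ) * saving M) ^ 2)) := by
          gcongr
          exact hsum M hMs κ hκ
      _ = 2 * κ * (gapBound s * (M : ℝ) ^ (31 / 16 : ℝ)) +
          2 * κ * C * (gapBound s * ((M : ℝ) * saving M) ^ 2) := by ring
      _ ≤ 2 * κ * ((4 * D) ^ (31 / 16 : ℝ) * ((2 : ℝ) ^ (-(1 / 16) : ℝ)) ^ s) +
          2 * κ * C * (256 * D ^ 2 * ((s : ℝ)⁻¹ * Real.log (s + 2) ^ (-(26 / 25) : ℝ))) := by gcongr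
      _ = b s := by
          simp only [hb]
          ring
  refine ne_top_of_le_ne_top ?_ (ENNReal.tsum_le_tsum hle)
  rw [← ENNReal.ofReal_tsum_of_nonneg (fun t => hb0 _) ((summable_nat_add_iff t₀).2 hbs)]
  exact ENNReal.ofReal_ne_top

lemma ae_eventually_notMem_nearRatioSet (D : ℕ) (hD : 1 ≤ D) (κ : ℝ) (hκ : 1 ≤ κ) :
    ∀ᵐ α ∂(volume : Measure ℝ),
      ∀ᶠ t : ℕ in atTop, α ∉ nearRatioSet (D * 2 ^ (t + 2)) κ (gapBound t) := by
  obtain ⟨t₀, ht₀⟩ := tsum_volume_nearRatioSet_ne_top D hD κ hκ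
  filter_upwards [ae_eventually_notMem ht₀] with α hα
  rw [← map_add_atTop_eq_nat t₀, eventually_map]
  exact hα

lemma eq_of_irrational_mul_sq_add_sq {α : ℝ} (hα : Irrational α) {m n m' n' : ℕ}
    (h : α * (m : ℝ) ^ 2 + (n : ℝ) ^ 2 = α * (m' : ℝ) ^ 2 + (n' : ℝ) ^ 2) : m = m' ∧ n = n' := by
  have hm : m = m' := by
    by_contra hne
    have hz : ((m : ℤ) ^ 2 - (m' : ℤ) ^ 2) ≠ 0 := by
      rw [sub_ne_zero]
      intro h2
      exact hne (Nat.pow_left_injective two_ne_zero (by exact_mod_cast h2))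
    refine (hα.mul_intCast hz).ne_int ((n' : ℤ) ^ 2 - (n : ℤ) ^ 2) ?_
    push_cast
    linarith
  subst hm
  refine ⟨rfl, ?_⟩
  have h2 : (n : ℝ) ^ 2 = (n' : ℝ) ^ 2 := by linarith
  exact Nat.pow_left_injective two_ne_zero (by exact_mod_cast h2)

lemma exists_of_one_le {α : ℝ} {lam : ℕ → ℝ} (h : IsSpectrumEnum α lam) {k : ℕ} (hk : 1 ≤ k) :
    ∃ m n : ℕ, 1 ≤ m ∧ 1 ≤ n ∧ lam k = α * (m : ℝ) ^ 2 + (n : ℝ) ^ 2 := by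
  have h1 : lam k ∈ {x : ℝ | ∃ k : ℕ, 1 ≤ k ∧ lam k = x} := ⟨k, hk, rfl⟩
  rw [h.2.2] at h1
  exact h1

lemma lam_le_of_lt_sq {α : ℝ} {lam : ℕ → ℝ} (h : IsSpectrumEnum α lam)
    (hα : Irrational α) (hα0 : 0 < α) {N R : ℕ} (hR : N < R ^ 2) :
    lam (N + 1) ≤ (α + 1) * (R : ℝ) ^ 2 := by
  by_contra! hlt
  have hmap : ∀ z ∈ (Icc 1 R) ×ˢ (Icc 1 R),
      α * (z.1 : ℝ) ^ 2 + (z.2 : ℝ) ^ 2 ∈ (Icc 1 N).image lam := by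
    rintro ⟨m, n⟩ hz
    obtain ⟨hm, hn⟩ := mem_product.1 hz
    rw [mem_Icc] at hm hn
    have hmem : α * (m : ℝ) ^ 2 + (n : ℝ) ^ 2 ∈ {x : ℝ | ∃ k : ℕ, 1 ≤ k ∧ lam k = x} := by
      rw [h.2.2]
      exact ⟨m, n, hm.1, hn.1, rfl⟩
    obtain ⟨k, hk1, hk⟩ := hmem
    refine mem_image.2 ⟨k, mem_Icc.2 ⟨hk1, ?_⟩, hk⟩
    by_contra! hkN
    have hle : lam (N + 1) ≤ lam k := by
      rcases (Nat.succ_le_of_lt hkN).eq_or_lt with he | hl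
      · exact le_of_eq (congrArg lam he)
      · exact (h.1 _ _ (by omega) hl).le
    have hmR : (m : ℝ) ≤ R := by exact_mod_cast hm.2
    have hnR : (n : ℝ) ≤ R := by exact_mod_cast hn.2
    have h1 : α * (m : ℝ) ^ 2 + (n : ℝ) ^ 2 ≤ α * (R : ℝ) ^ 2 + (R : ℝ) ^ 2 := by gcongr
    linarith
  have hinj : Set.InjOn (fun z : ℕ × ℕ => α * (z.1 : ℝ) ^ 2 + (z.2 : ℝ) ^ 2)
      ((Icc 1 R) ×ˢ (Icc 1 R) : Finset (ℕ × ℕ)) := by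
    intro z _ w _ hzw
    obtain ⟨h1, h2⟩ := eq_of_irrational_mul_sq_add_sq hα hzw
    exact Prod.ext h1 h2
  have hcard := card_le_card_of_injOn _ hmap hinj
  have h2 := hcard.trans card_image_le
  rw [card_product, Nat.card_Icc, Nat.card_Icc] at h2
  simp only [Nat.add_sub_cancel] at h2
  rw [sq] at hR
  omega

lemma exists_gap_le_of_bDeltaMin_le {lam : ℕ → ℝ} {N : ℕ} (hN : 1 ≤ N) {ε : ℝ}
    (h : bDeltaMin lam N ≤ ε) : ∃ k, 1 ≤ k ∧ k ≤ N ∧ lam (k + 1) - lam k ≤ ε := by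
  set s := {x : ℝ | ∃ k : ℕ, 1 ≤ k ∧ k ≤ N ∧ x = lam (k + 1) - lam k} with hs
  have hfin : s.Finite := by
    refine ((Set.finite_Icc 1 N).image fun k => lam (k + 1) - lam k).subset ?_
    rintro x ⟨k, hk1, hk2, rfl⟩
    exact ⟨k, ⟨hk1, hk2⟩, rfl⟩
  have hne : s.Nonempty := ⟨_, 1, le_rfl, hN, rfl⟩
  obtain ⟨k, hk1, hk2, hk⟩ := hne.csInf_mem hfin
  exact ⟨k, hk1, hk2, hk ▸ h⟩

lemma natCast_sq_sub_sq {a b : ℕ} (h : b ≤ a) :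
    (((a - b) * (a + b) : ℕ) : ℝ) = (a : ℝ) ^ 2 - (b : ℝ) ^ 2 := by
  rw [Nat.cast_mul, Nat.cast_sub h, Nat.cast_add]
  ring

lemma sub_mul_add_mem_mulTable {M a b : ℕ} (h : b < a) (hM : a + b ≤ M) :
    (a - b) * (a + b) ∈ mulTable M :=
  mem_mulTable.2 ⟨a - b, a + b, ⟨by omega, by omega⟩, ⟨by omega, by omega⟩, rfl⟩

lemma mem_nearRatioSet_of_gap {α κ ε : ℝ} {M m n m' n' : ℕ} (hα0 : 0 < α) (hε1 : ε < 1)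
    (hεα : ε < α) (hκ : α + 1 ≤ κ) (hm : m + m' ≤ M) (hn : n + n' ≤ M)
    (h0 : α * (m' : ℝ) ^ 2 + (n' : ℝ) ^ 2 < α * (m : ℝ) ^ 2 + (n : ℝ) ^ 2)
    (h : α * (m : ℝ) ^ 2 + (n : ℝ) ^ 2 - (α * (m' : ℝ) ^ 2 + (n' : ℝ) ^ 2) ≤ ε) :
    α ∈ nearRatioSet M κ ε := by
  have hsq : ∀ a b : ℕ, a ≤ b → (a : ℝ) ^ 2 ≤ (b : ℝ) ^ 2 := fun a b hab => by gcongr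
  have hsq1 : ∀ a b : ℕ, a < b → (a : ℝ) ^ 2 + 1 ≤ (b : ℝ) ^ 2 := fun a b hab => by
    exact_mod_cast Nat.succ_le_of_lt (Nat.pow_lt_pow_left hab two_ne_zero)
  rcases lt_or_ge m' m with hmm | hmm
  · have h1 := hsq1 _ _ hmm
    have h2 : α ≤ α * (m : ℝ) ^ 2 - α * (m' : ℝ) ^ 2 := by nlinarith
    have hnn : n < n' := by
      by_contra! hnn
      have := hsq _ _ hnn
      linarith
    refine ⟨_, sub_mul_add_mem_mulTable hmm hm, _, sub_mul_add_mem_mulTable hnn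
      (by rwa [add_comm]), ?_, ?_⟩
    · rw [natCast_sq_sub_sq hmm.le, natCast_sq_sub_sq hnn.le]
      nlinarith
    · rw [natCast_sq_sub_sq hmm.le, natCast_sq_sub_sq hnn.le, abs_le]
      constructor <;> nlinarith
  · have h1 := mul_le_mul_of_nonneg_left (hsq _ _ hmm) hα0.le
    have hnn : n' < n := by
      by_contra! hnn
      have := hsq _ _ hnn
      linarith
    have h2 := hsq1 _ _ hnn
    have hmm' : m < m' := by
      refine hmm.lt_of_ne fun he => ?_
      rw [he] at h
      linarith
    have h3 := hsq1 _ _ hmm'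
    refine ⟨_, sub_mul_add_mem_mulTable hmm' (by rwa [add_comm]), _,
      sub_mul_add_mem_mulTable hnn hn, ?_, ?_⟩
    · rw [natCast_sq_sub_sq hmm'.le, natCast_sq_sub_sq hnn.le]
      nlinarith
    · rw [natCast_sq_sub_sq hmm'.le, natCast_sq_sub_sq hnn.le, abs_le]
      constructor <;> nlinarith

lemma mem_nearRatioSet_of_bDeltaMin_le {α : ℝ} {lam : ℕ → ℝ} (h : IsSpectrumEnum α lam)
    (hα : Irrational α) (hα0 : 0 < α) {D N t : ℕ} (hD : α + 1 ≤ D) (hD' : 1 ≤ α * D)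
    (hN1 : 4 ^ t ≤ N) (hN2 : N < 4 ^ (t + 1)) {ε : ℝ} (hε1 : ε < 1) (hεα : ε < α)
    (hN : bDeltaMin lam N ≤ ε) : α ∈ nearRatioSet (D * 2 ^ (t + 2)) D ε := by
  obtain ⟨k, hk1, hkN, hk⟩ := exists_gap_le_of_bDeltaMin_le
    ((Nat.one_le_pow t 4 (by norm_num)).trans hN1) hN
  obtain ⟨m, n, -, -, hmn⟩ := exists_of_one_le h (k := k + 1) (by omega)
  obtain ⟨m', n', -, -, hmn'⟩ := exists_of_one_le h hk1
  have hlt : lam k < lam (k + 1) := h.1 _ _ hk1 (Nat.lt_succ_self k)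
  have hle : lam (k + 1) ≤ (α + 1) * ((2 ^ (t + 1) : ℕ) : ℝ) ^ 2 := by
    refine le_trans ?_ (lam_le_of_lt_sq h hα hα0 (N := N) (R := 2 ^ (t + 1)) ?_)
    · rcases (Nat.succ_le_succ hkN).eq_or_lt with he | hl
      · exact le_of_eq (congrArg lam he)
      · exact (h.1 _ _ (by omega) hl).le
    · calc N < 4 ^ (t + 1) := hN2
        _ = (2 ^ (t + 1)) ^ 2 := by rw [← pow_mul, mul_comm, pow_mul]; norm_num
  have hD0 : (0 : ℝ) < D := by linarith
  have hbound : ∀ a b : ℕ, α * (a : ℝ) ^ 2 + (b : ℝ) ^ 2 ≤ (α + 1) * ((2 ^ (t + 1) : ℕ) : ℝ) ^ 2 →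
      a ≤ D * 2 ^ (t + 1) ∧ b ≤ D * 2 ^ (t + 1) := by
    intro a b hab
    have hX : (0 : ℝ) ≤ ((2 ^ (t + 1) : ℕ) : ℝ) ^ 2 := by positivity
    have h1 : (α + 1) * ((2 ^ (t + 1) : ℕ) : ℝ) ^ 2 ≤ D * ((2 ^ (t + 1) : ℕ) : ℝ) ^ 2 := by gcongr
    have hD1 : (1 : ℝ) ≤ D := by linarith
    constructor
    · have h2 : (a : ℝ) ^ 2 ≤ ((D * 2 ^ (t + 1) : ℕ) : ℝ) ^ 2 := by
        calc (a : ℝ) ^ 2 ≤ α * D * (a : ℝ) ^ 2 := le_mul_of_one_le_left (by positivity) hD'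
          _ = D * (α * (a : ℝ) ^ 2) := by ring
          _ ≤ D * (D * ((2 ^ (t + 1) : ℕ) : ℝ) ^ 2) := by
              exact mul_le_mul_of_nonneg_left (by linarith [sq_nonneg (b : ℝ)]) hD0.le
          _ = _ := by
              push_cast
              ring
      exact Nat.cast_le.1
        ((pow_le_pow_iff_left₀ (Nat.cast_nonneg a) (Nat.cast_nonneg _) two_ne_zero).1 h2)
    · have h2 : (b : ℝ) ^ 2 ≤ ((D * 2 ^ (t + 1) : ℕ) : ℝ) ^ 2 := by
        calc (b : ℝ) ^ 2 ≤ D * ((2 ^ (t + 1) : ℕ) : ℝ) ^ 2 := by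
              have : 0 ≤ α * (a : ℝ) ^ 2 := by positivity
              linarith
          _ ≤ D * (D * ((2 ^ (t + 1) : ℕ) : ℝ) ^ 2) := le_mul_of_one_le_left (by positivity) hD1
          _ = _ := by
              push_cast
              ring
      exact Nat.cast_le.1
        ((pow_le_pow_iff_left₀ (Nat.cast_nonneg b) (Nat.cast_nonneg _) two_ne_zero).1 h2)
  obtain ⟨b1, b2⟩ := hbound m n (hmn ▸ hle)
  obtain ⟨b3, b4⟩ := hbound m' n' (hmn' ▸ hlt.le.trans hle)
  have hpow : D * 2 ^ (t + 2) = D * 2 ^ (t + 1) + D * 2 ^ (t + 1) := by ring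
  refine mem_nearRatioSet_of_gap (m := m) (n := n) (m' := m') (n' := n') hα0 hε1 hεα hD
    (by omega) (by omega) ?_ ?_
  · rw [← hmn, ← hmn']
    exact hlt
  · rw [← hmn, ← hmn']
    exact hk

lemma threshold_le_gapBound {N t : ℕ} (ht : 1 ≤ t) (hN : 4 ^ t ≤ N) :
    L N ^ (2 * erdosC) / ((N : ℝ) * L N) ≤ gapBound t := by
  have ht0 : (0 : ℝ) < t := by exact_mod_cast ht
  have hN' : (4 : ℝ) ^ t ≤ N := by exact_mod_cast hN
  have hN0 : (0 : ℝ) < N := lt_of_lt_of_le (by positivity) hN'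
  have h4 : (1 : ℝ) ≤ Real.log 4 := by
    rw [Real.le_log_iff_exp_le (by norm_num)]
    linarith [Real.exp_one_lt_d9]
  have hL : (t : ℝ) ≤ L N := by
    calc (t : ℝ) ≤ t * Real.log 4 := le_mul_of_one_le_right ht0.le h4
      _ = Real.log (4 ^ t) := (Real.log_pow _ _).symm
      _ ≤ Real.log N := Real.log_le_log (by positivity) hN'
      _ ≤ _ := le_max_right _ _
  have hL0 : 0 < L N := ht0.trans_le hL
  calc L N ^ (2 * erdosC) / ((N : ℝ) * L N) = L N ^ (2 * erdosC - 1) / N := by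
        rw [Real.rpow_sub_one hL0.ne']
        field_simp
    _ ≤ (t : ℝ) ^ (2 * erdosC - 1) / 4 ^ t := by
        exact div_le_div₀ (by positivity)
          (Real.rpow_le_rpow_of_nonpos ht0 hL (by linarith [erdosC_lt_half])) (by positivity) hN'

lemma tendsto_gapBound : Tendsto gapBound atTop (nhds 0) := by
  refine squeeze_zero' (g := fun t : ℕ => ((1 : ℝ) / 4) ^ t) (Eventually.of_forall gapBound_nonneg)
    ?_ (tendsto_pow_atTop_nhds_zero_of_lt_one (by norm_num) (by norm_num))
  filter_upwards [eventually_ge_atTop 1] with t ht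
  rw [gapBound, one_div, inv_pow, div_eq_mul_inv]
  exact mul_le_of_le_one_left (by positivity) (Real.rpow_le_one_of_one_le_of_nonpos
    (by exact_mod_cast ht) (by linarith [erdosC_lt_half]))

lemma ae_irrational : ∀ᵐ α ∂(volume : Measure ℝ), Irrational α :=
  (Set.countable_range ((↑) : ℚ → ℝ)).ae_notMem volume

end BilliardGaps

theorem stmt12 :
    ∀ᵐ α ∂(volume : Measure ℝ), 0 < α →
      ∀ lam : ℕ → ℝ, IsSpectrumEnum α lam →
        {N : ℕ | bDeltaMin lam N ≤ (L N) ^ (2 * erdosC) / ((N : ℝ) * L N)}.Finite := by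
  have hbc : ∀ᵐ α ∂(volume : Measure ℝ), ∀ D : ℕ, 1 ≤ D → ∀ᶠ t : ℕ in atTop,
      α ∉ BilliardGaps.nearRatioSet (D * 2 ^ (t + 2)) D (BilliardGaps.gapBound t) := by
    rw [ae_all_iff]
    intro D
    by_cases hD : 1 ≤ D
    · filter_upwards [BilliardGaps.ae_eventually_notMem_nearRatioSet D hD D (by exact_mod_cast hD)]
        with α hα _ using hα
    · exact Eventually.of_forall fun α h => absurd h hD
  filter_upwards [hbc, BilliardGaps.ae_irrational] with α hα hirr hα0 lam hlam
  obtain ⟨D, hD⟩ := exists_nat_ge (α + 1 + α⁻¹)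
  have hinv : 0 < α⁻¹ := inv_pos.2 hα0
  have hDα : 1 ≤ α * D := by
    rw [← inv_le_iff_one_le_mul₀' hα0]
    linarith
  have hD1 : 1 ≤ D := by
    have : (1 : ℝ) ≤ D := by linarith
    exact_mod_cast this
  obtain ⟨t₀, ht₀⟩ := eventually_atTop.1 ((hα D hD1).and
    ((BilliardGaps.tendsto_gapBound.eventually_lt_const (lt_min one_pos hα0)).and
      (eventually_ge_atTop 1)))
  refine (Set.finite_lt_nat (4 ^ t₀)).subset fun N hN => ?_
  by_contra hlt
  have hN0 : 4 ^ t₀ ≤ N := not_lt.1 hlt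
  have hNne : N ≠ 0 := (lt_of_lt_of_le (by positivity) hN0).ne'
  have ht : t₀ ≤ Nat.log 4 N := Nat.le_log_of_pow_le (by norm_num) hN0
  obtain ⟨h1, h2, h3⟩ := ht₀ _ ht
  have hle := Nat.pow_log_le_self 4 hNne
  exact h1 (BilliardGaps.mem_nearRatioSet_of_bDeltaMin_le hlam hirr hα0 (by linarith) hDα hle
    (Nat.lt_pow_succ_log_self (by norm_num) N) (h2.trans_le (min_le_left _ _))
    (h2.trans_le (min_le_right _ _))
    (le_trans hN (BilliardGaps.threshold_le_gapBound h3 hle)))
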